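/- arXiv:math/0301304 — 3 statements merged into one kernel-verified Lean document; each statement's English description precedes it below -/
import Mathlib

section
/- The set of norm-compatible families (c_K)_K, indexed by the CM subfields K of ℂ of finite degree over ℚ, with c_K in the ideal class group Cl(𝓞_K) and Nm_{L/K}(c_L) = c_K whenever K ⊆ L, is uncountable. (Equivalently, the inverse limit over CM fields of the ideal class groups under the norm maps is uncountable.) -/
set_option synthInstance.maxHeartbeats 400000

open NumberField IntermediateField
open scoped nonZeroDivisors

/-- A subfield of `ℂ` is totally real if every field embedding of it into `ℂ`
has image contained in `ℝ`. -/
def TotallyReal (F : IntermediateField ℚ ℂ) : Prop :=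
  ∀ φ : F →+* ℂ, ∀ x : F, (φ x).im = 0

/-- A subfield of `ℂ` is a CM field if it is totally imaginary (no embedding into `ℂ`
lands in `ℝ`) and is a quadratic extension of a totally real subfield. -/
def IsCM (K : IntermediateField ℚ ℂ) : Prop :=
  (∀ φ : K →+* ℂ, ∃ x : K, (φ x).im ≠ 0) ∧
  ∃ (Kp : IntermediateField ℚ ℂ) (h : Kp ≤ K), TotallyReal Kp ∧
    (letI : Algebra Kp K := (IntermediateField.inclusion h).toRingHom.toAlgebra
     Module.finrank Kp K = 2)

instance (F : IntermediateField ℚ ℂ) [FiniteDimensional ℚ F] : NumberField F :=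
  NumberField.of_module_finite ℚ F

/-- The relative ideal norm `Nm_{L/F}` for subfields `F ⊆ L` of `ℂ`: the ideal of `𝓞 F`
generated by the field norms `Nm_{L/F}(x)` of the elements `x` of the given ideal of
`𝓞 L`. -/
noncomputable def idealNorm (F L : IntermediateField ℚ ℂ) (h : F ≤ L)
    (I : Ideal (𝓞 L)) : Ideal (𝓞 F) :=
  letI : Algebra F L := (IntermediateField.inclusion h).toRingHom.toAlgebra
  Ideal.span {y : 𝓞 F | ∃ x ∈ I, (y : F) = Algebra.norm F (x : L)}

section

open scoped NumberTheorySymbols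

namespace CMU

lemma J_two {n : ℕ} (hn : n % 8 = 1) : J(2 | n) = 1 := by
  rw [jacobiSym.at_two (Nat.odd_iff.mpr (by omega)), ZMod.χ₈_nat_eq_if_mod_eight]
  simp [hn]; omega

lemma J_neg_one {n : ℕ} (hn : n % 4 = 1) : J(-1 | n) = 1 := by
  rw [jacobiSym.at_neg_one (Nat.odd_iff.mpr (by omega)), ZMod.χ₄_nat_one_mod_four hn]

lemma J_natAbs {n : ℕ} (hn : n % 4 = 1) (a : ℤ) : J(a | n) = J(a.natAbs | n) := by
  rcases Int.natAbs_eq a with h | h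
  · rw [← h]
  · conv_lhs => rw [h, ← neg_one_mul, jacobiSym.mul_left, J_neg_one hn, one_mul]

lemma J_recip {n : ℕ} (hn : n % 4 = 1) {a : ℤ} (ha : Odd a) : J(a | n) = J(n | a.natAbs) := by
  rw [J_natAbs hn]
  exact jacobiSym.quadratic_reciprocity_one_mod_four' (Int.natAbs_odd.mpr ha) hn

lemma descent {p : ℕ} (hp : p.Prime) (hp8 : p % 8 = 1) :
    ∀ m : ℕ, m ≠ 0 → ¬ p ∣ m → ∀ k f v : ℤ, (m : ℤ) * k = f ^ 2 - p * v ^ 2 →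
    (∀ r : ℕ, r.Prime → r ≠ 2 → r ∣ m → (r : ℤ) ∣ k → (r : ℤ) ∣ f → (r : ℤ) ∣ v → False) →
    J(m | p) = 1 := by
  intro m
  induction m using Nat.strong_induction_on with
  | _ m ih =>
  intro hm0 hpm k f v hmk hc
  by_cases hm1 : m = 1
  · subst hm1; simp
  have hr := Nat.minFac_prime hm1
  obtain ⟨m1, hm1'⟩ := Nat.minFac_dvd m
  set r := m.minFac with hrdef
  have hm1pos : m1 ≠ 0 := by rintro rfl; simp at hm1'; exact hm0 hm1'
  have hlt : m1 < m := by
    rw [hm1']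
    have := hr.two_le
    have : 0 < m1 := Nat.pos_of_ne_zero hm1pos
    nlinarith
  have hpm1 : ¬ p ∣ m1 := fun h => hpm (hm1' ▸ Dvd.dvd.mul_left h _)
  by_cases hr2 : r = 2
  · have := ih m1 hlt hm1pos hpm1 (2 * k) f v (by
      rw [← hmk, hm1', hr2]; push_cast; ring) (by
      intro s hs hs2 h1 h2 h3 h4
      refine hc s hs hs2 (hm1' ▸ Dvd.dvd.mul_left h1 _) ?_ h3 h4
      refine ((Nat.prime_iff_prime_int.mp hs).dvd_or_dvd h2).resolve_left ?_
      intro h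
      have h' : s ∣ 2 := by exact_mod_cast h
      exact hs2 ((Nat.prime_dvd_prime_iff_eq hs Nat.prime_two).mp h'))
    rw [hm1', hr2]; push_cast
    rw [jacobiSym.mul_left, J_two hp8, this, one_mul]
  have hrI := Nat.prime_iff_prime_int.mp hr
  haveI : Fact r.Prime := ⟨hr⟩
  have hrm : (r : ℤ) ∣ m := by rw [hm1']; push_cast; exact dvd_mul_right _ _
  by_cases hrv : (r : ℤ) ∣ v
  · have hrf : (r : ℤ) ∣ f := by
      apply hrI.dvd_of_dvd_pow (n := 2)
      have : f ^ 2 = m * k + p * v ^ 2 := by rw [hmk]; ring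
      rw [this]
      exact dvd_add (hrm.mul_right _) ((hrv.pow two_ne_zero).mul_left _)
    have hrk : ¬ (r : ℤ) ∣ k := fun h => hc r hr hr2 (hm1' ▸ dvd_mul_right _ _) h hrf hrv
    obtain ⟨f1, rfl⟩ := hrf
    obtain ⟨v1, rfl⟩ := hrv
    have hr0 : (r : ℤ) ≠ 0 := by exact_mod_cast hr.ne_zero
    have h1 : (m1 : ℤ) * k = r * (f1 ^ 2 - p * v1 ^ 2) := by
      apply mul_left_cancel₀ hr0
      rw [← mul_assoc]
      have : (r : ℤ) * m1 = m := by rw [hm1']; push_cast; ring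
      rw [this, hmk]; ring
    have h2 : (r : ℤ) ∣ m1 := by
      refine (hrI.dvd_or_dvd ?_).resolve_right hrk
      exact ⟨_, h1⟩
    have h2' : r ∣ m1 := by exact_mod_cast h2
    obtain ⟨m2, rfl⟩ := h2'
    have := ih m2 (lt_of_le_of_lt (Nat.le_mul_of_pos_left _ hr.pos) hlt)
      (by rintro rfl; simp at hm1pos) (fun h => hpm1 (h.mul_left _)) k f1 v1 (by
        apply mul_left_cancel₀ hr0
        rw [← h1]; push_cast; ring) (by
        intro s hs hs2 a b c d
        exact hc s hs hs2 (hm1' ▸ (a.mul_left _).mul_left _) b (c.mul_left _) (d.mul_left _))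
    rw [hm1']
    have h3 : ((r * (r * m2) : ℕ) : ℤ) = (r : ℤ) ^ 2 * m2 := by push_cast; ring
    rw [h3, jacobiSym.mul_left, this, mul_one, jacobiSym.sq_one']
    have : Nat.Coprime r p := by
      rw [Nat.coprime_primes hr hp]
      rintro rfl
      exact hpm (hm1' ▸ dvd_mul_right _ _)
    simpa using this
  · have hJ : J(r | p) = 1 := by
      rw [jacobiSym.quadratic_reciprocity_one_mod_four' (hr.odd_of_ne_two hr2) (by omega)]
      have hcop : ((p : ℤ).gcd r) = 1 := by
        have : Nat.Coprime p r := by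
          rw [Nat.coprime_primes hp hr]
          rintro h
          exact hpm (hm1' ▸ h ▸ dvd_mul_right _ _)
        simpa using this
      rcases jacobiSym.eq_one_or_neg_one hcop with h | h
      · exact h
      · exact absurd (jacobiSym.prime_dvd_of_eq_neg_one h (hmk ▸ hrm.mul_right k)).2 hrv
    have := ih m1 hlt hm1pos hpm1 (r * k) f v (by
      rw [← hmk, hm1']; push_cast; ring) (by
      intro s hs hs2 h1 h2 h3 h4
      rcases (Nat.prime_iff_prime_int.mp hs).dvd_or_dvd h2 with h | h
      · have h' : s ∣ r := by exact_mod_cast h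
        rw [Nat.prime_dvd_prime_iff_eq hs hr] at h'
        exact hrv (h' ▸ h4)
      · exact hc s hs hs2 (hm1' ▸ Dvd.dvd.mul_left h1 _) h h3 h4)
    rw [hm1']; push_cast
    rw [jacobiSym.mul_left, hJ, this, one_mul]

lemma coprime_of_sq_add {n : ℕ} (hn : Squarefree n) {e f : ℤ} (h : (n : ℤ) = e ^ 2 + f ^ 2) :
    ∀ r : ℤ, Prime r → r ∣ e → r ∣ f → False := by
  rintro r hr ⟨a, rfl⟩ ⟨b, rfl⟩
  have : r * r ∣ (n : ℤ) := ⟨a ^ 2 + b ^ 2, by rw [h]; ring⟩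
  have h2 := Int.squarefree_natCast.mpr hn r this
  exact hr.not_isUnit h2

lemma gcd_one_of_prime {a : ℤ} {n : ℕ}
    (h : ∀ r : ℕ, r.Prime → (r : ℤ) ∣ a → (r : ℤ) ∣ n → False) : a.gcd n = 1 := by
  by_contra hne
  obtain ⟨r, hr, hd⟩ := Nat.exists_prime_and_dvd hne
  refine h r hr ?_ ?_
  · exact (Int.natCast_dvd_natCast.mpr hd).trans (Int.gcd_dvd_left _ _)
  · exact (Int.natCast_dvd_natCast.mpr hd).trans (Int.gcd_dvd_right _ _)

lemma J_g_aux {p n : ℕ} (hp : p.Prime) (hp8 : p % 8 = 1) {x y e f u v : ℤ}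
    (hxy : (p : ℤ) = x ^ 2 + y ^ 2) (hy : Odd y)
    (hn : Squarefree n) (hef : (n : ℤ) = e ^ 2 + f ^ 2)
    (huv : (n : ℤ) = u ^ 2 + p * v ^ 2) (hg : ((x * f - y * e).gcd p) = 1)
    (hpm : ¬ (p : ℤ) ∣ u + e) :
    J(x * f - y * e | p) = 1 := by
  haveI : Fact p.Prime := ⟨hp⟩
  have hyp : y.gcd p = 1 := by
    apply gcd_one_of_prime
    intro r hr h1 h2
    have hrp : r = p := (Nat.prime_dvd_prime_iff_eq hr hp).mp (by exact_mod_cast h2)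
    subst hrp
    exact coprime_of_sq_add hr.prime.squarefree hxy r (Nat.prime_iff_prime_int.mp hr)
      ((Nat.prime_iff_prime_int.mp hr).dvd_of_dvd_pow (n := 2) (by
        have : x ^ 2 = r - y ^ 2 := by rw [hxy]; ring
        rw [this]; exact dvd_sub h2 (h1.pow two_ne_zero))) h1
  have hJy : J(y | p) = 1 := by
    rw [J_recip (by omega) hy, hxy]
    have : J(x ^ 2 + y ^ 2 | y.natAbs) = J(x ^ 2 | y.natAbs) := by
      apply jacobiSym.mod_left'
      apply Int.ModEq.symm
      apply (Int.modEq_iff_dvd).mpr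
      rw [Int.natCast_natAbs, abs_dvd]
      exact ⟨y, by ring⟩
    rw [this]
    apply jacobiSym.sq_one'
    apply gcd_one_of_prime
    intro r hr h1 h2
    rw [Int.natCast_natAbs, dvd_abs] at h2
    exact coprime_of_sq_add hp.prime.squarefree hxy r (Nat.prime_iff_prime_int.mp hr) h1 h2
  have hmp : (u + e).gcd p = 1 := by
    apply gcd_one_of_prime
    intro r hr h1 h2
    have hrp : r = p := (Nat.prime_dvd_prime_iff_eq hr hp).mp (by exact_mod_cast h2)
    exact hpm (hrp ▸ h1)
  have hJm : J(u + e | p) = 1 := by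
    rw [J_natAbs (by omega)]
    have h0 : u + e ≠ 0 := by intro h; exact hpm (h ▸ dvd_zero _)
    have main : ((u + e).natAbs : ℤ) * ((u + e).sign * (u - e)) = f ^ 2 - p * v ^ 2 := by
      have : ((u + e).natAbs : ℤ) * (u + e).sign = u + e := by
        rw [Int.natCast_natAbs, mul_comm, Int.sign_mul_abs]
      rw [← mul_assoc, this]
      linarith [hef, huv, mul_comm (u+e) (u-e), (by ring : (u+e)*(u-e) = u^2 - e^2)]
    refine descent hp hp8 _ (by simpa using h0) ?_ _ f v main ?_
    · intro h; apply hpm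
      rw [← Int.natCast_dvd_natCast, Int.natCast_natAbs, dvd_abs] at h
      exact h
    · intro r hr hr2 h1 h2 h3 h4
      have hrI := Nat.prime_iff_prime_int.mp hr
      have h1' : (r : ℤ) ∣ u + e := by
        rw [← Int.natCast_dvd_natCast, Int.natCast_natAbs, dvd_abs] at h1
        exact h1
      have h2' : (r : ℤ) ∣ u - e := by
        rcases hrI.dvd_or_dvd h2 with h | h
        · exfalso
          have hu : IsUnit ((u+e).sign) := by
            rcases lt_or_gt_of_ne h0 with h' | h'
            · rw [Int.sign_eq_neg_one_of_neg h']; simp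
            · rw [Int.sign_eq_one_of_pos h']; simp
          exact hrI.not_isUnit (isUnit_of_dvd_unit h hu)
        · exact h
      have h5 : (r : ℤ) ∣ 2 * e := by
        have := dvd_sub h1' h2'
        have h : u + e - (u - e) = 2 * e := by ring
        rwa [h] at this
      have h6 : (r : ℤ) ∣ e := by
        refine (hrI.dvd_or_dvd h5).resolve_left ?_
        intro h
        exact hr2 ((Nat.prime_dvd_prime_iff_eq hr Nat.prime_two).mp (by exact_mod_cast h))
      exact coprime_of_sq_add hn hef r hrI h6 h3
  have key : J(2 * (y * (u + e)) * (-1 * (x * f - y * e)) | p) =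
      J((y * e + y * u - x * f) ^ 2 | p) := by
    apply jacobiSym.mod_left'
    apply Int.ModEq.symm
    apply (Int.modEq_iff_dvd).mpr
    refine ⟨y^2 - y^2 * v^2 - f ^ 2 - y^2 + y^2 * v^2 + y^2*v^2, ?_⟩
    have h1 : e ^ 2 + f ^ 2 = u ^ 2 + p * v ^ 2 := by rw [← hef, huv]
    have h2 : x ^ 2 = p - y ^ 2 := by rw [hxy]; ring
    have h3 : e ^ 2 = u ^ 2 + p * v ^ 2 - f ^ 2 := by linarith
    linear_combination (y ^ 2) * h3 - f ^ 2 * h2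
  have hne : J(2 * (y * (u + e)) * (-1 * (x * f - y * e)) | p) =
      J(x * f - y * e | p) := by
    rw [jacobiSym.mul_left, jacobiSym.mul_left, jacobiSym.mul_left, jacobiSym.mul_left,
      J_two hp8, hJy, hJm, J_neg_one (by omega)]; simp
  rw [hne, jacobiSym.pow_left] at key
  rcases jacobiSym.eq_one_or_neg_one hg with h | h
  · exact h
  · rw [h] at key
    nlinarith [sq_nonneg J(y * e + y * u - x * f | p)]

lemma lemR {p n : ℕ} (hp : p.Prime) (hp8 : p % 8 = 1) {x y e f u v : ℤ}
    (hxy : (p : ℤ) = x ^ 2 + y ^ 2) (hx : Even x) (hy : Odd y)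
    (hn : Squarefree n) (hn1 : n ≠ 1) (hn8 : n % 8 = 1) (hef : (n : ℤ) = e ^ 2 + f ^ 2)
    (he : Odd e) (hf : Even f)
    (huv : (n : ℤ) = u ^ 2 + p * v ^ 2) (hpn : ¬ p ∣ n) :
    J(f * (x * f - y * e) | n) = 1 := by
  haveI : Fact p.Prime := ⟨hp⟩
  have hpI := Nat.prime_iff_prime_int.mp hp
  have hpnI : ¬ (p : ℤ) ∣ n := by exact_mod_cast hpn
  have hf0 : f ≠ 0 := by
    rintro rfl
    apply hn1
    have : e * e ∣ (n : ℤ) := ⟨1, by rw [hef]; ring⟩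
    have := Int.squarefree_natCast.mpr hn e this
    rw [Int.isUnit_iff] at this
    have h : (n : ℤ) = 1 := by rw [hef]; rcases this with rfl | rfl <;> norm_num
    exact_mod_cast h
  have hJf : J(f | n) = 1 := by
    rw [J_natAbs (by omega)]
    obtain ⟨k, m, hm, hfm⟩ := Nat.exists_eq_two_pow_mul_odd (n := f.natAbs) (by simpa using hf0)
    rw [hfm]; push_cast
    rw [jacobiSym.mul_left, jacobiSym.pow_left, J_two hn8, one_pow, one_mul,
      jacobiSym.quadratic_reciprocity_one_mod_four' hm (by omega), hef]
    have hmf : (m : ℤ) ∣ f := by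
      have : m ∣ f.natAbs := hfm ▸ dvd_mul_left _ _
      rwa [← Int.natCast_dvd_natCast, Int.natCast_natAbs, dvd_abs] at this
    have : J(e ^ 2 + f ^ 2 | m) = J(e ^ 2 | m) := by
      apply jacobiSym.mod_left'
      apply Int.ModEq.symm
      apply (Int.modEq_iff_dvd).mpr
      have h : e ^ 2 + f ^ 2 - e ^ 2 = f ^ 2 := by ring
      rw [h]; exact hmf.pow two_ne_zero
    rw [this]
    apply jacobiSym.sq_one'
    apply gcd_one_of_prime
    intro r hr h1 h2
    exact coprime_of_sq_add hn hef r (Nat.prime_iff_prime_int.mp hr) h1 (h2.trans hmf)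
  set g := x * f - y * e with hgdef
  have hbr : (p : ℤ) * n = g ^ 2 + (x * e + y * f) ^ 2 := by rw [hxy, hef, hgdef]; ring
  have hgodd : Odd g := by
    rw [hgdef]
    exact (hf.mul_left x).sub_odd (hy.mul he)
  have hgp : g.gcd p = 1 := by
    apply gcd_one_of_prime
    intro r hr h1 h2
    have hrp : r = p := (Nat.prime_dvd_prime_iff_eq hr hp).mp (by exact_mod_cast h2)
    subst hrp
    have hrI := Nat.prime_iff_prime_int.mp hr
    have h3 : (r : ℤ) ∣ x * e + y * f := by
      apply hrI.dvd_of_dvd_pow (n := 2)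
      have : (x * e + y * f) ^ 2 = r * n - g ^ 2 := by rw [hbr]; ring
      rw [this]
      exact dvd_sub (dvd_mul_right _ _) (h1.pow two_ne_zero)
    -- r^2 | r * n
    obtain ⟨a, ha⟩ := h1
    obtain ⟨b, hb⟩ := h3
    apply hpnI
    refine ⟨a ^ 2 + b ^ 2, ?_⟩
    apply mul_left_cancel₀ hrI.ne_zero
    rw [hbr, ha, hb]; ring
  have hgn : g.gcd n = 1 := by
    apply gcd_one_of_prime
    intro r hr h1 h2
    have hrI := Nat.prime_iff_prime_int.mp hr
    have h3 : (r : ℤ) ∣ x * e + y * f := by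
      apply hrI.dvd_of_dvd_pow (n := 2)
      have : (x * e + y * f) ^ 2 = p * n - g ^ 2 := by rw [hbr]; ring
      rw [this]
      exact dvd_sub (h2.mul_left _) (h1.pow two_ne_zero)
    have h4 : (r * r : ℤ) ∣ p * n := by
      rw [hbr]; rw [← pow_two]
      exact dvd_add (pow_dvd_pow_of_dvd h1 2) (pow_dvd_pow_of_dvd h3 2)
    have hsq : Squarefree (p * n) := by
      rw [Nat.squarefree_mul_iff]
      exact ⟨(Nat.Prime.coprime_iff_not_dvd hp).mpr hpn, hp.prime.squarefree, hn⟩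
    have := hsq r (by exact_mod_cast h4)
    exact hr.one_lt.ne' (by simpa using this)
  have hJg : J(g | n) = J(g | p) := by
    rw [J_recip (by omega) hgodd, J_recip (by omega) hgodd]
    have h1 : J((p : ℤ) * n | g.natAbs) = 1 := by
      have : J((p : ℤ) * n | g.natAbs) = J((x * e + y * f) ^ 2 | g.natAbs) := by
        apply jacobiSym.mod_left'
        apply Int.ModEq.symm
        apply (Int.modEq_iff_dvd).mpr
        rw [Int.natCast_natAbs, abs_dvd]
        exact ⟨g, by rw [hbr]; ring⟩
      rw [this]
      apply jacobiSym.sq_one'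
      apply gcd_one_of_prime
      intro r hr h1 h2
      rw [Int.natCast_natAbs, dvd_abs] at h2
      have hrI := Nat.prime_iff_prime_int.mp hr
      have h4 : (r : ℤ) ∣ p * n := by
        rw [hbr]
        exact dvd_add (h2.pow two_ne_zero) (h1.pow two_ne_zero)
      have aux : ∀ m : ℕ, g.gcd m = 1 → (r : ℤ) ∣ m → False := by
        intro m hm hrm
        have := Int.dvd_coe_gcd h2 hrm
        rw [hm] at this
        exact hrI.not_isUnit (isUnit_of_dvd_one (by simpa using this))
      rcases hrI.dvd_or_dvd h4 with h | h
      · exact aux p hgp h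
      · exact aux n hgn h
    rw [jacobiSym.mul_left] at h1
    rcases Int.mul_eq_one_iff_eq_one_or_neg_one.mp h1 with ⟨a, b⟩ | ⟨a, b⟩ <;> rw [a, b]
  rw [jacobiSym.mul_left, hJf, hJg, one_mul]
  by_cases hpm : (p : ℤ) ∣ u + e
  · refine J_g_aux (u := -u) (v := v) hp hp8 hxy hy hn hef (by rw [huv]; ring) hgp ?_
    intro h
    have h1 := dvd_sub hpm h
    have h2 : u + e - (-u + e) = 2 * u := by ring
    rw [h2] at h1
    have h3 : (p : ℤ) ∣ u := by
      refine (hpI.dvd_or_dvd h1).resolve_left ?_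
      intro h
      have := (Nat.prime_dvd_prime_iff_eq hp Nat.prime_two).mp (by exact_mod_cast h)
      omega
    apply hpnI
    rw [huv]
    exact dvd_add (h3.pow two_ne_zero) (dvd_mul_right _ _)
  · exact J_g_aux hp hp8 hxy hy hn hef huv hgp hpm

lemma sign_indep {q : ℕ} [Fact q.Prime] {p : ℕ} (hqp : q ≠ p) (hp : p.Prime) {x y : ℤ}
    (hxy : (p : ℤ) = x ^ 2 + y ^ 2) (hs : IsSquare (p : ZMod q)) {I c : ZMod q}
    (hI : I ^ 2 = -1) (hc : c ^ 2 = -1) (h : IsSquare (x + y * c : ZMod q)) :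
    IsSquare (x + y * I : ZMod q) := by
  have hp0 : (p : ZMod q) ≠ 0 := by
    intro h
    rw [ZMod.natCast_eq_zero_iff] at h
    exact hqp ((Nat.prime_dvd_prime_iff_eq Fact.out hp).mp h)
  have hpp : (p : ZMod q) = (x + y * c) * (x - y * c) := by
    have : (p : ZMod q) = ((p : ℤ) : ZMod q) := by push_cast; rfl
    rw [this, hxy]; push_cast
    linear_combination (y : ZMod q) ^ 2 * hc
  have h1 : I = c ∨ I = -c := by
    rw [← sq_eq_sq_iff_eq_or_eq_neg, hI, hc]
  rcases h1 with rfl | rfl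
  · exact h
  · have h0 : (x + y * c : ZMod q) ≠ 0 := by
      intro h; rw [h, zero_mul] at hpp; exact hp0 hpp
    have : (x + y * -c : ZMod q) = p / (x + y * c) := by
      rw [hpp]; field_simp; ring
    rw [this]
    exact hs.div h

lemma half_step {q : ℕ} [Fact q.Prime] {p : ℕ} (hqp : q ≠ p) (hp : p.Prime) {x y e f : ℤ}
    (hxy : (p : ℤ) = x ^ 2 + y ^ 2) (hs : IsSquare (p : ZMod q)) {I : ZMod q}
    (hI : I ^ 2 = -1) (hf : (f : ZMod q) ≠ 0) (hef : (e : ZMod q) ^ 2 + f ^ 2 = 0) :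
    IsSquare (x + y * I : ZMod q) ↔ IsSquare ((f * (x * f - y * e) : ℤ) : ZMod q) := by
  have hc : (- e / f : ZMod q) ^ 2 = -1 := by
    field_simp
    linear_combination hef
  have h1 : IsSquare (x + y * I : ZMod q) ↔ IsSquare (x + y * (- e / f) : ZMod q) :=
    ⟨fun h => sign_indep hqp hp hxy hs hc hI h, fun h => sign_indep hqp hp hxy hs hI hc h⟩
  rw [h1]
  have h2 : (x + y * (- e / f) : ZMod q) = ((f * (x * f - y * e) : ℤ) : ZMod q) / (f * f) := by
    push_cast; field_simp; ring
  rw [h2]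
  constructor
  · intro h
    have := h.mul (IsSquare.mul_self (f : ZMod q))
    rwa [div_mul_cancel₀ _ (mul_ne_zero hf hf)] at this
  · intro h
    exact h.div (IsSquare.mul_self _)

lemma corR_aux {p q q' : ℕ} [Fact q.Prime] [Fact q'.Prime] (hp : p.Prime) (hp8 : p % 8 = 1)
    {x y u v e f : ℤ}
    (hxy : (p : ℤ) = x ^ 2 + y ^ 2) (hx : Even x) (hy : Odd y)
    (hqp : q ≠ p) (hqp' : q' ≠ p) (hqq : q ≠ q') (hq : q % 8 = 1) (hq' : q' % 8 = 1)
    (hs : IsSquare (p : ZMod q)) (hs' : IsSquare (p : ZMod q'))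
    (huv : (q * q' : ℤ) = u ^ 2 + p * v ^ 2)
    (hef : (q * q' : ℤ) = e ^ 2 + f ^ 2) (he : Odd e) (hf : Even f)
    {I : ZMod q} {I' : ZMod q'} (hI : I ^ 2 = -1) (hI' : I' ^ 2 = -1) :
    IsSquare (x + y * I : ZMod q) ↔ IsSquare (x + y * I' : ZMod q') := by
  have hqP : q.Prime := Fact.out
  have hqP' : q'.Prime := Fact.out
  have hsq : Squarefree (q * q') := by
    rw [Nat.squarefree_mul_iff]
    exact ⟨(Nat.coprime_primes hqP hqP').mpr hqq, hqP.prime.squarefree, hqP'.prime.squarefree⟩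
  have hn1 : q * q' ≠ 1 := by
    intro h; exact hqP.one_lt.ne' (Nat.eq_one_of_mul_eq_one_right h)
  have hR := lemR (n := q * q') hp hp8 hxy hx hy hsq hn1 (by rw [Nat.mul_mod, hq, hq'])
    (by push_cast; exact hef) he hf (by push_cast; exact huv) (by
      rw [hp.dvd_mul, Nat.prime_dvd_prime_iff_eq hp hqP, Nat.prime_dvd_prime_iff_eq hp hqP']
      rintro (h | h)
      · exact hqp h.symm
      · exact hqp' h.symm)
  have aux : ∀ r : ℕ, r.Prime → r ∣ q * q' → (f : ZMod r) ≠ 0 ∧ (e : ZMod r) ^ 2 + f ^ 2 = 0 := by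
    intro r hr hrn
    have h1 : (r : ℤ) ∣ e ^ 2 + f ^ 2 := by
      rw [← hef]; exact_mod_cast hrn
    constructor
    · intro h
      rw [ZMod.intCast_zmod_eq_zero_iff_dvd] at h
      have hrI := Nat.prime_iff_prime_int.mp hr
      refine coprime_of_sq_add (n := q * q') hsq (by push_cast; exact hef) r hrI ?_ h
      apply hrI.dvd_of_dvd_pow (n := 2)
      exact (Int.dvd_add_left (h.pow two_ne_zero)).mp h1
    · have := (ZMod.intCast_zmod_eq_zero_iff_dvd _ r).mpr h1
      push_cast at this; exact this
  obtain ⟨a1, a2⟩ := aux q hqP (dvd_mul_right _ _)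
  obtain ⟨b1, b2⟩ := aux q' hqP' (dvd_mul_left _ _)
  rw [half_step hqp hp hxy hs hI a1 a2, half_step hqp' hp hxy hs' hI' b1 b2]
  rw [jacobiSym.mul_right' _ hqP.ne_zero hqP'.ne_zero, ← jacobiSym.legendreSym.to_jacobiSym,
    ← jacobiSym.legendreSym.to_jacobiSym] at hR
  rcases Int.mul_eq_one_iff_eq_one_or_neg_one.mp hR with ⟨a, b⟩ | ⟨a, b⟩
  · refine iff_of_true ?_ ?_
    · refine (legendreSym.eq_one_iff q ?_).mp a
      intro h; rw [(legendreSym.eq_zero_iff q _).mpr h] at a; simp at a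
    · refine (legendreSym.eq_one_iff q' ?_).mp b
      intro h; rw [(legendreSym.eq_zero_iff q' _).mpr h] at b; simp at b
  · exact iff_of_false ((legendreSym.eq_neg_one_iff q).mp a) ((legendreSym.eq_neg_one_iff q').mp b)

lemma corR {p q q' : ℕ} [Fact q.Prime] [Fact q'.Prime] (hp : p.Prime) (hp8 : p % 8 = 1)
    {x y u v : ℤ}
    (hxy : (p : ℤ) = x ^ 2 + y ^ 2) (hx : Even x) (hy : Odd y)
    (hqp : q ≠ p) (hqp' : q' ≠ p) (hq : q % 8 = 1) (hq' : q' % 8 = 1)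
    (hs : IsSquare (p : ZMod q)) (hs' : IsSquare (p : ZMod q'))
    (huv : (q * q' : ℤ) = u ^ 2 + p * v ^ 2)
    {I : ZMod q} {I' : ZMod q'} (hI : I ^ 2 = -1) (hI' : I' ^ 2 = -1) :
    IsSquare (x + y * I : ZMod q) ↔ IsSquare (x + y * I' : ZMod q') := by
  by_cases hqq : q = q'
  · subst hqq
    exact ⟨fun h => sign_indep hqp hp hxy hs hI' hI h, fun h => sign_indep hqp hp hxy hs hI hI' h⟩
  obtain ⟨a, b, hab⟩ := Nat.Prime.sq_add_sq (p := q) (by omega)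
  obtain ⟨c, d, hcd⟩ := Nat.Prime.sq_add_sq (p := q') (by omega)
  have hef : (q * q' : ℤ) = ((a * c - b * d : ℤ)) ^ 2 + (a * d + b * c : ℤ) ^ 2 := by
    rw [← hab, ← hcd]; push_cast; ring
  generalize (a * c - b * d : ℤ) = e at hef
  generalize (a * d + b * c : ℤ) = f at hef
  have hodd : Odd (e ^ 2 + f ^ 2) := by
    rw [← hef]
    have h1 : Odd q := Nat.odd_iff.mpr (by omega)
    have h2 : Odd q' := Nat.odd_iff.mpr (by omega)
    exact_mod_cast h1.mul h2
  rcases Int.even_or_odd f with hf | hf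
  · have he : Odd e := by
      rw [Int.odd_add] at hodd
      exact Int.Odd.of_mul_left (by rw [← pow_two e]; exact hodd.mpr (hf.pow_of_ne_zero two_ne_zero))
    exact corR_aux hp hp8 hxy hx hy hqp hqp' hqq hq hq' hs hs' huv hef he hf hI hI'
  · have he : Even e := by
      rw [add_comm, Int.odd_add] at hodd
      have := hodd.mp hf.pow
      exact (Int.even_pow' two_ne_zero).mp this
    exact corR_aux hp hp8 hxy hx hy hqp hqp' hqq hq hq' hs hs' huv (by rw [hef]; ring) hf he hI hI'

end CMU

end

section

open NumberField Filter Topology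

namespace CMU

section zeta

variable (K : Type*) [Field K] [NumberField K]

noncomputable def aN (n : ℕ) : ℝ := (Nat.card {I : Ideal (𝓞 K) // Ideal.absNorm I = n} : ℝ)

noncomputable def ZK (s : ℝ) : ℝ := ∑' n : ℕ, aN K n * (n : ℝ) ^ (-s)

noncomputable def wt (s : ℝ) (I : Ideal (𝓞 K)) : ℝ := (Ideal.absNorm I : ℝ) ^ (-s)

lemma dedekindZeta_eq {s : ℝ} (hs : 1 < s) : dedekindZeta K (s : ℂ) = (ZK K s : ℂ) := by
  unfold dedekindZeta ZK LSeries
  rw [Complex.ofReal_tsum]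
  refine tsum_congr fun n => ?_
  rw [LSeries.term_def]
  split_ifs with h
  · subst h
    simp [Real.zero_rpow (by linarith : -s ≠ 0)]
  · rw [Real.rpow_neg (Nat.cast_nonneg _), ← div_eq_mul_inv]
    push_cast
    rw [Complex.ofReal_cpow (Nat.cast_nonneg _)]
    simp [aN]

lemma tendsto_ZK : Tendsto (fun s : ℝ => (s - 1) * ZK K s) (𝓝[>] 1)
    (𝓝 (dedekindZeta_residue K)) := by
  have h := tendsto_sub_one_mul_dedekindZeta_nhdsGT K
  have h2 : Tendsto (fun s : ℝ => (((s - 1) * ZK K s : ℝ) : ℂ)) (𝓝[>] 1)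
      (𝓝 (dedekindZeta_residue K : ℂ)) := by
    refine h.congr' ?_
    filter_upwards [self_mem_nhdsWithin] with s hs
    rw [dedekindZeta_eq K hs]
    push_cast; rfl
  have := (Complex.continuous_re.tendsto _).comp h2
  simpa [Function.comp_def] using this

lemma aN_nonneg (n : ℕ) : 0 ≤ aN K n := Nat.cast_nonneg _

lemma term_nonneg (s : ℝ) (n : ℕ) : 0 ≤ aN K n * (n : ℝ) ^ (-s) :=
  mul_nonneg (aN_nonneg K n) (Real.rpow_nonneg (Nat.cast_nonneg _) _)

lemma wt_nonneg (s : ℝ) (I : Ideal (𝓞 K)) : 0 ≤ wt K s I :=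
  Real.rpow_nonneg (Nat.cast_nonneg _) _

lemma summable_ZK {s : ℝ} (hs : 1 < s) : Summable fun n : ℕ => aN K n * (n : ℝ) ^ (-s) := by
  have h := (tendsto_ZK K).eventually_ne (dedekindZeta_residue_ne_zero K)
  have h2 : ∀ᶠ t : ℝ in 𝓝[>] 1, t < s := by
    filter_upwards [Ioo_mem_nhdsGT hs] with t ht using ht.2
  obtain ⟨t, ht, hts, ht1⟩ := (h.and (h2.and self_mem_nhdsWithin)).exists
  have ht1 : 1 < t := ht1
  have hsum : Summable fun n : ℕ => aN K n * (n : ℝ) ^ (-t) := by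
    by_contra hn
    apply ht
    unfold ZK
    rw [tsum_eq_zero_of_not_summable hn, mul_zero]
  refine Summable.of_nonneg_of_le (term_nonneg K s) (fun n => ?_) hsum
  refine mul_le_mul_of_nonneg_left ?_ (aN_nonneg K n)
  rcases Nat.eq_zero_or_pos n with rfl | hn
  · simp [Real.zero_rpow (by linarith : -s ≠ 0), Real.zero_rpow (by linarith : -t ≠ 0)]
  · exact Real.rpow_le_rpow_of_exponent_le (by exact_mod_cast hn) (by linarith)

lemma finite_norm_eq (n : ℕ) : {I : Ideal (𝓞 K) | Ideal.absNorm I = n}.Finite :=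
  Ideal.finite_setOfPred_absNorm_eq n

lemma aN_eq (n : ℕ) : aN K n = ((finite_norm_eq K n).toFinset.card : ℝ) := by
  unfold aN
  rw [← Set.ncard_eq_toFinset_card _ (finite_norm_eq K n), ← Nat.card_coe_set_eq]
  rfl

lemma sum_le_ZK {s : ℝ} (hs : 1 < s) (T : Finset (Ideal (𝓞 K))) :
    ∑ I ∈ T, wt K s I ≤ ZK K s := by
  classical
  rw [← Finset.sum_fiberwise_of_maps_to (g := fun I : Ideal (𝓞 K) => Ideal.absNorm I)
    (t := T.image (fun I : Ideal (𝓞 K) => Ideal.absNorm I))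
    (fun I hI => Finset.mem_image_of_mem _ hI)]
  refine le_trans (Finset.sum_le_sum (g := fun n : ℕ => aN K n * (n : ℝ) ^ (-s)) ?_)
    ((summable_ZK K hs).sum_le_tsum _ (fun n _ => term_nonneg K s n))
  intro n _
  rw [aN_eq]
  have : ∑ I ∈ T with Ideal.absNorm I = n, wt K s I =
      ∑ I ∈ T with Ideal.absNorm I = n, (n : ℝ) ^ (-s) := by
    refine Finset.sum_congr rfl fun I hI => ?_
    rw [wt, (Finset.mem_filter.mp hI).2]
  rw [this, Finset.sum_const, nsmul_eq_mul]
  refine mul_le_mul_of_nonneg_right ?_ (Real.rpow_nonneg (Nat.cast_nonneg _) _)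
  norm_cast
  refine Finset.card_le_card fun I hI => ?_
  simpa using (Finset.mem_filter.mp hI).2

lemma ZK_le {s : ℝ} (hs : 1 < s) {B : ℝ}
    (h : ∀ T : Finset (Ideal (𝓞 K)), (∀ I ∈ T, I ≠ ⊥) → ∑ I ∈ T, wt K s I ≤ B) : ZK K s ≤ B := by
  classical
  refine Real.tsum_le_of_sum_le (fun n => term_nonneg K s n) ?_
  intro F
  have := h ((F.filter (· ≠ 0)).biUnion fun n => (finite_norm_eq K n).toFinset) (by
    intro I hI
    simp only [Finset.mem_biUnion, Finset.mem_filter, Set.Finite.mem_toFinset,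
      Set.mem_ofPred_eq] at hI
    obtain ⟨n, ⟨_, hn⟩, hI⟩ := hI
    rintro rfl
    apply hn
    rw [← hI]; simp)
  refine le_trans (le_of_eq ?_) this
  rw [Finset.sum_biUnion, Finset.sum_filter]
  · refine Finset.sum_congr rfl fun n hn => ?_
    split_ifs with h0
    · rw [aN_eq]
      have : ∑ I ∈ (finite_norm_eq K n).toFinset, wt K s I =
        ∑ I ∈ (finite_norm_eq K n).toFinset, (n : ℝ) ^ (-s) := by
        refine Finset.sum_congr rfl fun I hI => ?_
        have h2 : Ideal.absNorm I = n := by simpa using hI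
        rw [wt, h2]
      rw [this, Finset.sum_const, nsmul_eq_mul]
    · push Not at h0
      subst h0
      simp [Real.zero_rpow (by linarith : -s ≠ 0)]
  · intro m _ n _ hmn
    rw [Function.onFun, Finset.disjoint_left]
    intro I h1 h2
    apply hmn
    have h1 : Ideal.absNorm I = m := by simpa using h1
    have h2 : Ideal.absNorm I = n := by simpa using h2
    rw [← h1, h2]

lemma wt_mul (s : ℝ) (I J : Ideal (𝓞 K)) : wt K s (I * J) = wt K s I * wt K s J := by
  unfold wt
  rw [map_mul]; push_cast
  rw [Real.mul_rpow (Nat.cast_nonneg _) (Nat.cast_nonneg _)]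

noncomputable def wtHom (s : ℝ) : Ideal (𝓞 K) →* ℝ where
  toFun := wt K s
  map_one' := by simp [wt]
  map_mul' := wt_mul K s

open UniqueFactorizationMonoid in
lemma exp_le_ZK {s : ℝ} (hs : 1 < s) (S : Finset (Ideal (𝓞 K))) (hS : ∀ P ∈ S, Prime P) :
    Real.exp (∑ P ∈ S, (wt K s P - wt K s P ^ 2)) ≤ ZK K s := by
  classical
  have h1 : Real.exp (∑ P ∈ S, (wt K s P - wt K s P ^ 2)) ≤ ∏ P ∈ S, (1 + wt K s P) := by
    rw [Real.exp_sum]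
    refine Finset.prod_le_prod (fun _ _ => (Real.exp_pos _).le) fun P _ => ?_
    have hw := wt_nonneg K s P
    set w := wt K s P
    have h := Real.add_one_le_exp (-(w - w ^ 2))
    rw [Real.exp_neg] at h
    have hpos : 0 < -(w - w ^ 2) + 1 := by nlinarith [sq_nonneg (w - 1/2)]
    have h2 := (le_inv_comm₀ hpos (Real.exp_pos _)).mp h
    refine h2.trans ?_
    rw [inv_le_iff_one_le_mul₀ hpos]
    nlinarith [pow_nonneg hw 3]
  refine h1.trans ?_
  rw [Finset.prod_one_add]
  have h2 : ∀ t ∈ S.powerset, ∏ P ∈ t, wt K s P = wt K s (∏ P ∈ t, P) := by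
    intro t _
    exact (map_prod (wtHom K s) _ _).symm
  rw [Finset.sum_congr rfl h2]
  have hinj : Set.InjOn (fun t : Finset (Ideal (𝓞 K)) => ∏ P ∈ t, P) (S.powerset : Set _) := by
    intro t ht t' ht' h
    have aux : ∀ t ∈ S.powerset, normalizedFactors (∏ P ∈ t, P) = t.val := by
      intro t ht
      have := normalizedFactors_prod_of_prime (m := t.val)
        (fun P hP => hS P (Finset.mem_powerset.mp ht hP))
      rwa [Finset.prod_val] at this
    apply Finset.val_injective
    rw [← aux t ht, ← aux t' ht']
    simp only at h
    rw [h]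
  rw [← Finset.sum_image (f := wt K s) hinj]
  exact sum_le_ZK K hs _

open UniqueFactorizationMonoid in
lemma ZK_le_exp {s : ℝ} (hs : 1 < s) {B : ℝ}
    (h : ∀ S : Finset (Ideal (𝓞 K)), (∀ P ∈ S, Prime P) →
      ∑ P ∈ S, (wt K s P + 2 * wt K s P ^ 2) ≤ B) : ZK K s ≤ Real.exp B := by
  classical
  refine ZK_le K hs fun T hT => ?_
  set S : Finset (Ideal (𝓞 K)) := T.biUnion fun I => (normalizedFactors I).toFinset with hSdef
  have hS : ∀ P ∈ S, Prime P := by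
    intro P hP
    simp only [hSdef, Finset.mem_biUnion, Multiset.mem_toFinset] at hP
    obtain ⟨I, _, hP⟩ := hP
    exact prime_of_normalized_factor P hP
  set M : ℕ := ∑ I ∈ T, Multiset.card (normalizedFactors I) with hM
  have hw2 : ∀ P ∈ S, wt K s P ≤ 1 / 2 := by
    intro P hP
    have h0 : Ideal.absNorm P ≠ 0 := by
      rw [Ne, Ideal.absNorm_eq_zero_iff]; exact (hS P hP).ne_zero
    have h1 : Ideal.absNorm P ≠ 1 := by
      rw [Ne, Ideal.absNorm_eq_one_iff]
      intro h
      exact (hS P hP).not_isUnit (Ideal.isUnit_iff.mpr h)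
    have h2 : (2 : ℝ) ≤ Ideal.absNorm P := by
      have : 2 ≤ Ideal.absNorm P := by omega
      exact_mod_cast this
    calc wt K s P ≤ (2 : ℝ) ^ (-s) :=
          Real.rpow_le_rpow_of_nonpos (by norm_num) h2 (by linarith)
      _ ≤ (2 : ℝ) ^ (-1 : ℝ) := Real.rpow_le_rpow_of_exponent_le (by norm_num) (by linarith)
      _ = 1 / 2 := by rw [Real.rpow_neg_one]; norm_num
  have hprod : ∀ I ∈ T, ∏ P ∈ S, P ^ (Multiset.count P (normalizedFactors I)) = I := by
    intro I hI
    rw [← Finset.prod_multiset_count_of_subset]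
    · exact associated_iff_eq.mp (prod_normalizedFactors (hT I hI))
    · exact Finset.subset_biUnion_of_mem (fun I => (normalizedFactors I).toFinset) hI
  calc ∑ I ∈ T, wt K s I = ∑ I ∈ T, ∏ P : S, wt K s P.1 ^ (Multiset.count P.1 (normalizedFactors I)) := by
        refine Finset.sum_congr rfl fun I hI => ?_
        conv_lhs => rw [← hprod I hI]
        rw [← Finset.prod_coe_sort]
        exact (map_prod (wtHom K s) _ _).trans (Finset.prod_congr rfl fun P _ => map_pow (wtHom K s) _ _)
    _ = ∑ e ∈ T.image (fun I => fun P : S => Multiset.count P.1 (normalizedFactors I)),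
          ∏ P : S, wt K s P.1 ^ (e P) := by
        rw [Finset.sum_image]
        intro I hI J hJ hIJ
        rw [← hprod I hI, ← hprod J hJ, ← Finset.prod_coe_sort, ← Finset.prod_coe_sort S]
        exact Finset.prod_congr rfl fun P _ => congrArg (fun k => P.1 ^ k) (congrFun hIJ P)
    _ ≤ ∑ e ∈ Fintype.piFinset (fun _ : S => Finset.range (M + 1)), ∏ P : S, wt K s P.1 ^ (e P) := by
        refine Finset.sum_le_sum_of_subset_of_nonneg ?_ fun e _ _ =>
          Finset.prod_nonneg fun P _ => pow_nonneg (wt_nonneg K s _) _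
        intro e he
        obtain ⟨I, hI, rfl⟩ := Finset.mem_image.mp he
        rw [Fintype.mem_piFinset]
        intro P
        rw [Finset.mem_range, Nat.lt_succ_iff]
        exact (Multiset.count_le_card _ _).trans
          (Finset.single_le_sum (f := fun I => Multiset.card (normalizedFactors I))
            (fun _ _ => Nat.zero_le _) hI)
    _ = ∏ P : S, ∑ k ∈ Finset.range (M + 1), wt K s P.1 ^ k := by
        rw [Finset.prod_univ_sum]
    _ ≤ ∏ P : S, Real.exp (wt K s P.1 + 2 * wt K s P.1 ^ 2) := by
        refine Finset.prod_le_prod (fun P _ => Finset.sum_nonneg fun k _ =>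
          pow_nonneg (wt_nonneg K s _) _) fun P _ => ?_
        have hw := wt_nonneg K s P.1
        have hw' := hw2 P.1 P.2
        set w := wt K s P.1
        refine le_trans ?_ (Real.add_one_le_exp _)
        have h1 : w < 1 := by linarith
        have h2 : (∑ k ∈ Finset.range (M + 1), w ^ k) * (1 - w) ≤ 1 := by
          have := geom_sum_mul_neg w (M + 1)
          rw [this]; linarith [pow_nonneg hw (M + 1)]
        have h3 : 1 ≤ (w + 2 * w ^ 2 + 1) * (1 - w) := by nlinarith [mul_nonneg hw hw]
        exact le_of_mul_le_mul_right (h2.trans h3) (by linarith)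
    _ = Real.exp (∑ P ∈ S, (wt K s P + 2 * wt K s P ^ 2)) := by
        rw [Real.exp_sum, Finset.prod_coe_sort S (fun P => Real.exp (wt K s P + 2 * wt K s P ^ 2))]
    _ ≤ Real.exp B := Real.exp_le_exp.mpr (h S hS)

lemma wt_sq_le {s : ℝ} (hs : 1 < s) (P : Ideal (𝓞 K)) : wt K s P ^ 2 ≤ wt K 2 P := by
  unfold wt
  rcases Nat.eq_zero_or_pos (Ideal.absNorm P) with h | h
  · rw [h]; simp [Real.zero_rpow (by linarith : -s ≠ 0)]
  · rw [← Real.rpow_natCast, ← Real.rpow_mul (Nat.cast_nonneg _)]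
    refine Real.rpow_le_rpow_of_exponent_le (by exact_mod_cast h) ?_
    push_cast; linarith

lemma sum_sq_le {s : ℝ} (hs : 1 < s) (S : Finset (Ideal (𝓞 K))) :
    ∑ P ∈ S, wt K s P ^ 2 ≤ ZK K 2 :=
  (Finset.sum_le_sum fun P _ => wt_sq_le K hs P).trans (sum_le_ZK K one_lt_two S)

lemma prime_norm (P : Ideal (𝓞 K)) (hP : Prime P) :
    ∃ q k : ℕ, q.Prime ∧ (q : 𝓞 K) ∈ P ∧ k ≠ 0 ∧ Ideal.absNorm P = q ^ k := by
  have hPp : P.IsPrime := Ideal.isPrime_of_prime hP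
  have hPm : P.IsMaximal := hPp.isMaximal hP.ne_zero
  obtain ⟨q, k, hk, hqP, hq, h⟩ := Ideal.exists_prime_and_absNorm_eq_pow P
  exact ⟨q, k, hq, hqP, hk.ne', h⟩

lemma card_over_le {q : ℕ} (hq : q.Prime) (S : Finset (Ideal (𝓞 K)))
    (hS : ∀ P ∈ S, Prime P ∧ (q : 𝓞 K) ∈ P ∧ q ≤ Ideal.absNorm P) :
    S.card ≤ Module.finrank ℤ (𝓞 K) := by
  have h1 : ∏ P ∈ S, P ∣ Ideal.span {(q : 𝓞 K)} := by
    refine Finset.prod_primes_dvd _ (fun P hP => (hS P hP).1) fun P hP => ?_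
    rw [Ideal.dvd_span_singleton]
    exact (hS P hP).2.1
  have h2 := map_dvd Ideal.absNorm h1
  rw [Ideal.absNorm_span_natCast, map_prod] at h2
  have h3 := Nat.le_of_dvd (pow_pos hq.pos _) h2
  have h4 : q ^ S.card ≤ ∏ P ∈ S, Ideal.absNorm P := by
    rw [← Finset.prod_const]
    exact Finset.prod_le_prod' fun P hP => (hS P hP).2.2
  exact (Nat.pow_le_pow_iff_right hq.one_lt).mp (h4.trans h3)

lemma bad_sum : ∃ C : ℝ, ∀ s : ℝ, 1 < s → ∀ S : Finset (Ideal (𝓞 K)),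
    (∀ P ∈ S, Prime P ∧ ¬ (Ideal.absNorm P).Prime) → ∑ P ∈ S, wt K s P ≤ C := by
  classical
  have hsum : Summable (fun n : ℕ => (Module.finrank ℤ (𝓞 K) : ℝ) * (n : ℝ) ^ (-2 : ℝ)) :=
    (Real.summable_nat_rpow.mpr (by norm_num)).mul_left _
  refine ⟨∑' n : ℕ, (Module.finrank ℤ (𝓞 K) : ℝ) * (n : ℝ) ^ (-2 : ℝ), ?_⟩
  intro s hs S hS
  have key : ∀ P ∈ S, (Ideal.absNorm P).minFac.Prime ∧ (((Ideal.absNorm P).minFac : ℕ) : 𝓞 K) ∈ P ∧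
      (Ideal.absNorm P).minFac ^ 2 ≤ Ideal.absNorm P := by
    intro P hP
    obtain ⟨q, k, hq, hqP, hk, h⟩ := prime_norm K P (hS P hP).1
    have h1 : (Ideal.absNorm P).minFac = q := by rw [h, Nat.Prime.pow_minFac hq hk]
    rw [h1]
    refine ⟨hq, hqP, ?_⟩
    rw [h]
    refine Nat.pow_le_pow_right hq.pos ?_
    have : k ≠ 1 := by
      rintro rfl
      apply (hS P hP).2
      rw [h, pow_one]; exact hq
    omega
  rw [← Finset.sum_fiberwise_of_maps_to (g := fun I : Ideal (𝓞 K) => (Ideal.absNorm I).minFac)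
    (t := S.image (fun I : Ideal (𝓞 K) => (Ideal.absNorm I).minFac))
    (fun I hI => Finset.mem_image_of_mem _ hI)]
  refine le_trans (Finset.sum_le_sum ?_)
    (hsum.sum_le_tsum (S.image (fun I : Ideal (𝓞 K) => (Ideal.absNorm I).minFac))
      (fun n _ => mul_nonneg (Nat.cast_nonneg _) (Real.rpow_nonneg (Nat.cast_nonneg _) _)))
  intro q hq
  have hqp : q.Prime := by
    obtain ⟨P, hP, rfl⟩ := Finset.mem_image.mp hq
    exact (key P hP).1
  have hc := card_over_le K hqp (S.filter fun P => (Ideal.absNorm P).minFac = q) (by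
    intro P hP
    obtain ⟨hPS, rfl⟩ := Finset.mem_filter.mp hP
    refine ⟨(hS P hPS).1, (key P hPS).2.1, ?_⟩
    refine le_trans ?_ (key P hPS).2.2
    exact Nat.le_self_pow two_ne_zero _)
  calc ∑ P ∈ S with (Ideal.absNorm P).minFac = q, wt K s P
      ≤ ∑ P ∈ S with (Ideal.absNorm P).minFac = q, (q : ℝ) ^ (-2 : ℝ) := by
        refine Finset.sum_le_sum fun P hP => ?_
        obtain ⟨hPS, rfl⟩ := Finset.mem_filter.mp hP
        have h1 := (key P hPS).2.2
        set q := (Ideal.absNorm P).minFac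
        have hq1 : (1 : ℝ) ≤ q := by exact_mod_cast hqp.one_le
        calc wt K s P ≤ ((q ^ 2 : ℕ) : ℝ) ^ (-s) :=
              Real.rpow_le_rpow_of_nonpos (by exact_mod_cast pow_pos hqp.pos 2)
                (by exact_mod_cast h1) (by linarith)
          _ = (q : ℝ) ^ (2 * (-s)) := by
              push_cast
              rw [← Real.rpow_natCast, ← Real.rpow_mul (Nat.cast_nonneg _)]; norm_num
          _ ≤ (q : ℝ) ^ (-2 : ℝ) := Real.rpow_le_rpow_of_exponent_le hq1 (by linarith)
    _ = ((S.filter fun P => (Ideal.absNorm P).minFac = q).card : ℝ) * (q : ℝ) ^ (-2 : ℝ) := by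
        rw [Finset.sum_const, nsmul_eq_mul]
    _ ≤ _ := mul_le_mul_of_nonneg_right (by exact_mod_cast hc)
        (Real.rpow_nonneg (Nat.cast_nonneg _) _)

lemma wt_le_one {s : ℝ} (hs : 1 < s) (P : Ideal (𝓞 K)) : wt K s P ≤ 1 := by
  unfold wt
  rcases Nat.eq_zero_or_pos (Ideal.absNorm P) with h | h
  · rw [h]; simp [Real.zero_rpow (by linarith : -s ≠ 0)]
  · exact Real.rpow_le_one_of_one_le_of_nonpos (by exact_mod_cast h) (by linarith)

lemma small_sum (B : ℕ) : ∃ C : ℝ, ∀ s : ℝ, 1 < s → ∀ S : Finset (Ideal (𝓞 K)),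
    (∀ P ∈ S, Ideal.absNorm P ≤ B) → ∑ P ∈ S, wt K s P ≤ C := by
  have hfin : {I : Ideal (𝓞 K) | Ideal.absNorm I ≤ B}.Finite := Ideal.finite_setOfPred_absNorm_le B
  refine ⟨hfin.toFinset.card, fun s hs S hS => ?_⟩
  calc ∑ P ∈ S, wt K s P ≤ ∑ P ∈ S, (1 : ℝ) := Finset.sum_le_sum fun P _ => wt_le_one K hs P
    _ = S.card := by simp
    _ ≤ _ := by
      norm_cast
      refine Finset.card_le_card fun I hI => ?_
      simpa using hS I hI

lemma prime_of_norm (P : Ideal (𝓞 K)) (h : (Ideal.absNorm P).Prime) : Prime P := by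
  have h1 : P.IsPrime := Ideal.isPrime_of_irreducible_absNorm h
  refine Ideal.prime_of_isPrime ?_ h1
  rintro rfl
  simp [Nat.not_prime_zero] at h

end zeta

theorem no_double (E E' : Type*) [Field E] [NumberField E] [Field E'] [NumberField E'] (B : ℕ)
    (Φ : {P : Ideal (𝓞 E) // (Ideal.absNorm P).Prime ∧ B < Ideal.absNorm P} × Bool → Ideal (𝓞 E'))
    (hinj : Function.Injective Φ) (hΦ : ∀ P b, Ideal.absNorm (Φ (P, b)) = Ideal.absNorm P.1) :
    False := by
  classical
  obtain ⟨C1, hC1⟩ := bad_sum E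
  obtain ⟨C2, hC2⟩ := small_sum E B
  set D : ℝ := (ZK E' 2) / 2 + C1 + C2 + 2 * ZK E 2 with hD
  have main : ∀ s : ℝ, 1 < s → ZK E s ≤ Real.exp (Real.log (ZK E' s) / 2 + D) := by
    intro s hs
    have hZpos : 0 < ZK E' s := by
      have := exp_le_ZK E' hs ∅ (by simp)
      exact lt_of_lt_of_le (Real.exp_pos _) this
    refine ZK_le_exp E hs fun S hS => ?_
    rw [Finset.sum_add_distrib, ← Finset.mul_sum]
    have hsq := sum_sq_le E hs S
    have h1 : ∑ P ∈ S with ¬ (Ideal.absNorm P).Prime, wt E s P ≤ C1 := by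
      refine hC1 s hs _ fun P hP => ?_
      obtain ⟨hP, h⟩ := Finset.mem_filter.mp hP
      exact ⟨hS P hP, h⟩
    have h2 : ∑ P ∈ S.filter (fun P => (Ideal.absNorm P).Prime) with ¬ B < Ideal.absNorm P,
        wt E s P ≤ C2 := by
      refine hC2 s hs _ fun P hP => ?_
      have := (Finset.mem_filter.mp hP).2
      omega
    have h3 := Finset.sum_filter_add_sum_filter_not S (fun P => (Ideal.absNorm P).Prime) (wt E s)
    have h4 := Finset.sum_filter_add_sum_filter_not (S.filter (fun P => (Ideal.absNorm P).Prime))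
      (fun P => B < Ideal.absNorm P) (wt E s)
    set G := (S.filter (fun P => (Ideal.absNorm P).Prime)).filter (fun P => B < Ideal.absNorm P)
      with hG
    have hGm : ∀ P ∈ G, (Ideal.absNorm P).Prime ∧ B < Ideal.absNorm P := by
      intro P hP
      obtain ⟨hP, h⟩ := Finset.mem_filter.mp hP
      exact ⟨(Finset.mem_filter.mp hP).2, h⟩
    have h5 : 2 * ∑ P ∈ G, wt E s P ≤ Real.log (ZK E' s) + ZK E' 2 := by
      set S' := ((G.subtype (fun P => (Ideal.absNorm P).Prime ∧ B < Ideal.absNorm P)) ×ˢ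
        (Finset.univ : Finset Bool)).image Φ with hS'
      have e1 : ∑ Q ∈ S', wt E' s Q = 2 * ∑ P ∈ G, wt E s P := by
        rw [hS', Finset.sum_image (fun a _ b _ h => hinj h), Finset.sum_product]
        have : ∀ P b, wt E' s (Φ (P, b)) = wt E s P.1 := by
          intro P b; simp only [wt, hΦ]
        simp only [this]
        rw [← Finset.sum_subtype_of_mem (p := fun P => (Ideal.absNorm P).Prime ∧ B < Ideal.absNorm P)
          (wt E s) hGm, Finset.mul_sum]
        refine Finset.sum_congr rfl fun P _ => ?_
        simp
      have e2 := exp_le_ZK E' hs S' (by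
        intro Q hQ
        obtain ⟨⟨P, b⟩, _, rfl⟩ := Finset.mem_image.mp hQ
        apply prime_of_norm
        rw [hΦ]; exact P.2.1)
      have e3 := (Real.le_log_iff_exp_le hZpos).mpr e2
      rw [Finset.sum_sub_distrib, e1] at e3
      have e4 := sum_sq_le E' hs S'
      linarith
    rw [hD]
    linarith
  have main2 : ∀ s : ℝ, 1 < s → ((s - 1) * ZK E s) ^ 2 ≤
      Real.exp (2 * D) * ((s - 1) * ((s - 1) * ZK E' s)) := by
    intro s hs
    have hZpos : 0 < ZK E' s := by
      have := exp_le_ZK E' hs ∅ (by simp)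
      exact lt_of_lt_of_le (Real.exp_pos _) this
    have hZpos' : 0 < ZK E s := by
      have := exp_le_ZK E hs ∅ (by simp)
      exact lt_of_lt_of_le (Real.exp_pos _) this
    have h1 : ZK E s ^ 2 ≤ ZK E' s * Real.exp (2 * D) := by
      refine (pow_le_pow_left₀ hZpos'.le (main s hs) 2).trans (le_of_eq ?_)
      rw [← Real.exp_nat_mul]
      push_cast
      rw [mul_add, Real.exp_add, mul_div_cancel₀ _ (two_ne_zero), Real.exp_log hZpos]
    have := mul_le_mul_of_nonneg_left h1 (sq_nonneg (s - 1))
    calc _ = (s - 1) ^ 2 * ZK E s ^ 2 := by ring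
      _ ≤ _ := this
      _ = _ := by ring
  have t1 := (tendsto_ZK E).pow 2
  have t0 : Tendsto (fun s : ℝ => s - 1) (𝓝[>] 1) (𝓝 0) := by
    have : Tendsto (fun s : ℝ => s - 1) (𝓝 1) (𝓝 (1 - 1)) := tendsto_id.sub_const 1
    rw [sub_self] at this
    exact this.mono_left nhdsWithin_le_nhds
  have t2 := (t0.mul (tendsto_ZK E')).const_mul (Real.exp (2 * D))
  have hle := le_of_tendsto_of_tendsto t1 t2 (by
    filter_upwards [self_mem_nhdsWithin] with s hs using main2 s hs)
  have := dedekindZeta_residue_pos E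
  simp only [zero_mul, mul_zero] at hle
  nlinarith [pow_pos this 2]


end CMU

end

section

open NumberField Polynomial

namespace CMU

universe u

lemma exists_quad (E : Type u) [Field E] [NumberField E] (β : E) (hβ : ¬ IsSquare β) :
    ∃ (E' : Type u) (_ : Field E') (_ : NumberField E') (_ : Algebra E E') (θ : E'),
      θ ^ 2 = algebraMap E E' β ∧ (∀ z : E', ∃ a b : E, z = algebraMap E E' a + algebraMap E E' b * θ) ∧
      ∃ σ : E' →ₐ[E] E', σ θ = -θ := by
  have hirr : Irreducible (X ^ 2 - C β : E[X]) := by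
    refine X_pow_sub_C_irreducible_of_prime Nat.prime_two fun b hb => hβ ⟨b, ?_⟩
    rw [← hb, pow_two]
  have : Fact (Irreducible (X ^ 2 - C β : E[X])) := ⟨hirr⟩
  have hmonic : (X ^ 2 - C β : E[X]).Monic := monic_X_pow_sub_C β two_ne_zero
  have hdeg : (X ^ 2 - C β : E[X]).natDegree = 2 := natDegree_X_pow_sub_C
  have hθ : (AdjoinRoot.root (X ^ 2 - C β : E[X])) ^ 2 = algebraMap E _ β := by
    have := AdjoinRoot.eval₂_root (X ^ 2 - C β : E[X])
    rw [eval₂_sub, eval₂_pow, eval₂_X, eval₂_C, sub_eq_zero] at this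
    exact this
  have : FiniteDimensional E (AdjoinRoot (X ^ 2 - C β : E[X])) := hmonic.finite_adjoinRoot
  have : FiniteDimensional ℚ (AdjoinRoot (X ^ 2 - C β : E[X])) :=
    FiniteDimensional.trans ℚ E _
  have : CharZero (AdjoinRoot (X ^ 2 - C β : E[X])) :=
    charZero_of_injective_algebraMap (algebraMap E _).injective
  refine ⟨AdjoinRoot (X ^ 2 - C β : E[X]), inferInstance, ⟨⟩, inferInstance,
    AdjoinRoot.root _, hθ, ?_, ?_⟩
  · intro z
    have h1 := AdjoinRoot.mk_leftInverse hmonic z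
    obtain ⟨g, rfl⟩ := AdjoinRoot.mk_surjective z
    rw [AdjoinRoot.modByMonicHom_mk] at h1
    have h2 : (g %ₘ (X ^ 2 - C β)).natDegree ≤ 1 := by
      have := natDegree_modByMonic_lt g hmonic (by intro h; rw [h] at hdeg; simp at hdeg)
      omega
    obtain ⟨a, b, hab⟩ := exists_eq_X_add_C_of_natDegree_le_one h2
    refine ⟨b, a, ?_⟩
    rw [← h1, hab]
    simp [add_comm]
  · refine ⟨AdjoinRoot.liftAlgHom _ (Algebra.ofId _ _) (-AdjoinRoot.root _) ?_, ?_⟩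
    · simp [hθ]
    · simp

section deg

variable {E E' : Type*} [Field E] [NumberField E] [Field E'] [NumberField E'] [Algebra E E']

lemma norm_eq_card {E : Type*} [Field E] [NumberField E] (P : Ideal (𝓞 E)) :
    Ideal.absNorm P = Nat.card (𝓞 E ⧸ P) := rfl

/-- Descent of degree one primes. -/
lemma comap_norm (P' : Ideal (𝓞 E')) (h : (Ideal.absNorm P').Prime) :
    Ideal.absNorm (P'.comap (algebraMap (𝓞 E) (𝓞 E'))) = Ideal.absNorm P' ∧
    Function.Bijective (Ideal.quotientMap P' (algebraMap (𝓞 E) (𝓞 E')) le_rfl) := by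
  have hP' : P'.IsPrime := Ideal.isPrime_of_irreducible_absNorm h
  set f := Ideal.quotientMap (I := P'.comap (algebraMap (𝓞 E) (𝓞 E'))) P'
    (algebraMap (𝓞 E) (𝓞 E')) le_rfl with hf
  have hinj : Function.Injective f := Ideal.quotientMap_injective
  have hfin : Finite (𝓞 E' ⧸ P') := Nat.finite_of_card_ne_zero (by
    rw [← norm_eq_card]; exact h.ne_zero)
  have hfin2 : Finite (𝓞 E ⧸ P'.comap (algebraMap (𝓞 E) (𝓞 E'))) := Finite.of_injective f hinj
  have hne : Nat.card (𝓞 E ⧸ P'.comap (algebraMap (𝓞 E) (𝓞 E'))) ≠ 1 := by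
    have : Nontrivial (𝓞 E ⧸ P'.comap (algebraMap (𝓞 E) (𝓞 E'))) :=
      Ideal.Quotient.nontrivial_iff.mpr (Ideal.comap_ne_top _ hP'.ne_top)
    exact Finite.one_lt_card.ne'
  have hdvd : Nat.card (𝓞 E ⧸ P'.comap (algebraMap (𝓞 E) (𝓞 E'))) ∣ Nat.card (𝓞 E' ⧸ P') :=
    AddSubgroup.card_dvd_of_injective f.toAddMonoidHom hinj
  have hc := (Nat.dvd_prime h).mp hdvd
  have hc : Nat.card (𝓞 E ⧸ P'.comap (algebraMap (𝓞 E) (𝓞 E'))) = Nat.card (𝓞 E' ⧸ P') :=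
    hc.resolve_left hne
  exact ⟨hc, (Nat.bijective_iff_injective_and_card f).mpr ⟨hinj, hc⟩⟩

lemma comap_isSquare (P' : Ideal (𝓞 E')) (h : (Ideal.absNorm P').Prime) (γ : 𝓞 E) :
    IsSquare (Ideal.Quotient.mk (P'.comap (algebraMap (𝓞 E) (𝓞 E'))) γ) ↔
    IsSquare (Ideal.Quotient.mk P' (algebraMap (𝓞 E) (𝓞 E') γ)) := by
  obtain ⟨_, hb⟩ := comap_norm (E := E) P' h
  set f := Ideal.quotientMap (I := P'.comap (algebraMap (𝓞 E) (𝓞 E'))) P'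
    (algebraMap (𝓞 E) (𝓞 E')) le_rfl with hf
  have h1 : f (Ideal.Quotient.mk _ γ) = Ideal.Quotient.mk P' (algebraMap (𝓞 E) (𝓞 E') γ) :=
    Ideal.quotientMap_mk
  rw [← h1]
  constructor
  · intro h; exact h.map f
  · rintro ⟨r, hr⟩
    obtain ⟨t, rfl⟩ := hb.2 r
    exact ⟨t, hb.1 (by rw [hr, map_mul])⟩

end deg

lemma split_prime {E E' : Type*} [Field E] [NumberField E] [Field E'] [NumberField E'] [Algebra E E']
    (β : 𝓞 E) (θ : 𝓞 E') (hθ : θ ^ 2 = algebraMap (𝓞 E) (𝓞 E') β)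
    (hrep : ∀ z : E', ∃ a b : E, z = algebraMap E E' a + algebraMap E E' b * θ)
    (σ : E' →ₐ[E] E') (hσ : σ θ = -θ)
    (P : Ideal (𝓞 E)) (hP : P.IsPrime) (hP0 : P ≠ ⊥)
    (h2 : (2 : 𝓞 E) ∉ P) (hβ : β ∉ P) (s : 𝓞 E) (hs : β - s ^ 2 ∈ P) :
    ∃ Q : Ideal (𝓞 E'), Q.IsPrime ∧ Q.comap (algebraMap (𝓞 E) (𝓞 E')) = P ∧
      θ - algebraMap (𝓞 E) (𝓞 E') s ∈ Q ∧ Ideal.absNorm Q = Ideal.absNorm P := by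
  have hmax : P.IsMaximal := hP.isMaximal hP0
  obtain ⟨Q0, hQ0, hQ0P⟩ : ∃ Q : Ideal (𝓞 E'), Q.IsPrime ∧ Q.comap (algebraMap (𝓞 E) (𝓞 E')) = P := by
    obtain ⟨Q, hQ, hQ'⟩ := Ideal.exists_maximal_ideal_liesOver_of_isIntegral (S := 𝓞 E') P
    exact ⟨Q, hQ.isPrime, hQ'.over.symm⟩
  have hprod : (θ - algebraMap (𝓞 E) (𝓞 E') s) * (θ + algebraMap (𝓞 E) (𝓞 E') s) ∈ Q0 := by
    have : (θ - algebraMap (𝓞 E) (𝓞 E') s) * (θ + algebraMap (𝓞 E) (𝓞 E') s) =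
      algebraMap (𝓞 E) (𝓞 E') (β - s ^ 2) := by
      rw [map_sub, ← hθ, map_pow]; ring
    rw [this]
    have := hs
    rw [← hQ0P] at this
    exact this
  let τ : 𝓞 E' →+* 𝓞 E' := RingOfIntegers.mapRingHom (σ : E' →+* E')
  have hτ : ∀ z : 𝓞 E', ((τ z : 𝓞 E') : E') = σ (z : E') := fun z => rfl
  have hτθ : τ θ = -θ := by
    apply RingOfIntegers.ext
    rw [hτ, hσ]; simp
  have hτE : ∀ a : 𝓞 E, τ (algebraMap (𝓞 E) (𝓞 E') a) = algebraMap (𝓞 E) (𝓞 E') a := by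
    intro a
    apply RingOfIntegers.ext
    rw [hτ]
    exact σ.commutes (a : E)
  obtain ⟨Q, hQ, hQP, hQθ⟩ : ∃ Q : Ideal (𝓞 E'), Q.IsPrime ∧
      Q.comap (algebraMap (𝓞 E) (𝓞 E')) = P ∧ θ - algebraMap (𝓞 E) (𝓞 E') s ∈ Q := by
    rcases hQ0.mem_or_mem hprod with h | h
    · exact ⟨Q0, hQ0, hQ0P, h⟩
    · refine ⟨Q0.comap τ, Ideal.IsPrime.comap τ, ?_, ?_⟩
      · rw [← hQ0P]
        ext a
        simp only [Ideal.mem_comap, hτE]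
      · rw [Ideal.mem_comap, map_sub, hτθ, hτE, ← neg_add']
        exact Q0.neg_mem h
  refine ⟨Q, hQ, hQP, hQθ, ?_⟩
  subst hQP
  set f := Ideal.quotientMap (I := Q.comap (algebraMap (𝓞 E) (𝓞 E'))) Q
    (algebraMap (𝓞 E) (𝓞 E')) le_rfl with hf
  have hinj : Function.Injective f := Ideal.quotientMap_injective
  have hfmk : ∀ a, f (Ideal.Quotient.mk _ a) = Ideal.Quotient.mk Q (algebraMap (𝓞 E) (𝓞 E') a) :=
    fun a => Ideal.quotientMap_mk
  -- surjectivity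
  have hsurj : Function.Surjective f := by
    intro r
    obtain ⟨z, rfl⟩ := Ideal.Quotient.mk_surjective r
    obtain ⟨a, b, hab⟩ := hrep (z : E')
    have hσz : σ (z : E') = algebraMap E E' a - algebraMap E E' b * θ := by
      rw [hab, map_add, map_mul, σ.commutes, σ.commutes, hσ]; ring
    have hθE : ((θ : 𝓞 E') : E') ^ 2 = algebraMap E E' (β : E) := by
      have := congrArg (algebraMap (𝓞 E') E') hθ
      rw [map_pow] at this
      exact this
    have hA : IsIntegral ℤ (2 * a) := by
      have : IsIntegral ℤ (algebraMap E E' (2 * a)) := by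
        have h : algebraMap E E' (2 * a) = ((z + τ z : 𝓞 E') : E') := by
          have e : ((z + τ z : 𝓞 E') : E') = (z : E') + σ (z : E') := rfl
          rw [e, hσz, hab, map_mul, map_ofNat]; ring
        rw [h]; exact RingOfIntegers.isIntegral_coe _
      exact (isIntegral_algebraMap_iff (algebraMap E E').injective).mp this
    have hB : IsIntegral ℤ (2 * b * β) := by
      have : IsIntegral ℤ (algebraMap E E' (2 * b * β)) := by
        have h : algebraMap E E' (2 * b * β) = ((θ * (z - τ z) : 𝓞 E') : E') := by
          have e : ((θ * (z - τ z) : 𝓞 E') : E') = (θ : E') * ((z : E') - σ (z : E')) := rfl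
          rw [e, hσz, hab, map_mul, map_mul, map_ofNat, ← hθE]; ring
        rw [h]; exact RingOfIntegers.isIntegral_coe _
      exact (isIntegral_algebraMap_iff (algebraMap E E').injective).mp this
    let A : 𝓞 E := ⟨2 * a, hA⟩
    let B : 𝓞 E := ⟨2 * b * β, hB⟩
    have hz : algebraMap (𝓞 E) (𝓞 E') (2 * β) * z =
        algebraMap (𝓞 E) (𝓞 E') (β * A) + algebraMap (𝓞 E) (𝓞 E') B * θ := by
      apply RingOfIntegers.ext
      have e1 : ((algebraMap (𝓞 E) (𝓞 E') (2 * β) : 𝓞 E') : E') = 2 * algebraMap E E' β := by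
        have : ((algebraMap (𝓞 E) (𝓞 E') (2 * β) : 𝓞 E') : E') = algebraMap E E' (2 * (β : E)) := rfl
        rw [this, map_mul, map_ofNat]
      have e2 : ((algebraMap (𝓞 E) (𝓞 E') (β * A) : 𝓞 E') : E') =
          algebraMap E E' β * (2 * algebraMap E E' a) := by
        have : ((algebraMap (𝓞 E) (𝓞 E') (β * A) : 𝓞 E') : E') = algebraMap E E' (β * (2 * a)) := rfl
        rw [this, map_mul, map_mul, map_ofNat]
      have e3 : ((algebraMap (𝓞 E) (𝓞 E') B : 𝓞 E') : E') =
          2 * algebraMap E E' b * algebraMap E E' β := by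
        have : ((algebraMap (𝓞 E) (𝓞 E') B : 𝓞 E') : E') = algebraMap E E' (2 * b * β) := rfl
        rw [this, map_mul, map_mul, map_ofNat]
      change ((algebraMap (𝓞 E) (𝓞 E') (2 * β) : 𝓞 E') : E') * (z : E') =
        ((algebraMap (𝓞 E) (𝓞 E') (β * A) : 𝓞 E') : E') +
        ((algebraMap (𝓞 E) (𝓞 E') B : 𝓞 E') : E') * (θ : E')
      rw [e1, e2, e3, hab]
      linear_combination (2 * algebraMap E E' b * algebraMap E E' β * 0) * hθE
    have hmod : f (Ideal.Quotient.mk _ (2 * β)) * Ideal.Quotient.mk Q z =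
        f (Ideal.Quotient.mk _ (β * A + B * s)) := by
      rw [hfmk, hfmk, ← map_mul, hz]
      rw [Ideal.Quotient.eq]
      have : algebraMap (𝓞 E) (𝓞 E') (β * A) + algebraMap (𝓞 E) (𝓞 E') B * θ -
        algebraMap (𝓞 E) (𝓞 E') (β * A + B * s) =
        algebraMap (𝓞 E) (𝓞 E') B * (θ - algebraMap (𝓞 E) (𝓞 E') s) := by
        rw [map_add, map_mul _ B]; ring
      rw [this]
      exact Q.mul_mem_left _ hQθ
    have h2β : 2 * β ∉ Q.comap (algebraMap (𝓞 E) (𝓞 E')) := by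
      intro h
      rcases hP.mem_or_mem h with h | h
      · exact h2 h
      · exact hβ h
    obtain ⟨w, hw⟩ := Ideal.Quotient.exists_inv (I := Q.comap (algebraMap (𝓞 E) (𝓞 E')))
      (a := Ideal.Quotient.mk _ (2 * β)) (by rwa [Ne, Ideal.Quotient.eq_zero_iff_mem])
    refine ⟨w * Ideal.Quotient.mk _ (β * A + B * s), ?_⟩
    rw [map_mul, ← hmod, ← mul_assoc, ← map_mul, mul_comm w, hw, map_one, one_mul]
  exact (Nat.card_congr (Equiv.ofBijective f ⟨hinj, hsurj⟩)).symm

lemma two_notMem {E : Type*} [Field E] [NumberField E] (P : Ideal (𝓞 E)) (m : ℕ) (hm : m ≠ 0)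
    (h : (Ideal.absNorm P).Prime) (h2 : m < Ideal.absNorm P) : (m : 𝓞 E) ∉ P := by
  intro hmem
  have hP : P.IsPrime := Ideal.isPrime_of_irreducible_absNorm h
  have hcop : Nat.Coprime m (Ideal.absNorm P) := by
    rw [Nat.coprime_comm, Nat.Prime.coprime_iff_not_dvd h]
    intro hd
    have := Nat.le_of_dvd (Nat.pos_of_ne_zero hm) hd
    omega
  obtain ⟨a, b, hab⟩ := (Nat.isCoprime_iff_coprime.mpr hcop)
  apply hP.ne_top
  rw [Ideal.eq_top_iff_one]
  have h1 : (1 : 𝓞 E) = a * m + b * (Ideal.absNorm P : ℕ) := by exact_mod_cast congrArg (Int.cast (R := 𝓞 E)) hab.symm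
  rw [h1]
  exact P.add_mem (P.mul_mem_left _ hmem) (P.mul_mem_left _ (Ideal.absNorm_mem P))

theorem exists_nonsquare (E : Type u) [Field E] [NumberField E] (β : 𝓞 E)
    (hβ : ¬ IsSquare (β : E)) (B : ℕ) :
    ∃ P : Ideal (𝓞 E), (Ideal.absNorm P).Prime ∧ B < Ideal.absNorm P ∧
      ¬ IsSquare (Ideal.Quotient.mk P β) := by
  by_contra hcon
  push Not at hcon
  have hβ0 : β ≠ 0 := by rintro rfl; exact hβ (by simp)
  obtain ⟨E', i1, i2, i3, θ, hθ, hrep, σ, hσ⟩ := exists_quad E (β : E) hβ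
  have hInteg : IsIntegral ℤ θ := by
    apply IsIntegral.of_pow (n := 2) (by norm_num)
    rw [hθ]
    exact (RingOfIntegers.isIntegral_coe β).algebraMap
  let Θ : 𝓞 E' := ⟨θ, hInteg⟩
  have hΘ : Θ ^ 2 = algebraMap (𝓞 E) (𝓞 E') β := by
    apply RingOfIntegers.ext
    exact hθ
  -- enlarge the bound so that β is not in P
  set B' := max (max B 2) (Ideal.absNorm (Ideal.span {β})) with hB'
  have hβP : ∀ P : Ideal (𝓞 E), (Ideal.absNorm P).Prime → B' < Ideal.absNorm P → β ∉ P := by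
    intro P hP hBP hmem
    have hd : Ideal.absNorm P ∣ Ideal.absNorm (Ideal.span {β}) :=
      map_dvd Ideal.absNorm (Ideal.dvd_span_singleton.mpr hmem)
    have h0 : 0 < Ideal.absNorm (Ideal.span {β}) := by
      rw [Nat.pos_iff_ne_zero, Ne, Ideal.absNorm_eq_zero_iff]
      simpa using hβ0
    have := Nat.le_of_dvd h0 hd
    have := le_max_right (max B 2) (Ideal.absNorm (Ideal.span {β}))
    omega
  have key : ∀ P : {P : Ideal (𝓞 E) // (Ideal.absNorm P).Prime ∧ B' < Ideal.absNorm P},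
      ∃ Q : Bool → Ideal (𝓞 E'), Q true ≠ Q false ∧
      ∀ b, (Q b).comap (algebraMap (𝓞 E) (𝓞 E')) = P.1 ∧ Ideal.absNorm (Q b) = Ideal.absNorm P.1 := by
    rintro ⟨P, hPn, hPB⟩
    have hP : P.IsPrime := Ideal.isPrime_of_irreducible_absNorm hPn
    have hP0 : P ≠ ⊥ := by
      rintro rfl
      simp [Nat.not_prime_zero] at hPn
    have hB : B < Ideal.absNorm P :=
      lt_of_le_of_lt ((le_max_left B 2).trans (le_max_left _ _)) hPB
    have h2 : (2 : 𝓞 E) ∉ P := by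
      have := two_notMem P 2 two_ne_zero hPn
        (lt_of_le_of_lt ((le_max_right B 2).trans (le_max_left _ _)) hPB)
      exact_mod_cast this
    have hbP := hβP P hPn hPB
    obtain ⟨r, hr⟩ := hcon P hPn hB
    obtain ⟨s, rfl⟩ := Ideal.Quotient.mk_surjective r
    rw [← map_mul, Ideal.Quotient.eq, ← pow_two] at hr
    have hsP : s ∉ P := by
      intro h
      apply hbP
      have := P.add_mem hr (P.pow_mem_of_mem h 2 (by norm_num))
      simpa using this
    obtain ⟨Q1, hQ1, hc1, hm1, hn1⟩ := split_prime β Θ hΘ hrep σ hσ P hP hP0 h2 hbP s hr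
    obtain ⟨Q2, hQ2, hc2, hm2, hn2⟩ := split_prime β Θ hΘ hrep σ hσ P hP hP0 h2 hbP (-s)
      (by rw [neg_sq]; exact hr)
    refine ⟨fun b => if b then Q1 else Q2, ?_, ?_⟩
    · simp only [if_true, Bool.false_eq_true, if_false]
      rintro rfl
      have h3 := Q1.sub_mem hm2 hm1
      have h4 : Θ - algebraMap (𝓞 E) (𝓞 E') (-s) - (Θ - algebraMap (𝓞 E) (𝓞 E') s) =
        algebraMap (𝓞 E) (𝓞 E') (2 * s) := by
        rw [map_neg, map_mul, map_ofNat]; ring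
      rw [h4, ← Ideal.mem_comap, hc1] at h3
      rcases hP.mem_or_mem h3 with h | h
      · exact h2 h
      · exact hsP h
    · intro b
      cases b
      · exact ⟨hc2, hn2⟩
      · exact ⟨hc1, hn1⟩
  choose Q hQne hQ using key
  refine no_double E E' B' (fun x => Q x.1 x.2) ?_ (fun P b => (hQ P b).2)
  rintro ⟨P, b⟩ ⟨P', b'⟩ h
  simp only at h
  have h1 : P = P' := by
    apply Subtype.ext
    rw [← (hQ P b).1, ← (hQ P' b').1, h]
  subst h1
  have : b = b' := by
    cases b <;> cases b'
    · rfl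
    · exact absurd h.symm (hQne P)
    · exact absurd h (hQne P)
    · rfl
  rw [this]

theorem exists_pattern (B : ℕ) : ∀ (n : ℕ) (E : Type u) [Field E] [NumberField E] (β : 𝓞 E)
    (Γ : List (𝓞 E)), Γ.length = n →
    (∀ Γ' : List (𝓞 E), Γ'.Sublist Γ → ¬ IsSquare ((β * Γ'.prod : 𝓞 E) : E)) →
    ∃ P : Ideal (𝓞 E), (Ideal.absNorm P).Prime ∧ B < Ideal.absNorm P ∧
      (∀ γ ∈ Γ, IsSquare (Ideal.Quotient.mk P γ)) ∧ ¬ IsSquare (Ideal.Quotient.mk P β) := by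
  intro n
  induction n with
  | zero =>
    intro E _ _ β Γ hlen hΓ
    have : Γ = [] := List.length_eq_zero_iff.mp hlen
    subst this
    have := hΓ [] (List.Sublist.refl _)
    rw [List.prod_nil, mul_one] at this
    obtain ⟨P, h1, h2, h3⟩ := exists_nonsquare E β this B
    exact ⟨P, h1, h2, by simp, h3⟩
  | succ n ih =>
    intro E _ _ β Γ hlen hΓ
    match Γ, hlen with
    | γ :: Γ, hlen =>
    have hlen : Γ.length = n := by simpa using hlen
    by_cases hγ : IsSquare (γ : E)
    · obtain ⟨P, h1, h2, h3, h4⟩ := ih E β Γ hlen (fun Γ' h => hΓ Γ' (h.cons _))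
      refine ⟨P, h1, h2, ?_, h4⟩
      intro g hg
      rcases List.mem_cons.mp hg with rfl | hg
      · obtain ⟨t, ht⟩ := hγ
        have hInteg : IsIntegral ℤ t := by
          apply IsIntegral.of_pow (n := 2) (by norm_num)
          rw [pow_two, ← ht]; exact RingOfIntegers.isIntegral_coe _
        obtain ⟨t', ht'⟩ : ∃ t' : 𝓞 E, (t' : E) = t := ⟨⟨t, hInteg⟩, rfl⟩
        have e : g = t' * t' := by
          apply RingOfIntegers.ext
          rw [ht, ← ht']; rfl
        exact ⟨Ideal.Quotient.mk P t', by rw [← map_mul, ← e]⟩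
      · exact h3 g hg
    · obtain ⟨E', i1, i2, i3, θ, hθ, hrep, σ, hσ⟩ := exists_quad E (γ : E) hγ
      have hInteg : IsIntegral ℤ θ := by
        apply IsIntegral.of_pow (n := 2) (by norm_num)
        rw [hθ]
        exact (RingOfIntegers.isIntegral_coe γ).algebraMap
      have hγ0 : (γ : E) ≠ 0 := by intro h; rw [h] at hγ; exact hγ (by simp)
      have hθ0 : θ ≠ 0 := by
        rintro rfl
        rw [zero_pow two_ne_zero] at hθ
        exact hγ0 ((map_eq_zero _).mp hθ.symm)
      obtain ⟨P', h1, h2, h3, h4⟩ := ih E' (algebraMap (𝓞 E) (𝓞 E') β)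
        (Γ.map (algebraMap (𝓞 E) (𝓞 E'))) (by simpa using hlen) (by
        intro Γ'' hsub
        obtain ⟨Γ', hsub', rfl⟩ := List.sublist_map_iff.mp hsub
        rw [← map_list_prod, ← map_mul]
        rintro ⟨z, hz⟩
        have hz : algebraMap E E' ((β * Γ'.prod : 𝓞 E) : E) = z * z := hz
        set g : E := ((β * Γ'.prod : 𝓞 E) : E) with hg
        obtain ⟨a, b, rfl⟩ := hrep z
        have hσz := congrArg σ hz
        rw [σ.commutes] at hσz
        simp only [map_mul, map_add, σ.commutes, hσ] at hσz
        have hab : algebraMap E E' a * algebraMap E E' b = 0 := by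
          have h4 : 4 * (algebraMap E E' a * algebraMap E E' b) * θ = 0 := by
            linear_combination hσz - hz
          rcases mul_eq_zero.mp h4 with h | h
          · exact (mul_eq_zero.mp h).resolve_left (by norm_num)
          · exact absurd h hθ0
        rcases mul_eq_zero.mp hab with h | h
        · -- a = 0
          refine hΓ (γ :: Γ') (hsub'.cons_cons _) ⟨b * γ, ?_⟩
          apply (algebraMap E E').injective
          have : ((β * (γ :: Γ').prod : 𝓞 E) : E) = g * γ := by
            rw [hg, List.prod_cons, ← map_mul]; congr 1; ring
          rw [this, map_mul, hz, h]
          simp only [map_mul]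
          rw [← hθ]; ring
        · refine hΓ Γ' (hsub'.cons _) ⟨a, ?_⟩
          apply (algebraMap E E').injective
          rw [hz, h, map_mul]; ring)
      obtain ⟨hn, _⟩ := comap_norm (E := E) P' h1
      refine ⟨P'.comap (algebraMap (𝓞 E) (𝓞 E')), by rw [hn]; exact h1, by rw [hn]; exact h2, ?_, ?_⟩
      · intro g hg
        rw [comap_isSquare P' h1]
        rcases List.mem_cons.mp hg with rfl | hg
        · obtain ⟨t', ht'⟩ : ∃ t' : 𝓞 E', (t' : E') = θ := ⟨⟨θ, hInteg⟩, rfl⟩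
          have e : algebraMap (𝓞 E) (𝓞 E') g = t' * t' := by
            apply RingOfIntegers.ext
            have e1 : ((t' * t' : 𝓞 E') : E') = (t' : E') * (t' : E') := rfl
            rw [e1, ht', ← pow_two, hθ]; rfl
          exact ⟨Ideal.Quotient.mk P' t', by rw [← map_mul, ← e]⟩
        · exact h3 _ (List.mem_map_of_mem hg)
      · rw [comap_isSquare P' h1]
        exact h4

end CMU

end

section

open NumberField IntermediateField
open scoped nonZeroDivisors

namespace CMU

/-- `z` has a complex conjugate inside `L`, compatible with all embeddings. -/
def Good (L : IntermediateField ℚ ℂ) (z : L) : Prop :=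
  ∃ w : L, ∀ φ : L →+* ℂ, φ w = (starRingEnd ℂ) (φ z)

/-- All elements have conjugates. -/
def IsC (L : IntermediateField ℚ ℂ) : Prop := ∀ z : L, Good L z

lemma Good.add {L : IntermediateField ℚ ℂ} {x y : L} (hx : Good L x) (hy : Good L y) :
    Good L (x + y) := by
  obtain ⟨a, ha⟩ := hx
  obtain ⟨b, hb⟩ := hy
  exact ⟨a + b, fun φ => by rw [map_add, map_add, map_add, ha, hb]⟩

lemma Good.mul {L : IntermediateField ℚ ℂ} {x y : L} (hx : Good L x) (hy : Good L y) :
    Good L (x * y) := by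
  obtain ⟨a, ha⟩ := hx
  obtain ⟨b, hb⟩ := hy
  exact ⟨a * b, fun φ => by rw [map_mul, map_mul, map_mul, ha, hb]⟩

lemma Good.inv {L : IntermediateField ℚ ℂ} {x : L} (hx : Good L x) : Good L x⁻¹ := by
  obtain ⟨a, ha⟩ := hx
  exact ⟨a⁻¹, fun φ => by rw [map_inv₀, map_inv₀, map_inv₀, ha]⟩

lemma Good.rat {L : IntermediateField ℚ ℂ} (q : ℚ) : Good L (algebraMap ℚ L q) := by
  refine ⟨algebraMap ℚ L q, fun φ => ?_⟩
  rw [eq_ratCast, map_ratCast, map_ratCast]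

lemma Good.mono {F L : IntermediateField ℚ ℂ} (h : F ≤ L) {z : F} (hz : Good F z) :
    Good L (inclusion h z) := by
  obtain ⟨w, hw⟩ := hz
  exact ⟨inclusion h w, fun φ => hw (φ.comp (inclusion h).toRingHom)⟩

lemma isC_adjoin (S : Set ℂ) (hS : ∀ x (hx : x ∈ S), Good (adjoin ℚ S) ⟨x, subset_adjoin ℚ S hx⟩) :
    IsC (adjoin ℚ S) := by
  rintro ⟨z, hz⟩
  refine adjoin_induction ℚ (p := fun x hx => Good (adjoin ℚ S) ⟨x, hx⟩) ?_ ?_ ?_ ?_ ?_ hz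
  · exact hS
  · exact fun q => Good.rat q
  · exact fun x y hx hy h1 h2 => h1.add h2
  · exact fun x hx h1 => h1.inv
  · exact fun x y hx hy h1 h2 => h1.mul h2

lemma IsC.sup {F L : IntermediateField ℚ ℂ} (hF : IsC F) (hL : IsC L) : IsC (F ⊔ L) := by
  have key : ∀ M : IntermediateField ℚ ℂ, M = F ⊔ L → IsC M := by
    intro M hM
    have hM2 := hM
    rw [sup_def] at hM2
    subst hM2
    apply isC_adjoin
    rintro x (hx | hx)
    · exact (hF ⟨x, hx⟩).mono (hM ▸ le_sup_left)
    · exact (hL ⟨x, hx⟩).mono (hM ▸ le_sup_right)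
  exact key _ rfl

lemma good_of_sq {L : IntermediateField ℚ ℂ} (z : L) (q : ℚ) (hz : z ^ 2 = algebraMap ℚ L q) :
    Good L z := by
  have h : ∀ φ : L →+* ℂ, (φ z) ^ 2 = ((q : ℝ) : ℂ) := by
    intro φ
    rw [← map_pow, hz, eq_ratCast, map_ratCast, Complex.ofReal_ratCast]
  by_cases hq : 0 ≤ q
  · refine ⟨z, fun φ => ?_⟩
    have h1 := h φ
    have h2 := congrArg Complex.re h1
    have h3 := congrArg Complex.im h1
    rw [pow_two, Complex.mul_re, Complex.ofReal_re] at h2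
    rw [pow_two, Complex.mul_im, Complex.ofReal_im] at h3
    have hq' : (0 : ℝ) ≤ q := by exact_mod_cast hq
    have h4 : (φ z).im = 0 := by
      by_contra hne
      have h5 : (φ z).re = 0 := by
        have : (φ z).re * (φ z).im = 0 := by linarith
        exact (mul_eq_zero.mp this).resolve_right hne
      rw [h5] at h2
      have := mul_self_pos.mpr hne
      linarith
    exact (Complex.conj_eq_iff_im.mpr h4).symm
  · refine ⟨-z, fun φ => ?_⟩
    have h1 := h φ
    have h2 := congrArg Complex.re h1
    have h3 := congrArg Complex.im h1
    rw [pow_two, Complex.mul_re, Complex.ofReal_re] at h2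
    rw [pow_two, Complex.mul_im, Complex.ofReal_im] at h3
    have hq' : (q : ℝ) < 0 := by exact_mod_cast not_le.mp hq
    have h4 : (φ z).re = 0 := by
      by_contra hne
      have h5 : (φ z).im = 0 := by
        have : (φ z).re * (φ z).im = 0 := by linarith
        exact (mul_eq_zero.mp this).resolve_left hne
      rw [h5] at h2
      have := mul_self_pos.mpr hne
      linarith
    rw [map_neg]
    apply Complex.ext
    · rw [Complex.conj_re, Complex.neg_re, h4, neg_zero]
    · rw [Complex.conj_im, Complex.neg_im]

lemma isC_adjoin_sq (S : Set ℂ) (hS : ∀ x ∈ S, ∃ q : ℚ, x ^ 2 = q) : IsC (adjoin ℚ S) := by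
  apply isC_adjoin
  intro x hx
  obtain ⟨q, hq⟩ := hS x hx
  apply good_of_sq _ q
  apply Subtype.ext
  rw [SubmonoidClass.coe_pow, hq]
  simp

lemma isC_of_isCM {K : IntermediateField ℚ ℂ} (hK : IsCM K) : IsC K := by
  obtain ⟨him, Kp, h, hreal, hrank⟩ := hK
  letI : Algebra Kp K := (IntermediateField.inclusion h).toRingHom.toAlgebra
  have hrank : Module.finrank Kp K = 2 := hrank
  have hR : ∀ (φ : K →+* ℂ) (a : Kp), (φ (algebraMap Kp K a)).im = 0 := fun φ a =>
    hreal (φ.comp (algebraMap Kp K)) a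
  intro z
  by_cases hz : ∃ a : Kp, algebraMap Kp K a = z
  · obtain ⟨a, rfl⟩ := hz
    exact ⟨algebraMap Kp K a, fun φ => (Complex.conj_eq_iff_im.mpr (hR φ a)).symm⟩
  · have hli : LinearIndependent Kp ![(1 : K), z] := by
      rw [LinearIndependent.pair_iff]
      intro s t hst
      have ht : t = 0 := by
        by_contra ht
        apply hz
        refine ⟨-s / t, ?_⟩
        have ht' : algebraMap Kp K t ≠ 0 := by simpa using ht
        rw [map_div₀, map_neg, div_eq_iff ht']
        rw [Algebra.smul_def, Algebra.smul_def, mul_one] at hst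
        linear_combination -hst
      refine ⟨?_, ht⟩
      rw [ht, zero_smul, add_zero, Algebra.smul_def, mul_one] at hst
      simpa using hst
    have hspan := hli.span_eq_top_of_card_eq_finrank (by rw [hrank]; simp)
    have hall : ∀ y : K, ∃ a b : Kp, y = algebraMap Kp K a + algebraMap Kp K b * z := by
      intro y
      have hy : y ∈ Submodule.span Kp (Set.range ![(1 : K), z]) := by rw [hspan]; trivial
      simp only [Matrix.range_cons, Matrix.range_empty, Set.union_empty] at hy
      rw [Set.singleton_union, Submodule.mem_span_pair] at hy
      obtain ⟨a, b, hab⟩ := hy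
      exact ⟨a, b, by rw [← hab, Algebra.smul_def, Algebra.smul_def, mul_one]⟩
    have hne : ∀ φ : K →+* ℂ, (φ z).im ≠ 0 := by
      intro φ h0
      obtain ⟨y, hy⟩ := him φ
      obtain ⟨a, b, rfl⟩ := hall y
      apply hy
      rw [map_add, map_mul, Complex.add_im, Complex.mul_im, hR, hR, h0]
      ring
    obtain ⟨n, t, hnt⟩ := hall (z * z)
    refine ⟨algebraMap Kp K t - z, fun φ => ?_⟩
    have h1 := congrArg φ hnt
    rw [map_add, map_mul, map_mul] at h1
    have h3 := congrArg Complex.im h1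
    rw [Complex.add_im, Complex.mul_im, Complex.mul_im, hR, hR] at h3
    have h4 : (φ (algebraMap Kp K t)).re = 2 * (φ z).re := by
      apply mul_right_cancel₀ (hne φ)
      linarith
    rw [map_sub]
    apply Complex.ext
    · rw [Complex.conj_re, Complex.sub_re, h4]; ring
    · rw [Complex.conj_im, Complex.sub_im, hR]; ring

/-- Key obstruction to being a square. -/
lemma not_square {L : IntermediateField ℚ ℂ} [FiniteDimensional ℚ L] (hL : IsC L) (z : L) (N : ℕ)
    (hN : ¬ IsSquare (N : ℚ)) (hz : (z : ℂ) * (starRingEnd ℂ) (z : ℂ) = N) : ¬ IsSquare z := by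
  rintro ⟨γ, rfl⟩
  obtain ⟨w, hw⟩ := hL γ
  have hw0 : (w : ℂ) = (starRingEnd ℂ) (γ : ℂ) := hw (algebraMap L ℂ)
  have hρ : (γ * w) ^ 2 = algebraMap ℚ L (N : ℚ) := by
    apply Subtype.ext
    have : ((algebraMap ℚ L (N : ℚ) : L) : ℂ) = N := by simp
    rw [this, ← hz]
    simp only [SubmonoidClass.coe_pow, MulMemClass.coe_mul, map_mul, hw0]
    ring
  have hirr : Irreducible (Polynomial.X ^ 2 - Polynomial.C (N : ℚ) : Polynomial ℚ) := by
    refine X_pow_sub_C_irreducible_of_prime Nat.prime_two fun b hb => hN ⟨b, ?_⟩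
    rw [← hb, pow_two]
  have hmin : Polynomial.X ^ 2 - Polynomial.C (N : ℚ) = minpoly ℚ (γ * w) := by
    apply minpoly.eq_of_irreducible_of_monic hirr
    · simp only [map_sub, map_pow, Polynomial.aeval_X, Polynomial.aeval_C, hρ, sub_self]
    · exact Polynomial.monic_X_pow_sub_C _ two_ne_zero
  obtain ⟨φ, hφ⟩ := exists_algHom_of_splits_of_aeval (F := ℚ) (E := L) (K := ℂ)
    (fun s => ⟨Algebra.IsIntegral.isIntegral s, IsAlgClosed.splits _⟩) (x := γ * w)
    (y := -((γ * w : L) : ℂ)) (by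
      rw [← hmin]
      simp only [map_sub, map_pow, Polynomial.aeval_X, Polynomial.aeval_C, neg_sq]
      have := congrArg (algebraMap L ℂ) hρ
      rw [map_pow] at this
      rw [sub_eq_zero]
      exact this)
  have h1 : φ (γ * w) = ((Complex.normSq (φ γ) : ℝ) : ℂ) := by
    rw [map_mul, ← Complex.mul_conj]
    congr 1
    exact hw φ.toRingHom
  have h2 : ((γ * w : L) : ℂ) = ((Complex.normSq (γ : ℂ) : ℝ) : ℂ) := by
    rw [← Complex.mul_conj, MulMemClass.coe_mul, hw0]
  rw [h1, h2, ← Complex.ofReal_neg, Complex.ofReal_inj] at hφ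
  have h3 := Complex.normSq_nonneg (φ γ)
  have h4 := Complex.normSq_nonneg (γ : ℂ)
  have h5 : Complex.normSq (γ : ℂ) = 0 := by linarith
  rw [Complex.normSq_eq_zero] at h5
  apply hN
  have h6 : (N : ℂ) = 0 := by rw [← hz, MulMemClass.coe_mul, h5]; simp
  have h7 : N = 0 := by exact_mod_cast h6
  rw [h7]; simp

end CMU

end

section

open NumberField IntermediateField
open scoped nonZeroDivisors

namespace CMU

/-- A sequence of distinct primes `1 mod 8`, written as sums of two squares. -/
structure PData where
  p : ℕ → ℕ
  x : ℕ → ℤ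
  y : ℕ → ℤ
  prime : ∀ j, (p j).Prime
  mod8 : ∀ j, p j % 8 = 1
  inj : Function.Injective p
  sum : ∀ j, (p j : ℤ) = x j ^ 2 + y j ^ 2
  evenx : ∀ j, Even (x j)
  oddy : ∀ j, Odd (y j)

lemma exists_pdata : Nonempty PData := by
  have hinf : Set.Infinite {p : ℕ | p.Prime ∧ p ≡ 1 [MOD 8]} :=
    Nat.infinite_setOfPred_prime_modEq_one (by norm_num)
  let e := hinf.natEmbedding
  have hp : ∀ j, (e j : ℕ).Prime := fun j => (e j).2.1
  have h8 : ∀ j, (e j : ℕ) % 8 = 1 := fun j => (e j).2.2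
  have hs : ∀ j, ∃ x y : ℤ, ((e j : ℕ) : ℤ) = x ^ 2 + y ^ 2 ∧ Even x ∧ Odd y := by
    intro j
    have := Fact.mk (hp j)
    obtain ⟨a, b, hab⟩ := Nat.Prime.sq_add_sq (p := (e j : ℕ)) (by have := h8 j; omega)
    have hab' : ((e j : ℕ) : ℤ) = (a : ℤ) ^ 2 + (b : ℤ) ^ 2 := by exact_mod_cast hab.symm
    have hodd : Odd ((e j : ℕ) : ℤ) := by
      have := h8 j
      rw [Int.odd_iff]; omega
    rw [hab', Int.odd_add, Int.odd_pow' two_ne_zero, Int.even_pow' two_ne_zero] at hodd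
    rcases Int.even_or_odd (a : ℤ) with ha | ha
    · refine ⟨a, b, hab', ha, ?_⟩
      by_contra hb
      rw [Int.not_odd_iff_even] at hb
      exact (Int.not_even_iff_odd.mpr (hodd.mpr hb)) ha
    · exact ⟨b, a, by rw [hab']; ring, hodd.mp ha, ha⟩
  choose x y h1 h2 h3 using hs
  exact ⟨⟨fun j => e j, x, y, hp, h8, fun a b h => e.injective (Subtype.ext h), h1, h2, h3⟩⟩

lemma N_notsq (D : PData) (δ : ℕ → Bool) (l : List ℕ) (hl : l.Nodup) :
    ¬ IsSquare ((D.p 0 * (l.map fun j => (if δ j then 1 else D.p 0) * D.p (j + 1)).prod : ℕ) : ℚ) := by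
  rw [Rat.isSquare_natCast_iff]
  have key : ∀ p M : ℕ, p.Prime → ¬ p ∣ M → ¬ IsSquare (p * M) := by
    rintro p M hp hM ⟨s, hs⟩
    have h1 : p ∣ s * s := hs ▸ dvd_mul_right p M
    have h2 : p ∣ s := by rcases hp.dvd_mul.mp h1 with h | h <;> exact h
    obtain ⟨t, rfl⟩ := h2
    apply hM
    refine ⟨t * t, ?_⟩
    apply Nat.eq_of_mul_eq_mul_left hp.pos
    rw [hs]; ring
  have hne : ∀ i j, i ≠ j → ¬ D.p i ∣ D.p j := by
    intro i j hij h
    rw [Nat.prime_dvd_prime_iff_eq (D.prime i) (D.prime j)] at h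
    exact hij (D.inj h)
  cases l with
  | nil =>
    rw [List.map_nil, List.prod_nil]
    exact key _ _ (D.prime 0) (by simpa using (D.prime 0).one_lt.ne')
  | cons a l =>
    rw [List.map_cons, List.prod_cons]
    have : D.p 0 * ((if δ a then 1 else D.p 0) * D.p (a + 1) *
      (l.map fun j => (if δ j then 1 else D.p 0) * D.p (j + 1)).prod) = D.p (a + 1) *
      (D.p 0 * ((if δ a then 1 else D.p 0) *
      (l.map fun j => (if δ j then 1 else D.p 0) * D.p (j + 1)).prod)) := by ring
    rw [this]
    apply key _ _ (D.prime _)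
    have hif : ∀ b : Bool, ¬ D.p (a + 1) ∣ (if b then 1 else D.p 0) := by
      intro b
      cases b
      · simpa using hne (a + 1) 0 (by omega)
      · simpa using (D.prime (a + 1)).one_lt.ne'
    intro h
    rcases (D.prime _).dvd_mul.mp h with h | h
    · exact hne _ _ (by omega) h
    rcases (D.prime _).dvd_mul.mp h with h | h
    · exact hif _ h
    rw [Prime.dvd_prod_iff (D.prime _).prime] at h
    obtain ⟨m, hm, h⟩ := h
    obtain ⟨j, hj, rfl⟩ := List.mem_map.mp hm
    rcases (D.prime _).dvd_mul.mp h with h | h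
    · exact hif _ h
    · refine hne (a + 1) (j + 1) ?_ h
      intro h
      have : a = j := by omega
      subst this
      exact (List.nodup_cons.mp hl).1 hj

/-- The property of degree one primes that we want. -/
def Pat (D : PData) (δ : ℕ → Bool) (r q : ℕ) : Prop :=
  q % 8 = 1 ∧ ∃ I : ZMod q, I ^ 2 = -1 ∧ ∀ j < r, q ≠ D.p (j + 1) ∧ IsSquare (D.p (j + 1) : ZMod q) ∧
    (IsSquare ((D.x (j + 1) : ZMod q) + (D.y (j + 1) : ZMod q) * I) ↔ δ j = true)

lemma pattern_aux (D : PData) (δ : ℕ → Bool) (r : ℕ) (L : IntermediateField ℚ ℂ)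
    [FiniteDimensional ℚ L] (hL : IsC L) (i t : 𝓞 L) (s : ℕ → 𝓞 L) (hi : ((i : L) : ℂ) = Complex.I)
    (ht : t ^ 2 = 2) (hs : ∀ j < r, s j ^ 2 = -(D.p (j + 1) : 𝓞 L)) :
    ∃ P : Ideal (𝓞 L), (Ideal.absNorm P).Prime ∧ Pat D δ r (Ideal.absNorm P) := by
  let z : ℕ → 𝓞 L := fun j => (D.x j : 𝓞 L) + (D.y j : 𝓞 L) * i
  let g : ℕ → 𝓞 L := fun j => (if δ j then 1 else z 0) * z (j + 1)
  have hzC : ∀ j, ((z j : L) : ℂ) = D.x j + D.y j * Complex.I := by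
    intro j
    rw [← hi]
    have : ∀ n : ℤ, (((n : 𝓞 L) : L) : ℂ) = n := fun n => by simp
    rw [← this, ← this]; rfl
  let ν : 𝓞 L →* ℝ := (Complex.normSq : ℂ →* ℝ).comp
    (((algebraMap L ℂ).comp (algebraMap (𝓞 L) L) : 𝓞 L →+* ℂ) : 𝓞 L →* ℂ)
  have hν : ∀ a : 𝓞 L, ν a = Complex.normSq ((a : L) : ℂ) := fun a => rfl
  have hνz : ∀ j, ν (z j) = (D.p j : ℝ) := by
    intro j
    rw [hν, hzC, Complex.normSq_apply]
    simp
    have := D.sum j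
    have h : (D.p j : ℝ) = D.x j ^ 2 + D.y j ^ 2 := by exact_mod_cast this
    rw [h]; ring
  have hνg : ∀ j, ν (g j) = (((if δ j then 1 else D.p 0) * D.p (j + 1) : ℕ) : ℝ) := by
    intro j
    simp only [g, map_mul, hνz]
    cases δ j <;> simp [hνz]
  obtain ⟨P, hP, hB, hg, hz0⟩ := exists_pattern (2 + ∑ j ∈ Finset.range r, D.p (j + 1)) r L (z 0)
    ((List.range r).map g) (by simp) (by
      intro Γ' hsub
      obtain ⟨l, hl, rfl⟩ := List.sublist_map_iff.mp hsub
      refine not_square hL _ _ (N_notsq D δ l (hl.nodup List.nodup_range)) ?_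
      rw [Complex.mul_conj, ← hν]
      have h : ν (z 0 * (l.map g).prod) = ((D.p 0 * (l.map fun j =>
          (if δ j then 1 else D.p 0) * D.p (j + 1)).prod : ℕ) : ℝ) := by
        rw [map_mul, hνz, map_list_prod, List.map_map, Nat.cast_mul, Nat.cast_list_prod,
          List.map_map]
        congr 2
        apply List.map_congr_left
        intro j _
        exact hνg j
      rw [h, Complex.ofReal_natCast])
  refine ⟨P, hP, ?_⟩
  have hfin : Finite (𝓞 L ⧸ P) := Nat.finite_of_card_ne_zero (by
    rw [← norm_eq_card]; exact hP.ne_zero)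
  let _ : Fintype (𝓞 L ⧸ P) := Fintype.ofFinite _
  have hcard : Fintype.card (𝓞 L ⧸ P) = Ideal.absNorm P := by
    rw [norm_eq_card, Nat.card_eq_fintype_card]
  let e := ZMod.ringEquivOfPrime (𝓞 L ⧸ P) hP hcard
  set q := Ideal.absNorm P with hq
  have hF : Fact q.Prime := ⟨hP⟩
  let ψ : 𝓞 L →+* ZMod q := (e.symm : (𝓞 L ⧸ P) →+* ZMod q).comp (Ideal.Quotient.mk P)
  have hψ : ∀ a, ψ a = e.symm (Ideal.Quotient.mk P a) := fun a => rfl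
  have hψsq : ∀ a, IsSquare (Ideal.Quotient.mk P a) ↔ IsSquare (ψ a) := by
    intro a
    constructor
    · intro h
      exact h.map e.symm
    · intro h
      have := h.map e
      rwa [hψ, e.apply_symm_apply] at this
  have hi2 : i ^ 2 = -1 := by
    apply RingOfIntegers.ext
    apply Subtype.ext
    change ((i : L) : ℂ) ^ 2 = -1
    rw [hi, Complex.I_sq]
  have hψi : ψ i ^ 2 = -1 := by rw [← map_pow, hi2, map_neg, map_one]
  have hψt : ψ t ^ 2 = 2 := by rw [← map_pow, ht, map_ofNat]
  have hψz : ∀ j, ψ (z j) = (D.x j : ZMod q) + (D.y j : ZMod q) * ψ i := by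
    intro j; simp [z]
  have hlt : ∀ j < r, D.p (j + 1) < q := by
    intro j hj
    have := Finset.single_le_sum (f := fun j => D.p (j + 1)) (fun _ _ => Nat.zero_le _)
      (Finset.mem_range.mpr hj)
    have h1 : D.p (j + 1) ≤ ∑ j ∈ Finset.range r, D.p (j + 1) := this
    omega
  have hne0 : ∀ j < r, ψ (z (j + 1)) ≠ 0 := by
    intro j hj h0
    have h1 : ((D.p (j + 1) : ℕ) : ZMod q) = 0 := by
      have h2 : ((D.p (j + 1) : ℕ) : ZMod q) = (D.x (j + 1) : ZMod q) ^ 2 + (D.y (j + 1) : ZMod q) ^ 2 := by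
        have := congrArg (fun n : ℤ => (n : ZMod q)) (D.sum (j + 1))
        push_cast at this
        exact this
      rw [hψz] at h0
      rw [h2]
      linear_combination ((D.x (j + 1) : ZMod q) - (D.y (j + 1) : ZMod q) * ψ i) * h0 + (D.y (j + 1) : ZMod q) ^ 2 * hψi
    rw [ZMod.natCast_eq_zero_iff] at h1
    exact absurd (Nat.le_of_dvd (D.prime _).pos h1) (not_le.mpr (hlt j hj))
  refine ⟨?_, ψ i, hψi, ?_⟩
  · have h2 := (ZMod.exists_sq_eq_two_iff (p := q) (by omega)).mp ⟨ψ t, by rw [← hψt, pow_two]⟩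
    have h1 := (ZMod.exists_sq_eq_neg_one_iff (p := q)).mp ⟨ψ i, by rw [← hψi, pow_two]⟩
    omega
  · intro j hj
    refine ⟨(hlt j hj).ne', ⟨ψ i * ψ (s j), ?_⟩, ?_⟩
    · have h1 : ψ (s j) ^ 2 = -(D.p (j + 1) : ZMod q) := by
        rw [← map_pow, hs j hj, map_neg, map_natCast]
      linear_combination -(ψ (s j)) ^ 2 * hψi + h1
    · rw [← hψz]
      have h1 := hg (g j) (List.mem_map_of_mem (List.mem_range.mpr hj))
      rw [hψsq] at h1 hz0
      cases hδ : δ j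
      · simp only [Bool.false_eq_true, iff_false]
        intro h2
        simp only [g, hδ, map_mul] at h1
        apply hz0
        have h3 := h1.div h2
        simpa [hne0 j hj] using h3
      · simp only [iff_true]
        simpa [g, hδ] using h1

lemma lift_integral {L : IntermediateField ℚ ℂ} (a : ℂ) (ha : a ∈ L) (h : IsIntegral ℤ a) :
    ∃ b : 𝓞 L, ((b : L) : ℂ) = a := by
  have : IsIntegral ℤ (⟨a, ha⟩ : L) := by
    rw [← isIntegral_algebraMap_iff (algebraMap L ℂ).injective]
    exact h
  exact ⟨⟨⟨a, ha⟩, this⟩, rfl⟩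

/-- square root of `-n` in `ℂ`. -/
noncomputable def rt (n : ℕ) : ℂ := Complex.I * ((Real.sqrt n : ℝ) : ℂ)

lemma rt_sq (n : ℕ) : rt n ^ 2 = -(n : ℂ) := by
  rw [rt, mul_pow, Complex.I_sq, ← Complex.ofReal_pow, Real.sq_sqrt (Nat.cast_nonneg n)]
  simp

lemma isIntegral_of_sq (a : ℂ) (n : ℤ) (h : a ^ 2 = n) : IsIntegral ℤ a := by
  apply IsIntegral.of_pow (n := 2) (by norm_num)
  rw [h]
  exact isIntegral_algebraMap (x := n)

lemma pattern (D : PData) (δ : ℕ → Bool) (r : ℕ) (L : IntermediateField ℚ ℂ)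
    [FiniteDimensional ℚ L] (hL : IsC L) :
    ∃ P : Ideal (𝓞 L), (Ideal.absNorm P).Prime ∧ Pat D δ r (Ideal.absNorm P) := by
  let S : Set ℂ := {Complex.I, ((Real.sqrt 2 : ℝ) : ℂ)} ∪ (fun j => rt (D.p (j + 1))) '' Set.Iio r
  have hSfin : S.Finite := Set.Finite.union (by simp) ((Set.finite_Iio r).image _)
  have h2 : ((Real.sqrt 2 : ℝ) : ℂ) ^ 2 = 2 := by
    rw [← Complex.ofReal_pow, Real.sq_sqrt (by norm_num)]; simp
  have hSq : ∀ x ∈ S, ∃ n : ℤ, x ^ 2 = n := by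
    rintro x ((rfl | rfl) | ⟨j, _, rfl⟩)
    · exact ⟨-1, by simp⟩
    · exact ⟨2, by rw [h2]; simp⟩
    · exact ⟨-(D.p (j + 1) : ℤ), by simp [rt_sq]⟩
  have hSC : IsC (adjoin ℚ S) := isC_adjoin_sq S (fun x hx => by
    obtain ⟨n, hn⟩ := hSq x hx
    exact ⟨n, by rw [hn]; simp⟩)
  have hfd : FiniteDimensional ℚ (adjoin ℚ S) := by
    have : Finite S := hSfin
    exact finiteDimensional_adjoin (fun x hx => by
      obtain ⟨n, hn⟩ := hSq x hx
      exact (isIntegral_of_sq x n hn).tower_top)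
  let M := L ⊔ adjoin ℚ S
  have hSM : ∀ x ∈ S, x ∈ M := fun x hx => (le_sup_right : adjoin ℚ S ≤ M) (subset_adjoin ℚ S hx)
  have hMC : IsC M := hL.sup hSC
  have hex : ∀ x ∈ S, ∃ b : 𝓞 M, ((b : M) : ℂ) = x := fun x hx => by
    obtain ⟨n, hn⟩ := hSq x hx
    exact lift_integral x (hSM x hx) (isIntegral_of_sq x n hn)
  obtain ⟨i, hi⟩ := hex Complex.I (by simp [S])
  obtain ⟨t, ht⟩ := hex ((Real.sqrt 2 : ℝ) : ℂ) (by simp [S])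
  have hs : ∀ j, ∃ b : 𝓞 M, j < r → ((b : M) : ℂ) = rt (D.p (j + 1)) := by
    intro j
    by_cases hj : j < r
    · obtain ⟨b, hb⟩ := hex (rt (D.p (j + 1))) (Or.inr ⟨j, hj, rfl⟩)
      exact ⟨b, fun _ => hb⟩
    · exact ⟨0, fun h => absurd h hj⟩
  choose s hs using hs
  obtain ⟨P, hP, hPat⟩ := pattern_aux D δ r M hMC i t s hi (by
    apply RingOfIntegers.ext
    apply Subtype.ext
    change ((t : M) : ℂ) ^ 2 = 2
    rw [ht, h2]) (fun j hj => by
    apply RingOfIntegers.ext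
    apply Subtype.ext
    change ((s j : M) : ℂ) ^ 2 = -(((D.p (j + 1) : 𝓞 M) : M) : ℂ)
    rw [hs j hj, rt_sq]
    simp)
  let _ : Algebra L M := (inclusion (le_sup_left : L ≤ M)).toRingHom.toAlgebra
  obtain ⟨h1, _⟩ := comap_norm (E := L) P hP
  exact ⟨P.comap (algebraMap (𝓞 L) (𝓞 M)), by rw [h1]; exact hP, by rw [h1]; exact hPat⟩

end CMU

end

section

open NumberField IntermediateField
open scoped nonZeroDivisors

namespace CMU

section norms

variable {E E' : Type*} [Field E] [NumberField E] [Field E'] [NumberField E'] [Algebra E E']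

lemma span_eq_relNorm (I : Ideal (𝓞 E')) :
    Ideal.span {y : 𝓞 E | ∃ x ∈ I, (y : E) = Algebra.norm E (x : E')} = Ideal.relNorm (𝓞 E) I := by
  rw [Ideal.relNorm_apply]
  congr 1
  ext y
  have key : ∀ x : 𝓞 E', ((Algebra.intNorm (𝓞 E) (𝓞 E') x : 𝓞 E) : E) = Algebra.norm E (x : E') :=
    fun x => Algebra.algebraMap_intNorm (A := 𝓞 E) (K := E) (L := E') (B := 𝓞 E') x
  constructor
  · rintro ⟨x, hx, h⟩
    exact ⟨x, hx, RingOfIntegers.ext (by rw [key, h])⟩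
  · rintro ⟨x, hx, rfl⟩
    exact ⟨x, hx, key x⟩

lemma relNorm_deg_one (P : Ideal (𝓞 E')) (h : (Ideal.absNorm P).Prime) :
    Ideal.relNorm (𝓞 E) P = P.comap (algebraMap (𝓞 E) (𝓞 E')) := by
  have h1 : Ideal.absNorm (Ideal.relNorm (𝓞 E) P) = Ideal.absNorm P := Ideal.absNorm_relNorm _ _ _
  have hp : (Ideal.absNorm (Ideal.relNorm (𝓞 E) P)).Prime := by rw [h1]; exact h
  have hprime : (Ideal.relNorm (𝓞 E) P).IsPrime := Ideal.isPrime_of_irreducible_absNorm hp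
  have hne : Ideal.relNorm (𝓞 E) P ≠ ⊥ := by
    intro h0
    rw [h0, Ideal.absNorm_bot] at hp
    exact Nat.not_prime_zero hp
  have hP : P.IsPrime := Ideal.isPrime_of_irreducible_absNorm h
  exact (hprime.isMaximal hne).eq_of_le (Ideal.comap_ne_top _ hP.ne_top)
    (Ideal.relNorm_le_comap _ P)

lemma mk0_relNorm (I I' : (Ideal (𝓞 E'))⁰) (h : ClassGroup.mk0 I = ClassGroup.mk0 I')
    (J J' : (Ideal (𝓞 E))⁰) (hJ : (J : Ideal (𝓞 E)) = Ideal.relNorm (𝓞 E) (I : Ideal (𝓞 E')))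
    (hJ' : (J' : Ideal (𝓞 E)) = Ideal.relNorm (𝓞 E) (I' : Ideal (𝓞 E'))) :
    ClassGroup.mk0 J = ClassGroup.mk0 J' := by
  rw [ClassGroup.mk0_eq_mk0_iff] at h ⊢
  obtain ⟨x, y, hx, hy, hxy⟩ := h
  refine ⟨Algebra.intNorm (𝓞 E) (𝓞 E') x, Algebra.intNorm (𝓞 E) (𝓞 E') y, ?_, ?_, ?_⟩
  · rwa [Ne, Algebra.intNorm_eq_zero]
  · rwa [Ne, Algebra.intNorm_eq_zero]
  · rw [hJ, hJ', ← Ideal.relNorm_singleton, ← Ideal.relNorm_singleton, ← map_mul, hxy, map_mul]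

end norms

section quad

lemma quad_norm_trace {K : Type*} [Field K] [NumberField K] (s : K) (p : ℕ) (hs : s ^ 2 = -(p : K))
    (hp : p.Prime) (hrank : Module.finrank ℚ K = 2) : ∀ c : K, ∃ a b : ℚ, Algebra.norm ℚ c = a ^ 2 + p * b ^ 2 ∧
    Algebra.trace ℚ K c = 2 * a := by
  have hli : LinearIndependent ℚ ![(1 : K), s] := by
    rw [LinearIndependent.pair_iff]
    intro a b hab
    rw [Algebra.smul_def, Algebra.smul_def, mul_one, eq_ratCast, eq_ratCast] at hab
    have h1 : (a : K) ^ 2 + p * (b : K) ^ 2 = 0 := by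
      linear_combination ((a : K) - b * s) * hab + (b : K) ^ 2 * hs
    have h2 : a ^ 2 + p * b ^ 2 = 0 := by exact_mod_cast h1
    have h3 : (0 : ℚ) < p := by exact_mod_cast hp.pos
    have hb : b = 0 := by
      by_contra hb
      have := sq_nonneg a
      have := mul_pos h3 (pow_pos (abs_pos.mpr hb) 2)
      rw [sq_abs] at this
      linarith
    have ha : a = 0 := by
      rw [hb] at h2
      simpa using h2
    exact ⟨ha, hb⟩
  let b := basisOfLinearIndependentOfCardEqFinrank hli (by rw [hrank]; simp)
  have hb0 : b 0 = 1 := by simp [b]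
  have hb1 : b 1 = s := by simp [b]
  intro c
  refine ⟨b.repr c 0, b.repr c 1, ?_⟩
  set u := b.repr c 0 with hu
  set v := b.repr c 1 with hv
  have hc : c = u • b 0 + v • b 1 := by
    rw [hu, hv, ← Fin.sum_univ_two (f := fun i => b.repr c i • b i), b.sum_repr]
  have e0 : c * b 0 = u • b 0 + v • b 1 := by rw [hb0, mul_one]; rw [hb0] at hc; exact hc
  have e1 : c * b 1 = (-(p : ℚ) * v) • b 0 + u • b 1 := by
    rw [hc, hb0, hb1]
    simp only [Algebra.smul_def, eq_ratCast]
    push_cast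
    linear_combination (v : K) * hs
  have m00 : Algebra.leftMulMatrix b c 0 0 = u := by
    rw [Algebra.leftMulMatrix_eq_repr_mul, e0]; simp
  have m10 : Algebra.leftMulMatrix b c 1 0 = v := by
    rw [Algebra.leftMulMatrix_eq_repr_mul, e0]; simp
  have m01 : Algebra.leftMulMatrix b c 0 1 = -(p : ℚ) * v := by
    rw [Algebra.leftMulMatrix_eq_repr_mul, e1]; simp
  have m11 : Algebra.leftMulMatrix b c 1 1 = u := by
    rw [Algebra.leftMulMatrix_eq_repr_mul, e1]; simp
  constructor
  · rw [Algebra.norm_eq_matrix_det b, Matrix.det_fin_two, m00, m01, m10, m11]; ring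
  · rw [Algebra.trace_eq_matrix_trace b, Matrix.trace_fin_two, m00, m11]; ring

lemma int_of_integral (a : ℚ) (h : IsIntegral ℤ a) : ∃ n : ℤ, (n : ℚ) = a := by
  obtain ⟨n, hn⟩ := IsIntegrallyClosed.isIntegral_iff.mp h
  exact ⟨n, by rw [← hn]; rfl⟩

lemma quad_form {K : Type*} [Field K] [NumberField K] (s : K) (p : ℕ) (hs : s ^ 2 = -(p : K))
    (hp : p.Prime) (hrank : Module.finrank ℚ K = 2) (hp4 : p % 4 = 1) (c : 𝓞 K) : ∃ u v : ℤ, Algebra.norm ℤ c = u ^ 2 + p * v ^ 2 := by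
  obtain ⟨a, b, hn, ht⟩ := quad_norm_trace s p hs hp hrank (c : K)
  obtain ⟨U, hU⟩ := int_of_integral _ (Algebra.isIntegral_trace (L := ℚ) (F := K)
    (RingOfIntegers.isIntegral_coe c))
  have hN : ((Algebra.norm ℤ c : ℤ) : ℚ) = Algebra.norm ℚ (c : K) := Algebra.coe_norm_int c
  set n := Algebra.norm ℤ c with hndef
  rw [ht] at hU
  rw [hn] at hN
  have hp0 : (p : ℚ) ≠ 0 := by exact_mod_cast hp.ne_zero
  obtain ⟨W, hW⟩ := int_of_integral ((p : ℚ) * (2 * b)) (by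
    apply IsIntegral.of_pow (n := 2) (by norm_num)
    have : ((p : ℚ) * (2 * b)) ^ 2 = ((p * (4 * n - U ^ 2) : ℤ) : ℚ) := by
      push_cast
      rw [hN, hU]; ring
    rw [this]
    exact isIntegral_algebraMap (x := (p * (4 * n - U ^ 2) : ℤ)))
  have hW2 : W ^ 2 = p * (4 * n - U ^ 2) := by
    have : ((W ^ 2 : ℤ) : ℚ) = ((p * (4 * n - U ^ 2) : ℤ) : ℚ) := by
      push_cast
      rw [hN, hU, hW]; ring
    exact_mod_cast this
  have hpZ : Prime (p : ℤ) := Nat.prime_iff_prime_int.mp hp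
  obtain ⟨V, rfl⟩ : (p : ℤ) ∣ W := hpZ.dvd_of_dvd_pow (n := 2) (hW2 ▸ dvd_mul_right _ _)
  have hUV : U ^ 2 + p * V ^ 2 = 4 * n := by
    have : (p : ℤ) * (p * V ^ 2) = p * (4 * n - U ^ 2) := by rw [← hW2]; ring
    have := mul_left_cancel₀ hpZ.ne_zero this
    linarith
  obtain ⟨k, hk⟩ : ∃ k : ℤ, (p : ℤ) = 4 * k + 1 := ⟨(p / 4 : ℕ), by omega⟩
  have hmod : (U ^ 2 + V ^ 2) % 4 = 0 := by
    have : U ^ 2 + V ^ 2 = 4 * (n - k * V ^ 2) := by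
      rw [hk] at hUV
      linear_combination hUV
    rw [this]; omega
  have hev : Even U ∧ Even V := by
    rcases Int.even_or_odd' U with ⟨x, hx | hx⟩ <;> rcases Int.even_or_odd' V with ⟨y, hy | hy⟩
    · exact ⟨⟨x, by rw [hx]; ring⟩, ⟨y, by rw [hy]; ring⟩⟩
    · exfalso
      have : U ^ 2 + V ^ 2 = 4 * (x ^ 2 + y ^ 2 + y) + 1 := by rw [hx, hy]; ring
      omega
    · exfalso
      have : U ^ 2 + V ^ 2 = 4 * (x ^ 2 + y ^ 2 + x) + 1 := by rw [hx, hy]; ring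
      omega
    · exfalso
      have : U ^ 2 + V ^ 2 = 4 * (x ^ 2 + y ^ 2 + x + y) + 2 := by rw [hx, hy]; ring
      omega
  obtain ⟨⟨x, rfl⟩, ⟨y, rfl⟩⟩ := hev
  refine ⟨x, y, ?_⟩
  have : (4 : ℤ) * n = 4 * (x ^ 2 + p * y ^ 2) := by rw [← hUV]; ring
  omega

lemma same_class {K : Type*} [Field K] [NumberField K] (s : K) (p : ℕ) (hs : s ^ 2 = -(p : K))
    (hp : p.Prime) (hrank : Module.finrank ℚ K = 2) (hp4 : p % 4 = 1) (Q Q' : (Ideal (𝓞 K))⁰)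
    (hq' : (Ideal.absNorm (Q' : Ideal (𝓞 K))).Prime)
    (h : ClassGroup.mk0 Q = ClassGroup.mk0 Q') :
    ∃ u v : ℤ, (Ideal.absNorm (Q : Ideal (𝓞 K)) * Ideal.absNorm (Q' : Ideal (𝓞 K)) : ℤ) =
      u ^ 2 + p * v ^ 2 := by
  set q := Ideal.absNorm (Q : Ideal (𝓞 K)) with hq
  set q' := Ideal.absNorm (Q' : Ideal (𝓞 K)) with hqq'
  have hmem : (q' : 𝓞 K) ∈ (Q' : Ideal (𝓞 K)) := Ideal.absNorm_mem _
  have hdvd : (Q' : Ideal (𝓞 K)) ∣ Ideal.span {(q' : 𝓞 K)} := by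
    rw [Ideal.dvd_span_singleton]; exact hmem
  obtain ⟨R, hR⟩ := hdvd
  have hq0 : (q' : 𝓞 K) ≠ 0 := by exact_mod_cast hq'.ne_zero
  have hR0 : R ≠ 0 := by
    rintro rfl
    rw [mul_zero] at hR
    exact hq0 (by simpa using hR)
  have hnR : Ideal.absNorm R = q' := by
    have h1 := congrArg Ideal.absNorm hR
    rw [map_mul, Ideal.absNorm_span_singleton, ← hqq'] at h1
    have h2 : Algebra.norm ℤ (q' : 𝓞 K) = (q' : ℤ) ^ 2 := by
      have := Algebra.norm_algebraMap (S := 𝓞 K) (q' : ℤ)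
      rw [RingOfIntegers.rank, hrank] at this
      simpa using this
    rw [h2, Int.natAbs_pow, Int.natAbs_natCast, pow_two] at h1
    exact (Nat.eq_of_mul_eq_mul_left hq'.pos h1).symm
  let R' : (Ideal (𝓞 K))⁰ := ⟨R, mem_nonZeroDivisors_of_ne_zero hR0⟩
  have hone : ClassGroup.mk0 (Q' * R') = 1 := by
    have : (Q' * R' : (Ideal (𝓞 K))⁰) = ⟨(Q' : Ideal (𝓞 K)) * R, (Q' * R').2⟩ := rfl
    rw [this, ClassGroup.mk0_eq_one_iff]
    rw [← hR]
    exact ⟨⟨_, rfl⟩⟩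
  have hone2 : ClassGroup.mk0 (Q * R') = 1 := by
    rw [map_mul, h, ← map_mul, hone]
  have : (Q * R' : (Ideal (𝓞 K))⁰) = ⟨(Q : Ideal (𝓞 K)) * R, (Q * R').2⟩ := rfl
  rw [this, ClassGroup.mk0_eq_one_iff] at hone2
  obtain ⟨⟨c, hc⟩⟩ := hone2
  obtain ⟨u, v, huv⟩ := quad_form s p hs hp hrank hp4 c
  refine ⟨u, v, ?_⟩
  have h1 := congrArg Ideal.absNorm hc
  have h2 : Ideal.absNorm (Ideal.span {c}) = q * q' := by
    rw [← hnR, hq, ← map_mul]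
    exact h1.symm
  rw [Ideal.absNorm_span_singleton, huv] at h2
  have h3 : (0 : ℤ) ≤ u ^ 2 + p * v ^ 2 := by positivity
  have h4 := congrArg (fun n : ℕ => (n : ℤ)) h2
  change (((u ^ 2 + p * v ^ 2 : ℤ).natAbs : ℕ) : ℤ) = ((q * q' : ℕ) : ℤ) at h4
  rw [Int.natAbs_of_nonneg h3] at h4
  rw [h4]; push_cast; rfl

end quad

lemma same_pattern (D : PData) (δ δ' : ℕ → Bool) (r q q' j : ℕ) (hq : q.Prime) (hq' : q'.Prime)
    (hj : j < r) (h : Pat D δ r q) (h' : Pat D δ' r q') (u v : ℤ)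
    (huv : (q * q' : ℤ) = u ^ 2 + D.p (j + 1) * v ^ 2) : δ j = δ' j := by
  obtain ⟨h8, I, hI, h⟩ := h
  obtain ⟨h8', I', hI', h'⟩ := h'
  obtain ⟨h1, h2, h3⟩ := h j hj
  obtain ⟨h1', h2', h3'⟩ := h' j hj
  have := Fact.mk hq
  have := Fact.mk hq'
  have key := corR (D.prime (j + 1)) (D.mod8 _) (D.sum _) (D.evenx _) (D.oddy _) h1 h1' h8 h8' h2 h2'
    huv hI hI'
  rw [h3, h3'] at key
  exact Bool.eq_iff_iff.mpr key

/-- The imaginary quadratic field. -/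
noncomputable def quadField (p : ℕ) : IntermediateField ℚ ℂ := adjoin ℚ {rt p}

lemma rt_mem (p : ℕ) : rt p ∈ quadField p := mem_adjoin_simple_self ℚ _

lemma rt_integral (p : ℕ) : IsIntegral ℚ (rt p) :=
  (isIntegral_of_sq (rt p) (-(p : ℤ)) (by rw [rt_sq]; simp)).tower_top

lemma quadField_fd (p : ℕ) : FiniteDimensional ℚ (quadField p) :=
  adjoin.finiteDimensional (rt_integral p)

lemma quadField_rank (p : ℕ) (hp : p.Prime) : Module.finrank ℚ (quadField p) = 2 := by
  have h0 : (0 : ℚ) < p := by exact_mod_cast hp.pos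
  have hirr : Irreducible (Polynomial.X ^ 2 - Polynomial.C (-(p : ℚ)) : Polynomial ℚ) := by
    refine X_pow_sub_C_irreducible_of_prime Nat.prime_two fun b hb => ?_
    have := sq_nonneg b
    linarith
  have hmin : Polynomial.X ^ 2 - Polynomial.C (-(p : ℚ)) = minpoly ℚ (rt p) := by
    apply minpoly.eq_of_irreducible_of_monic hirr
    · simp [rt_sq]
    · exact Polynomial.monic_X_pow_sub_C _ two_ne_zero
  rw [quadField, adjoin.finrank (rt_integral p), ← hmin, Polynomial.natDegree_X_pow_sub_C]

lemma quadField_cm (p : ℕ) (hp : p.Prime) : IsCM (quadField p) := by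
  refine ⟨fun φ => ⟨⟨rt p, rt_mem p⟩, fun h0 => ?_⟩, ⊥, bot_le, ?_, ?_⟩
  · have h1 : (φ ⟨rt p, rt_mem p⟩) ^ 2 = -(p : ℂ) := by
      rw [← map_pow]
      have : (⟨rt p, rt_mem p⟩ : quadField p) ^ 2 = -(p : quadField p) := by
        apply Subtype.ext
        simp [rt_sq]
      rw [this, map_neg, map_natCast]
    have h2 := congrArg Complex.re h1
    rw [pow_two, Complex.mul_re, h0] at h2
    simp at h2
    have h3 : (0 : ℝ) < p := by exact_mod_cast hp.pos
    have := mul_self_nonneg (φ ⟨rt p, rt_mem p⟩).re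
    linarith
  · rintro φ ⟨x, hx⟩
    obtain ⟨y, rfl⟩ := mem_bot.mp hx
    have : (⟨algebraMap ℚ ℂ y, hx⟩ : (⊥ : IntermediateField ℚ ℂ)) = (y : (⊥ : IntermediateField ℚ ℂ)) := by
      apply Subtype.ext; simp
    rw [this, map_ratCast]
    exact Complex.ratCast_im y
  · let _ : Algebra (⊥ : IntermediateField ℚ ℂ) (quadField p) :=
      (IntermediateField.inclusion (bot_le : ⊥ ≤ quadField p)).toRingHom.toAlgebra
    have : IsScalarTower ℚ (⊥ : IntermediateField ℚ ℂ) (quadField p) :=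
      IsScalarTower.of_algebraMap_eq fun x => rfl
    have h := Module.finrank_mul_finrank ℚ (⊥ : IntermediateField ℚ ℂ) (quadField p)
    rw [IntermediateField.finrank_bot, one_mul, quadField_rank p hp] at h
    exact h

end CMU

end

section

open NumberField IntermediateField
open scoped nonZeroDivisors

namespace CMU

/-- Finite degree fields closed under conjugation. -/
abbrev CF : Type := {L : IntermediateField ℚ ℂ // FiniteDimensional ℚ L ∧ IsC L}

instance : IsDirectedOrder CF where
  directed := by
    rintro ⟨F, hF, hF'⟩ ⟨L, hL, hL'⟩
    exact ⟨⟨F ⊔ L, inferInstance, hF'.sup hL'⟩, (le_sup_left : F ≤ F ⊔ L), (le_sup_right : L ≤ F ⊔ L)⟩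

instance : IsDirectedOrder (CF × ℕ) where
  directed := by
    rintro ⟨a, m⟩ ⟨b, n⟩
    obtain ⟨c, h1, h2⟩ := exists_ge_ge a b
    exact ⟨(c, max m n), ⟨h1, le_max_left _ _⟩, ⟨h2, le_max_right _ _⟩⟩

instance : Nonempty CF := by
  have := quadField_fd 2
  exact ⟨⟨quadField 2, this, isC_of_isCM (quadField_cm 2 Nat.prime_two)⟩⟩

/-- The restriction of an ideal to a subfield. -/
noncomputable def res {F L : IntermediateField ℚ ℂ} (h : F ≤ L) (P : Ideal (𝓞 L)) : Ideal (𝓞 F) :=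
  P.comap (RingOfIntegers.mapRingHom (inclusion h).toRingHom)

lemma res_res {F L M : IntermediateField ℚ ℂ} (h : F ≤ L) (h' : L ≤ M) (P : Ideal (𝓞 M)) :
    res h (res h' P) = res (h.trans h') P := rfl

lemma res_norm {F L : IntermediateField ℚ ℂ} [FiniteDimensional ℚ F] [FiniteDimensional ℚ L]
    (h : F ≤ L) (P : Ideal (𝓞 L)) (hP : (Ideal.absNorm P).Prime) :
    Ideal.absNorm (res h P) = Ideal.absNorm P := by
  let _ : Algebra F L := (IntermediateField.inclusion h).toRingHom.toAlgebra
  exact (comap_norm (E := F) P hP).1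

lemma compat {F L : IntermediateField ℚ ℂ} [FiniteDimensional ℚ F] [FiniteDimensional ℚ L]
    (h : F ≤ L) (I I' : (Ideal (𝓞 L))⁰) (hI : ClassGroup.mk0 I = ClassGroup.mk0 I')
    (hP : (Ideal.absNorm (I' : Ideal (𝓞 L))).Prime) (J J' : (Ideal (𝓞 F))⁰)
    (hJ : (J : Ideal (𝓞 F)) = idealNorm F L h I) (hJ' : (J' : Ideal (𝓞 F)) = res h I') :
    ClassGroup.mk0 J = ClassGroup.mk0 J' := by
  let _ : Algebra F L := (IntermediateField.inclusion h).toRingHom.toAlgebra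
  refine mk0_relNorm I I' hI J J' ?_ ?_
  · rw [hJ]
    exact span_eq_relNorm (E := F) (E' := L) I
  · rw [hJ']
    exact (relNorm_deg_one (E := F) (E' := L) I' hP).symm

lemma exists_pr (D : PData) (δ : ℕ → Bool) (t : CF × ℕ) :
    ∃ P : Ideal (𝓞 t.1.1), have := t.1.2.1; (Ideal.absNorm P).Prime ∧ Pat D δ t.2 (Ideal.absNorm P) :=
  have := t.1.2.1
  pattern D δ t.2 t.1.1 t.1.2.2

/-- A chosen degree one prime with the prescribed pattern. -/
noncomputable def pr (D : PData) (δ : ℕ → Bool) (t : CF × ℕ) : Ideal (𝓞 t.1.1) :=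
  (exists_pr D δ t).choose

lemma pr_spec (D : PData) (δ : ℕ → Bool) (t : CF × ℕ) :
    have := t.1.2.1
    (Ideal.absNorm (pr D δ t)).Prime ∧ Pat D δ t.2 (Ideal.absNorm (pr D δ t)) :=
  (exists_pr D δ t).choose_spec

lemma res_pr (D : PData) (δ : ℕ → Bool) (t : CF × ℕ) (K : IntermediateField ℚ ℂ)
    [FiniteDimensional ℚ K] (h : K ≤ t.1.1) :
    (Ideal.absNorm (res h (pr D δ t))).Prime ∧ Pat D δ t.2 (Ideal.absNorm (res h (pr D δ t))) := by
  have := t.1.2.1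
  obtain ⟨h1, h2⟩ := pr_spec D δ t
  rw [res_norm h _ h1]
  exact ⟨h1, h2⟩

lemma nzd_of_prime {K : IntermediateField ℚ ℂ} [FiniteDimensional ℚ K] (P : Ideal (𝓞 K))
    (hP : (Ideal.absNorm P).Prime) : P ∈ (Ideal (𝓞 K))⁰ := by
  apply mem_nonZeroDivisors_of_ne_zero
  rintro rfl
  rw [map_zero] at hP
  exact Nat.not_prime_zero hP

/-- `x` is the class at `K` of the prime chosen at the index `t`. -/
def IsClass (D : PData) (δ : ℕ → Bool) (K : IntermediateField ℚ ℂ) [FiniteDimensional ℚ K]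
    (t : CF × ℕ) (x : ClassGroup (𝓞 K)) : Prop :=
  ∃ (h : K ≤ t.1.1) (Q : (Ideal (𝓞 K))⁰), (Q : Ideal (𝓞 K)) = res h (pr D δ t) ∧
    ClassGroup.mk0 Q = x

lemma bool_uncountable : ¬ Countable (ℕ → Bool) := by
  classical
  intro h
  obtain ⟨f, hf⟩ := h.exists_injective_nat
  refine Function.cantor_injective (fun s : Set ℕ => f fun n => decide (n ∈ s)) ?_
  intro s s' hs
  ext n
  have := congrFun (hf hs) n
  simpa using this

/-- A chosen ultrafilter on the index set. -/
noncomputable def U : Ultrafilter (CF × ℕ) := Ultrafilter.of Filter.atTop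

lemma eventually_ge (s : CF × ℕ) : ∀ᶠ t in (U : Filter (CF × ℕ)), s ≤ t :=
  (Ultrafilter.of_le Filter.atTop) (Filter.eventually_ge_atTop s)

lemma exists_class (D : PData) (δ : ℕ → Bool) (K : IntermediateField ℚ ℂ) [FiniteDimensional ℚ K]
    (hK : IsC K) : ∃ x : ClassGroup (𝓞 K), ∀ᶠ t in (U : Filter (CF × ℕ)), IsClass D δ K t x := by
  have h1 : ∀ t : CF × ℕ, ∃ x : ClassGroup (𝓞 K), K ≤ t.1.1 → IsClass D δ K t x := by
    intro t
    by_cases h : K ≤ t.1.1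
    · exact ⟨_, fun _ => ⟨h, ⟨res h (pr D δ t), nzd_of_prime _ (res_pr D δ t K h).1⟩, rfl, rfl⟩⟩
    · exact ⟨1, fun h' => absurd h' h⟩
  choose u hu using h1
  obtain ⟨x, hx⟩ := Ultrafilter.eq_pure_of_finite (U.map u)
  refine ⟨x, ?_⟩
  have h2 : ∀ᶠ t in (U : Filter (CF × ℕ)), u t = x := by
    have : {y | y = x} ∈ U.map u := by
      rw [hx, Ultrafilter.mem_pure]; rfl
    exact Ultrafilter.mem_map.mp this
  filter_upwards [h2, eventually_ge (⟨K, inferInstance, hK⟩, 0)] with t ht hge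
  rw [← ht]
  exact hu t hge.1

theorem main : ¬ Countable {c : ∀ K : {K : IntermediateField ℚ ℂ // FiniteDimensional ℚ K ∧ IsCM K},
        ClassGroup (𝓞 K.1) //
      ∀ (K L : {K : IntermediateField ℚ ℂ // FiniteDimensional ℚ K ∧ IsCM K})
        (h : K.1 ≤ L.1),
        haveI : FiniteDimensional ℚ K.1 := K.2.1
        haveI : FiniteDimensional ℚ L.1 := L.2.1
        ∀ I : (Ideal (𝓞 L.1))⁰, ClassGroup.mk0 I = c L →
          ∀ J : (Ideal (𝓞 K.1))⁰, (J : Ideal (𝓞 K.1)) = idealNorm K.1 L.1 h I →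
            ClassGroup.mk0 J = c K} := by
  intro hcount
  obtain ⟨D⟩ := exists_pdata
  have hex : ∀ (δ : ℕ → Bool) (K : {K : IntermediateField ℚ ℂ // FiniteDimensional ℚ K ∧ IsCM K}),
      ∃ x : ClassGroup (𝓞 K.1), have := K.2.1
        ∀ᶠ t in (U : Filter (CF × ℕ)), IsClass D δ K.1 t x := by
    intro δ K
    have := K.2.1
    exact exists_class D δ K.1 (isC_of_isCM K.2.2)
  choose c hc using hex
  have hcompat : ∀ δ : ℕ → Bool, ∀ (K L : {K : IntermediateField ℚ ℂ // FiniteDimensional ℚ K ∧ IsCM K})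
        (h : K.1 ≤ L.1),
        haveI : FiniteDimensional ℚ K.1 := K.2.1
        haveI : FiniteDimensional ℚ L.1 := L.2.1
        ∀ I : (Ideal (𝓞 L.1))⁰, ClassGroup.mk0 I = c δ L →
          ∀ J : (Ideal (𝓞 K.1))⁰, (J : Ideal (𝓞 K.1)) = idealNorm K.1 L.1 h I →
            ClassGroup.mk0 J = c δ K := by
    intro δ K L h
    have := K.2.1
    have := L.2.1
    intro I hI J hJ
    obtain ⟨t, ⟨h1, Q, hQ, hQc⟩, ⟨h2, R, hR, hRc⟩⟩ := ((hc δ K).and (hc δ L)).exists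
    rw [← hQc]
    refine compat h I R (by rw [hI, hRc]) ?_ J Q hJ ?_
    · rw [hR]
      exact (res_pr D δ t L.1 h2).1
    · rw [hQ, hR, res_res]
  refine bool_uncountable ?_
  have hinj : Function.Injective (fun δ : ℕ → Bool =>
      (⟨c δ, hcompat δ⟩ : {c : ∀ K : {K : IntermediateField ℚ ℂ // FiniteDimensional ℚ K ∧ IsCM K},
        ClassGroup (𝓞 K.1) //
      ∀ (K L : {K : IntermediateField ℚ ℂ // FiniteDimensional ℚ K ∧ IsCM K})
        (h : K.1 ≤ L.1),
        haveI : FiniteDimensional ℚ K.1 := K.2.1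
        haveI : FiniteDimensional ℚ L.1 := L.2.1
        ∀ I : (Ideal (𝓞 L.1))⁰, ClassGroup.mk0 I = c L →
          ∀ J : (Ideal (𝓞 K.1))⁰, (J : Ideal (𝓞 K.1)) = idealNorm K.1 L.1 h I →
            ClassGroup.mk0 J = c K})) := by
    intro δ δ' heq
    have heq : c δ = c δ' := congrArg Subtype.val heq
    funext j
    have hp := D.prime (j + 1)
    have hfd := quadField_fd (D.p (j + 1))
    let K : {K : IntermediateField ℚ ℂ // FiniteDimensional ℚ K ∧ IsCM K} :=
      ⟨quadField (D.p (j + 1)), hfd, quadField_cm _ hp⟩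
    obtain ⟨t, ⟨⟨h1, Q, hQ, hQc⟩, ⟨h2, R, hR, hRc⟩⟩, hge⟩ :=
      (((hc δ K).and (hc δ' K)).and (eventually_ge (Classical.arbitrary CF, j + 1))).exists
    have hj : j < t.2 := hge.2
    obtain ⟨a1, a2⟩ := res_pr D δ t K.1 h1
    obtain ⟨b1, b2⟩ := res_pr D δ' t K.1 h2
    rw [← hQ] at a1 a2
    rw [← hR] at b1 b2
    have hs : (⟨rt (D.p (j + 1)), rt_mem _⟩ : quadField (D.p (j + 1))) ^ 2 =
        -((D.p (j + 1) : ℕ) : quadField (D.p (j + 1))) := by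
      apply Subtype.ext
      simp [rt_sq]
    obtain ⟨u, v, huv⟩ := same_class (K := quadField (D.p (j + 1))) _ (D.p (j + 1)) hs hp
      (quadField_rank _ hp) (by have := D.mod8 (j + 1); omega) Q R b1 (by rw [hQc, hRc, heq])
    exact same_pattern D δ δ' t.2 _ _ j a1 b1 hj a2 b2 u v huv
  exact hinj.countable

end CMU

end

/-- The set of norm-compatible families of ideal classes, indexed by the CM
subfields of `ℂ` of finite degree over `ℚ`, is uncountable. -/
theorem stmt_9 :
    ¬ Countable {c : ∀ K : {K : IntermediateField ℚ ℂ // FiniteDimensional ℚ K ∧ IsCM K},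
        ClassGroup (𝓞 K.1) //
      ∀ (K L : {K : IntermediateField ℚ ℂ // FiniteDimensional ℚ K ∧ IsCM K})
        (h : K.1 ≤ L.1),
        haveI : FiniteDimensional ℚ K.1 := K.2.1
        haveI : FiniteDimensional ℚ L.1 := L.2.1
        ∀ I : (Ideal (𝓞 L.1))⁰, ClassGroup.mk0 I = c L →
          ∀ J : (Ideal (𝓞 K.1))⁰, (J : Ideal (𝓞 K.1)) = idealNorm K.1 L.1 h I →
            ClassGroup.mk0 J = c K} := by
  exact CMU.main
end

section
/- Let (a_F)_F be a family indexed by the totally real subfields F of ℂ of finite degree over ℚ, where a_F ∈ F^× is a nonzero element of F, and suppose the family is norm-compatible: whenever F ⊆ L are two such fields, the field norm Nm_{L/F}(a_L) = a_F. Then a_F = 1 for every F. (Equivalently, the inverse limit over totally real fields of the multiplicative groups F^× under the norm maps is trivial.) -/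
open NumberField IntermediateField

/-- The field norm `Nm_{L/F} : L → F` for subfields `F ⊆ L` of `ℂ`. -/
noncomputable def fieldNorm (F L : IntermediateField ℚ ℂ) (h : F ≤ L) (x : L) : F :=
  letI : Algebra F L := (IntermediateField.inclusion h).toRingHom.toAlgebra
  Algebra.norm F x


lemma prod_close {E Γ₀ ι : Type*} [Field E] [LinearOrderedCommGroupWithZero Γ₀]
    (v : Valuation E Γ₀) (s : Finset ι) (f : ι → E) (c : E) (hc : v c = 1)
    (h : ∀ i ∈ s, v (f i - c) < 1) : v (∏ i ∈ s, f i - c ^ s.card) < 1 := by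
  classical
  induction s using Finset.induction_on with
  | empty => simp
  | insert i s hi ih =>
    rw [Finset.prod_insert hi, Finset.card_insert_of_notMem hi]
    have h1 := h i (by simp)
    have h2 := ih (fun j hj => h j (by simp [hj]))
    have h3 : v (f i) = 1 := by
      have := v.map_add_eq_of_lt_left (x := c) (y := f i - c) (by rw [hc]; exact h1)
      rw [← hc, ← this]; congr 1; ring
    have : f i * ∏ j ∈ s, f j - c ^ (s.card + 1)
        = f i * (∏ j ∈ s, f j - c ^ s.card) + (f i - c) * c ^ s.card := by ring
    rw [this]
    refine v.map_add_lt ?_ ?_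
    · rw [map_mul, h3, one_mul]; exact h2
    · rw [map_mul, map_pow, hc, one_pow, mul_one]; exact h1

lemma zpow_inj_aux {Γ₀ : Type*} [LinearOrderedCommGroupWithZero Γ₀] {P : Γ₀} (h0 : P ≠ 0)
    (h1 : P < 1) {a b : ℤ} (h : P ^ a = P ^ b) : a = b :=
  (zpow_right_strictAnti₀ (zero_lt_iff.mpr h0) h1).injective h

open WithZero in
lemma key {F L E Γ₀ : Type*} [Field F] [Field L] [Field E] [Algebra F L] [Algebra F E]
    [IsAlgClosed E] [Algebra.IsSeparable F L] [FiniteDimensional F L]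
    [LinearOrderedCommGroupWithZero Γ₀]
    (w : Valuation F (WithZero (Multiplicative ℤ))) (v : Valuation E Γ₀)
    (h1 : ∀ x, w x = 1 → v (algebraMap F E x) = 1)
    (hlt : ∀ x, w x < 1 → v (algebraMap F E x) < 1)
    (pb : PowerBasis F L) (π : F) (hπ : w π = WithZero.exp (-1 : ℤ))
    (hroots : ∀ σ : L →ₐ[F] E, v (σ pb.gen) ^ pb.dim = v (algebraMap F E π))
    (y : L) (hy : w (Algebra.norm F y) = 1) :
    ∃ c : F, w c = 1 ∧ v (algebraMap F E (Algebra.norm F y) - (algebraMap F E c) ^ pb.dim) < 1 := by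
  classical
  have hπ0 : π ≠ 0 := by
    rintro rfl
    rw [map_zero] at hπ
    exact exp_ne_zero hπ.symm
  set P := v (algebraMap F E π) with hP
  have hP0 : P ≠ 0 := by simpa [hP] using hπ0
  have hP1 : P < 1 := hlt _ (by rw [hπ, ← exp_zero, exp_lt_exp]; norm_num)
  have hn : pb.dim ≠ 0 := pb.dim_ne_zero
  have hk : ∀ x : F, x ≠ 0 → ∃ k : ℤ, v (algebraMap F E x) = P ^ k ∧ w x = exp (-k) := by
    intro x hx
    have hwx : w x ≠ 0 := by simpa using hx
    refine ⟨-log (w x), ?_, by simp [exp_log hwx]⟩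
    have : w (x * π ^ (log (w x))) = 1 := by
      rw [map_mul, map_zpow₀, hπ, ← exp_zsmul]
      nth_rw 1 [← exp_log hwx]
      rw [← exp_add]; simp
    have := h1 _ this
    rw [map_mul, map_mul, map_zpow₀, map_zpow₀] at this
    rw [zpow_neg]
    exact eq_inv_of_mul_eq_one_left this
  have σ0 : L →ₐ[F] E := IsAlgClosed.lift
  set g := v (σ0 pb.gen) with hg
  have hgn : g ^ pb.dim = P := hroots σ0
  have hg0 : g ≠ 0 := by intro h; rw [h, zero_pow hn] at hgn; exact hP0 hgn.symm
  have hgσ : ∀ σ : L →ₐ[F] E, v (σ pb.gen) = g := fun σ =>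
    (pow_left_inj₀ (zero_le) (zero_le) hn).mp ((hroots σ).trans hgn.symm)
  have hy0 : y ≠ 0 := by
    rintro rfl
    have := pb.basis.index_nonempty
    rw [Algebra.norm_zero] at hy; simp at hy
  let c : Fin pb.dim → F := fun i => pb.basis.repr y i
  have hyc : y = ∑ i, c i • pb.gen ^ (i : ℕ) := by
    conv_lhs => rw [← pb.basis.sum_repr y]
    simp [c]
  let T : Fin pb.dim → Γ₀ := fun i => v (algebraMap F E (c i)) * g ^ (i : ℕ)
  have hT0 : ∀ i, c i ≠ 0 → T i ≠ 0 := fun i hi => mul_ne_zero (by simpa using hi) (pow_ne_zero _ hg0)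
  have hTn : ∀ i, c i ≠ 0 → ∃ k : ℤ, T i ^ pb.dim = P ^ (k * pb.dim + i) ∧ w (c i) = exp (-k) := by
    intro i hi
    obtain ⟨k, hk, hk'⟩ := hk _ hi
    refine ⟨k, ?_, hk'⟩
    simp only [T]
    rw [hk, mul_pow, ← pow_mul, mul_comm (i : ℕ), pow_mul, hgn, zpow_add₀ hP0, zpow_mul]
    simp
  have hdist : ∀ i j, T i ≠ 0 → T i = T j → i = j := by
    intro i j hi hij
    have hci : c i ≠ 0 := by intro h; simp [T, h] at hi
    have hcj : c j ≠ 0 := by intro h; rw [hij] at hi; simp [T, h] at hi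
    obtain ⟨k, h, -⟩ := hTn i hci
    obtain ⟨k', h', -⟩ := hTn j hcj
    rw [hij, h'] at h
    have := zpow_inj_aux hP0 hP1 h
    have h3 : ((i : ℕ) : ℤ) % pb.dim = ((j : ℕ) : ℤ) % pb.dim := by
      have := congrArg (· % (pb.dim : ℤ)) this
      simpa using this.symm
    rw [Int.emod_eq_of_lt (by positivity) (by exact_mod_cast i.2),
      Int.emod_eq_of_lt (by positivity) (by exact_mod_cast j.2)] at h3
    exact Fin.ext (by exact_mod_cast h3)
  have : Nonempty (Fin pb.dim) := ⟨⟨0, Nat.pos_of_ne_zero hn⟩⟩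
  obtain ⟨j, hj⟩ := Finite.exists_max T
  have hTj : T j ≠ 0 := by
    intro h
    apply hy0
    rw [hyc]
    refine Finset.sum_eq_zero fun i _ => ?_
    have : c i = 0 := by
      by_contra hc
      exact hT0 i hc (le_antisymm (h ▸ hj i) (zero_le))
    simp [this]
  have hjlt : ∀ i, i ≠ j → T i < T j := fun i hi =>
    lt_of_le_of_ne (hj i) fun h => hi (hdist j i hTj h.symm).symm
  have hσy : ∀ σ : L →ₐ[F] E, σ y = ∑ i, algebraMap F E (c i) * σ pb.gen ^ (i : ℕ) := by
    intro σ
    conv_lhs => rw [hyc]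
    simp [Algebra.smul_def]
  have hterm : ∀ (σ : L →ₐ[F] E) i, v (algebraMap F E (c i) * σ pb.gen ^ (i : ℕ)) = T i := by
    intro σ i; simp [T, hgσ]
  have hvσ : ∀ σ : L →ₐ[F] E, v (σ y) = T j := by
    intro σ
    rw [hσy, v.map_sum_eq_of_lt (j := j) (Finset.mem_univ _)]
    · exact hterm σ j
    · intro i hi
      rw [hterm, hterm]
      exact hjlt i (by simpa using hi)
  have hcard : Fintype.card (L →ₐ[F] E) = pb.dim := by
    rw [AlgHom.card, pb.finrank]
  have hnorm := Algebra.norm_eq_prod_embeddings F E y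
  have hTj1 : T j ^ pb.dim = 1 := by
    have := h1 _ hy
    rw [hnorm, map_prod] at this
    simp only [hvσ, Finset.prod_const, Finset.card_univ, hcard] at this
    exact this
  have hcj : c j ≠ 0 := by intro h; simp [T, h] at hTj
  obtain ⟨k, hk1, hk2⟩ := hTn j hcj
  rw [hTj1, ← zpow_zero P] at hk1
  have hk3 := zpow_inj_aux hP0 hP1 hk1
  have hj0 : (j : ℕ) = 0 := by
    have := congrArg (· % (pb.dim : ℤ)) hk3
    simp only [Int.zero_emod, Int.mul_add_emod_self_right] at this
    rw [Int.emod_eq_of_lt (by positivity) (by exact_mod_cast j.2)] at this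
    exact_mod_cast this.symm
  have hk0 : k = 0 := by
    rw [hj0] at hk3
    have : k * (pb.dim : ℤ) = 0 := by simpa using hk3.symm
    rcases mul_eq_zero.mp this with h | h
    · exact h
    · exact absurd (by exact_mod_cast h) hn
  have hwc : w (c j) = 1 := by rw [hk2, hk0]; simp
  refine ⟨c j, hwc, ?_⟩
  rw [hnorm, ← hcard, ← Finset.card_univ]
  apply prod_close v _ _ _ (h1 _ hwc)
  intro σ _
  rw [hσy, ← Finset.add_sum_erase _ _ (Finset.mem_univ j), hj0, pow_zero, mul_one, add_sub_cancel_left]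
  apply v.map_sum_lt one_ne_zero
  intro i hi
  rw [hterm]
  have : T j = 1 := by rw [show T j = v (algebraMap F E (c j)) * g ^ (j : ℕ) from rfl, hj0, h1 _ hwc]; simp
  rw [← this]
  exact hjlt i (Finset.ne_of_mem_erase hi)
open NumberField IsDedekindDomain Polynomial

lemma sign_aux (M : ℝ) (hM : 2 < M) (n i : ℕ) (hi : i ≤ n) :
    (M / 2) ^ n ≤ (-1) ^ (n - i) * ∏ j ∈ Finset.range n, (M * (i - 1 / 2) - M * j) := by
  rw [← Finset.prod_range_mul_prod_Ico _ hi]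
  have h1 : (M / 2) ^ i ≤ ∏ j ∈ Finset.range i, (M * (i - 1 / 2) - M * j) := by
    calc (M / 2) ^ i = ∏ j ∈ Finset.range i, (M / 2) := by rw [Finset.prod_const]; simp
      _ ≤ _ := by
        apply Finset.prod_le_prod
        · intros; positivity
        · intro j hj
          have : (j : ℝ) + 1 ≤ i := by exact_mod_cast Finset.mem_range.mp hj
          nlinarith
  have h2 : (M / 2) ^ (n - i) ≤ (-1) ^ (n - i) * ∏ j ∈ Finset.Ico i n, (M * (i - 1 / 2) - M * j) := by
    calc (M / 2) ^ (n - i) = ∏ j ∈ Finset.Ico i n, (M / 2) := by rw [Finset.prod_const]; simp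
      _ ≤ ∏ j ∈ Finset.Ico i n, ((-1) * (M * (i - 1 / 2) - M * j)) := by
        apply Finset.prod_le_prod
        · intros; positivity
        · intro j hj
          have : (i : ℝ) ≤ j := by exact_mod_cast (Finset.mem_Ico.mp hj).1
          nlinarith
      _ = _ := by rw [Finset.prod_mul_distrib]; simp
  calc (M / 2) ^ n = (M / 2) ^ i * (M / 2) ^ (n - i) := by rw [← pow_add]; congr 1; omega
    _ ≤ _ := mul_le_mul h1 h2 (by positivity) (le_trans (by positivity) h1)
    _ = _ := by ring

lemma roots_real (M c : ℝ) (hM : 2 < M) (n : ℕ) (hn : n ≠ 0) (hc : |c| < M / 2) (z : ℂ)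
    (hz : ∏ j ∈ Finset.range n, (z - M * j) + c = 0) : z.im = 0 := by
  let f : ℝ[X] := ∏ j ∈ Finset.range n, (X - C (M * j)) + C c
  have hgm : (∏ j ∈ Finset.range n, (X - C (M * (j : ℝ)))).Monic := monic_prod_X_sub_C _ _
  have hgd : (∏ j ∈ Finset.range n, (X - C (M * (j : ℝ)))).natDegree = n := by
    rw [natDegree_finsetProd_X_sub_C_eq_card]; simp
  have hdeg : (C c).degree < (∏ j ∈ Finset.range n, (X - C (M * (j : ℝ)))).degree := by
    refine lt_of_le_of_lt degree_C_le ?_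
    rw [degree_eq_natDegree hgm.ne_zero, hgd]; exact_mod_cast Nat.pos_of_ne_zero hn
  have hfm : f.Monic := hgm.add_of_left hdeg
  have hfd : f.natDegree = n := by rw [natDegree_add_C, hgd]
  have hfe : ∀ x, f.eval x = ∏ j ∈ Finset.range n, (x - M * j) + c := by
    intro x; simp [f, eval_prod]
  have hpow : M / 2 ≤ (M / 2) ^ n := le_self_pow₀ (by linarith) hn
  have hsign : ∀ i ≤ n, 0 < (-1) ^ (n - i) * f.eval (M * (i - 1 / 2)) := by
    intro i hi
    have := sign_aux M hM n i hi
    rw [hfe, mul_add]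
    have h2 := abs_lt.mp hc
    rcases neg_one_pow_eq_or ℝ (n - i) with h | h <;> rw [h] at this ⊢ <;> linarith
  have hroot : ∀ i : Fin n, ∃ r, M * ((i : ℕ) - 1 / 2) < r ∧ r < M * ((i : ℕ) + 1 / 2) ∧ f.eval r = 0 := by
    intro i
    have ha := hsign i i.2.le
    have hb := hsign (i + 1) i.2
    have hle : M * ((i : ℕ) - 1 / 2 : ℝ) ≤ M * (((i : ℕ) + 1 : ℕ) - 1 / 2 : ℝ) := by
      push_cast; nlinarith
    have he : n - (i : ℕ) = (n - (i + 1)) + 1 := by omega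
    rw [he, pow_succ] at ha
    have hcont : ContinuousOn (fun x => f.eval x) (Set.Icc (M * ((i : ℕ) - 1 / 2 : ℝ)) (M * (((i : ℕ) + 1 : ℕ) - 1 / 2 : ℝ))) :=
      f.continuous.continuousOn
    have : ∃ r ∈ Set.Ioo (M * ((i : ℕ) - 1 / 2 : ℝ)) (M * (((i : ℕ) + 1 : ℕ) - 1 / 2 : ℝ)), f.eval r = 0 := by
      rcases neg_one_pow_eq_or ℝ (n - (i + 1)) with h | h
      · rw [h] at ha hb
        exact intermediate_value_Ioo hle hcont ⟨by linarith, by linarith⟩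
      · rw [h] at ha hb
        exact intermediate_value_Ioo' hle hcont ⟨by linarith, by linarith⟩
    obtain ⟨r, ⟨h1, h2⟩, h3⟩ := this
    refine ⟨r, h1, ?_, h3⟩
    push_cast at h2; linarith
  choose r hr1 hr2 hr3 using hroot
  have hinj : Function.Injective r := by
    have : StrictMono r := by
      intro i j hij
      have h1 := hr2 i
      have h2 := hr1 j
      have : ((i : ℕ) : ℝ) + 1 ≤ (j : ℕ) := by exact_mod_cast hij
      nlinarith
    exact this.injective
  have hfprod : ∏ i, (X - C (r i)) = f := by
    symm
    apply eq_of_monic_of_dvd_of_natDegree_le (monic_prod_X_sub_C _ _) hfm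
    · apply Finset.prod_dvd_of_coprime
      · intro i _ j _ hij
        exact pairwise_coprime_X_sub_C hinj hij
      · intro i _
        exact dvd_iff_isRoot.mpr (hr3 i)
    · rw [hfd, natDegree_finsetProd_X_sub_C_eq_card]; simp
  have h0 : aeval z f = 0 := by
    rw [← hz]; simp [f]
  rw [← hfprod, map_prod, Finset.prod_eq_zero_iff] at h0
  obtain ⟨i, -, hi⟩ := h0
  have : z = r i := by simpa [sub_eq_zero] using hi
  rw [this]; simp

lemma exists_prime_units (F : Type*) [Field F] [NumberField F] (a b : F) (ha : a ≠ 0) (hb : b ≠ 0) :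
    ∃ p : HeightOneSpectrum (𝓞 F), p.valuation F a = 1 ∧ p.valuation F b = 1 := by
  obtain ⟨r, s, hs, rfl⟩ := IsFractionRing.div_surjective (A := 𝓞 F) a
  obtain ⟨r', s', hs', rfl⟩ := IsFractionRing.div_surjective (A := 𝓞 F) b
  have hr : r ≠ 0 := by rintro rfl; simp at ha
  have hr' : r' ≠ 0 := by rintro rfl; simp at hb
  have hs := nonZeroDivisors.ne_zero hs
  have hs' := nonZeroDivisors.ne_zero hs'
  have ht : r * s * (r' * s') ≠ 0 := by simp [*]
  set t := r * s * (r' * s') with htd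
  set N := Ideal.absNorm (Ideal.span {t}) with hN
  have hN0 : N ≠ 0 := by rw [hN, Ne, Ideal.absNorm_eq_zero_iff]; simpa using ht
  have hNt : ((N : ℕ) : 𝓞 F) ∈ Ideal.span {t} := Ideal.absNorm_mem _
  obtain ⟨q, hqN, hq⟩ := Nat.exists_infinite_primes (N + 1)
  have hqm : (Ideal.span {(q : ℤ)}).IsMaximal :=
    PrincipalIdealRing.isMaximal_of_irreducible (Nat.prime_iff_prime_int.mp hq).irreducible
  obtain ⟨Q, hQ, hQc⟩ := Ideal.exists_ideal_over_maximal_of_isIntegral (S := 𝓞 F)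
    (Ideal.span {(q : ℤ)}) (by
      rw [(RingHom.injective_iff_ker_eq_bot _).mp (FaithfulSMul.algebraMap_injective ℤ (𝓞 F))]
      exact bot_le)
  have hqQ : (q : 𝓞 F) ∈ Q := by
    have : (q : ℤ) ∈ Q.comap (algebraMap ℤ (𝓞 F)) := by
      rw [hQc]; exact Ideal.mem_span_singleton_self _
    simpa using this
  have hQ0 : Q ≠ ⊥ := by
    rintro rfl
    have : (q : 𝓞 F) = 0 := by simpa using hqQ
    exact hq.ne_zero (by exact_mod_cast this)
  have htQ : t ∉ Q := by
    intro h
    have h1 : (N : 𝓞 F) ∈ Q := (Ideal.span_singleton_le_iff_mem _).mpr h hNt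
    have h2 : (N : ℤ) ∈ Q.comap (algebraMap ℤ (𝓞 F)) := by simpa using h1
    rw [hQc, Ideal.mem_span_singleton] at h2
    have := Nat.le_of_dvd (Nat.pos_of_ne_zero hN0) (by exact_mod_cast h2)
    omega
  let p : HeightOneSpectrum (𝓞 F) := ⟨Q, hQ.isPrime, hQ0⟩
  have hmem : ∀ x, x ∣ t → p.valuation F (algebraMap (𝓞 F) F x) = 1 := by
    intro x hx
    exact (HeightOneSpectrum.valuation_eq_one_iff_notMem p).mpr fun h => htQ (Ideal.mem_of_dvd _ hx h)
  refine ⟨p, ?_, ?_⟩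
  · rw [map_div₀, hmem r ⟨s * (r' * s'), by rw [htd]; ring⟩, hmem s ⟨r * (r' * s'), by rw [htd]; ring⟩, div_one]
  · rw [map_div₀, hmem r' ⟨r * s * s', by rw [htd]; ring⟩, hmem s' ⟨r * s * r', by rw [htd]; ring⟩, div_one]

lemma exists_ext (F E : Type*) [Field F] [Field E] [Algebra F E] {Γ : Type*}
    [LinearOrderedCommGroupWithZero Γ] (w : Valuation F Γ) :
    ∃ B : ValuationSubring E, (∀ x, w x ≤ 1 → B.valuation (algebraMap F E x) ≤ 1) ∧
      (∀ x, w x = 1 → B.valuation (algebraMap F E x) = 1) ∧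
      (∀ x, w x < 1 → B.valuation (algebraMap F E x) < 1) := by
  obtain ⟨B, h, hB⟩ := IsLocalRing.exists_factor_valuationRing
    ((algebraMap F E).comp w.valuationSubring.subtype)
  have hle : ∀ x, w x ≤ 1 → B.valuation (algebraMap F E x) ≤ 1 := by
    intro x hx
    exact (B.valuation_le_one_iff _).mpr (h ⟨x, hx⟩)
  have heq : ∀ x, w x = 1 → B.valuation (algebraMap F E x) = 1 := by
    intro x hx
    apply le_antisymm (hle x hx.le)
    have h1 := hle x⁻¹ (by simp [hx])
    have hx0 : x ≠ 0 := by rintro rfl; simp at hx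
    rw [map_inv₀, map_inv₀] at h1
    exact (inv_le_one₀ (by simpa [zero_lt_iff] using hx0)).mp h1
  refine ⟨B, hle, heq, ?_⟩
  intro x hx
  refine lt_of_le_of_ne (hle x hx.le) fun h1 => ?_
  let x' : w.valuationSubring := ⟨x, hx.le⟩
  have hu : IsUnit (((algebraMap F E).comp w.valuationSubring.subtype).codRestrict B.toSubring h x') := by
    exact (B.valuation_eq_one_iff ⟨_, h x'⟩).mpr h1
  have hu' := hB.map_nonunit _ hu
  obtain ⟨y, hy⟩ := isUnit_iff_exists_inv.mp hu'
  have hxy : x * (y : F) = 1 := congrArg Subtype.val hy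
  have hy1 : w y ≤ 1 := y.2
  have : w x * w y = 1 := by rw [← map_mul, hxy, map_one]
  exact absurd this (ne_of_lt (lt_of_le_of_lt (mul_le_of_le_one_right' hy1) hx))

/-- The Eisenstein polynomial. -/
noncomputable def eisPoly {R : Type*} [CommRing R] (M : ℕ) (n : ℕ) (π : R) : R[X] :=
  ∏ j ∈ Finset.range n, (X - C ((M : R) * j)) + C π

lemma eisPoly_map {R S : Type*} [CommRing R] [CommRing S] (φ : R →+* S) (M n : ℕ) (π : R) :
    (eisPoly M n π).map φ = eisPoly M n (φ π) := by
  simp [eisPoly, Polynomial.map_prod]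

lemma eisPoly_monic {R : Type*} [CommRing R] [IsDomain R] (M n : ℕ) (hn : n ≠ 0) (π : R) :
    (eisPoly M n π).Monic ∧ (eisPoly M n π).natDegree = n := by
  have hgm : (∏ j ∈ Finset.range n, (X - C ((M : R) * (j : R)))).Monic := monic_prod_X_sub_C _ _
  have hgd : (∏ j ∈ Finset.range n, (X - C ((M : R) * (j : R)))).natDegree = n := by
    rw [natDegree_finsetProd_X_sub_C_eq_card]; simp
  have hdeg : (C π).degree < (∏ j ∈ Finset.range n, (X - C ((M : R) * (j : R)))).degree := by
    refine lt_of_le_of_lt degree_C_le ?_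
    rw [degree_eq_natDegree hgm.ne_zero, hgd]; exact_mod_cast Nat.pos_of_ne_zero hn
  exact ⟨hgm.add_of_left hdeg, by rw [eisPoly, natDegree_add_C, hgd]⟩

lemma eisPoly_irr {R : Type*} [CommRing R] [IsDomain R] (M n : ℕ) (hn : n ≠ 0) (π : R)
    (p : Ideal R) [hp : p.IsPrime] (hM : (M : R) ∈ p) (hπ : π ∈ p) (hπ2 : π ∉ p ^ 2) :
    Irreducible (eisPoly M n π) := by
  obtain ⟨hm, hd⟩ := eisPoly_monic M n hn π
  have hmap : (eisPoly M n π).map (Ideal.Quotient.mk p) = X ^ n := by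
    have h1 : ((M : ℕ) : R ⧸ p) = 0 := by
      rw [← map_natCast (Ideal.Quotient.mk p)]; exact Ideal.Quotient.eq_zero_iff_mem.mpr hM
    rw [eisPoly_map, Ideal.Quotient.eq_zero_iff_mem.mpr hπ, eisPoly]
    simp [h1]
  have hE : (eisPoly M n π).IsEisensteinAt p := by
    apply hm.isEisensteinAt_of_mem_of_notMem hp.ne_top
    · intro k hk
      rw [hd] at hk
      rw [← Ideal.Quotient.eq_zero_iff_mem, ← coeff_map, hmap, coeff_X_pow, if_neg hk.ne]
    · have : (eisPoly M n π).coeff 0 = π := by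
        rw [coeff_zero_eq_eval_zero, eisPoly, eval_add, eval_prod, eval_C,
          Finset.prod_eq_zero (Finset.mem_range.mpr (Nat.pos_of_ne_zero hn))]
        · simp
        · simp
      rwa [this]
  exact hE.irreducible hp hm.isPrimitive (by omega)

lemma eisPoly_root_val {E Γ₀ : Type*} [Field E] [LinearOrderedCommGroupWithZero Γ₀]
    (v : Valuation E Γ₀) (M n : ℕ) (hn : n ≠ 0) (π θ : E) (hint : ∀ j : ℕ, v (j : E) ≤ 1)
    (hπ1 : v π < 1) (hM : v (M : E) < v π) (hθ : (eisPoly M n π).eval θ = 0) :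
    v θ ^ n = v π := by
  have h0 : ∏ j ∈ Finset.range n, (θ - (M : E) * j) = -π := by
    simp [eisPoly, eval_prod] at hθ
    exact eq_neg_of_add_eq_zero_left hθ
  have h1 : v π = ∏ j ∈ Finset.range n, v (θ - (M : E) * j) := by
    rw [← map_prod, h0, v.map_neg]
  have hMj : ∀ j : ℕ, v ((M : E) * j) ≤ v M := fun j => by
    rw [map_mul]; exact mul_le_of_le_one_right' (hint j)
  have hlt : v (M : E) < v θ := by
    by_contra hcon
    push Not at hcon
    have : v π ≤ ∏ j ∈ Finset.range n, v (M : E) := by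
      rw [h1]
      apply Finset.prod_le_prod
      · intros; exact zero_le
      · intro j _
        exact v.map_sub_le hcon (hMj j)
    rw [Finset.prod_const, Finset.card_range] at this
    have h2 : v (M : E) ^ n ≤ v (M : E) := pow_le_of_le_one (zero_le) (hM.trans hπ1).le hn
    exact absurd (this.trans h2) (not_le.mpr hM)
  rw [h1, Finset.prod_congr rfl (fun j _ => v.map_sub_eq_of_lt_left ((hMj j).trans_lt hlt))]
  simp

open HeightOneSpectrum in
/-- The local statement: `a` is congruent to `1` modulo the chosen prime. -/
lemma stmt_aux (a : ∀ F : IntermediateField ℚ ℂ, F)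
    (hcompat : ∀ (F L : IntermediateField ℚ ℂ)
      [FiniteDimensional ℚ F] [FiniteDimensional ℚ L],
      TotallyReal F → TotallyReal L → ∀ h : F ≤ L, fieldNorm F L h (a L) = a F)
    (F : IntermediateField ℚ ℂ) [FiniteDimensional ℚ F] [NumberField F] (hF : TotallyReal F)
    (p : HeightOneSpectrum (𝓞 F)) (hpa : p.valuation F (a F) = 1) :
    p.valuation F (a F - 1) ≠ 1 := by
  classical
  set w := p.valuation F with hw
  obtain ⟨B, hle, heq, hlt⟩ := exists_ext F ℂ w
  set v := B.valuation with hv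
  obtain ⟨π, hπ⟩ := p.valuation_exists_uniformizer' F
  have hπ : w (algebraMap (𝓞 F) F π) = WithZero.exp (-1 : ℤ) := hπ
  set q := Ideal.absNorm p.asIdeal with hq
  have hqcard : q = Nat.card (𝓞 F ⧸ p.asIdeal) := rfl
  have hfin : Finite (𝓞 F ⧸ p.asIdeal) := Ideal.finiteQuotientOfFreeOfNeBot _ p.ne_bot
  have hq1 : 1 < q := by
    rw [hqcard]
    have : Nontrivial (𝓞 F ⧸ p.asIdeal) := Ideal.Quotient.nontrivial_iff.mpr p.isPrime.ne_top
    exact Finite.one_lt_card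
  have hqp : (q : 𝓞 F) ∈ p.asIdeal := Ideal.absNorm_mem _
  set n := q - 1 with hn
  have hn0 : n ≠ 0 := by omega
  -- the size of M
  obtain ⟨t, ht⟩ := exists_nat_gt (2 * ∑ φ : F →+* ℂ, ‖φ (algebraMap (𝓞 F) F π)‖ + 2)
  set M : ℕ := q ^ 2 * t with hM
  have hMt : (t : ℝ) ≤ M := by
    rw [hM]; exact_mod_cast Nat.le_mul_of_pos_left t (by positivity)
  have hsum0 : 0 ≤ ∑ φ : F →+* ℂ, ‖φ (algebraMap (𝓞 F) F π)‖ :=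
    Finset.sum_nonneg fun _ _ => norm_nonneg _
  have hM2 : (2 : ℝ) < M := by linarith
  have hMφ : ∀ φ : F →+* ℂ, ‖φ (algebraMap (𝓞 F) F π)‖ < M / 2 := by
    intro φ
    have := Finset.single_le_sum (f := fun φ : F →+* ℂ => ‖φ (algebraMap (𝓞 F) F π)‖)
      (fun _ _ => norm_nonneg _) (Finset.mem_univ φ)
    linarith
  -- valuations
  have hMp : (M : 𝓞 F) ∈ p.asIdeal ^ 2 := by
    rw [hM]; push_cast
    exact Ideal.mul_mem_right _ _ (Ideal.pow_mem_pow hqp 2)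
  have hπi : p.intValuation π = WithZero.exp (-1 : ℤ) := by
    rw [← hπ, hw, valuation_of_algebraMap]
  have hπp : π ∈ p.asIdeal := by
    rw [← intValuation_lt_one_iff_mem, hπi, ← WithZero.exp_zero, WithZero.exp_lt_exp]; norm_num
  have hπp2 : π ∉ p.asIdeal ^ 2 := by
    rw [← intValuation_le_pow_iff_mem, hπi, WithZero.exp_le_exp]; norm_num
  set π' : F := algebraMap (𝓞 F) F π with hπ'
  have hπ0 : π' ≠ 0 := by
    intro h
    rw [h, map_zero] at hπ
    exact WithZero.exp_ne_zero hπ.symm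
  have hwπ1 : w π' < 1 := by rw [hπ, ← WithZero.exp_zero, WithZero.exp_lt_exp]; norm_num
  have hwM : w (M : F) < w π' := by
    have h1 := (intValuation_le_pow_iff_mem p (M : 𝓞 F) 2).mpr hMp
    have h2 : w (M : F) = p.intValuation (M : 𝓞 F) := by
      rw [← valuation_of_algebraMap (K := F)]; simp [hw]
    rw [h2, hπ]
    refine lt_of_le_of_lt h1 ?_
    rw [WithZero.exp_lt_exp]; norm_num
  have hvM : v (M : ℂ) < v (algebraMap F ℂ π') := by
    have h1 : w (M / π') < 1 := by
      rw [map_div₀]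
      exact (div_lt_one₀ (zero_lt_iff.mpr (by simpa using hπ0))).mpr hwM
    have h2 := hlt _ h1
    rw [map_div₀, map_div₀, map_natCast] at h2
    exact (div_lt_one₀ (zero_lt_iff.mpr (by simpa using hπ0))).mp h2
  have hint : ∀ j : ℕ, v (j : ℂ) ≤ 1 := by
    intro j
    have := hle (j : F) (by
      have := p.valuation_le_one (K := F) (j : 𝓞 F)
      simpa using this)
    simpa using this
  -- the polynomial
  let f : F[X] := eisPoly M n π'
  have hfmd := eisPoly_monic M n hn0 π'
  have hirr : Irreducible f := by
    have h1 := eisPoly_irr M n hn0 π p.asIdeal (Ideal.pow_le_self two_ne_zero hMp) hπp hπp2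
    have h2 := ((eisPoly_monic M n hn0 π).1.irreducible_iff_irreducible_map_fraction_map (K := F)).mp h1
    rwa [eisPoly_map] at h2
  obtain ⟨θ, hθ⟩ := IsAlgClosed.exists_aeval_eq_zero ℂ f
    (by rw [degree_eq_natDegree hfmd.1.ne_zero, hfmd.2]; exact_mod_cast hn0)
  have hminpoly : minpoly F θ = f := (minpoly.eq_of_irreducible_of_monic hirr hθ hfmd.1).symm
  have hθi : IsIntegral F θ := ⟨f, hfmd.1, hθ⟩
  let L₀ : IntermediateField F ℂ := F⟮θ⟯
  have : FiniteDimensional F L₀ := IntermediateField.adjoin.finiteDimensional hθi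
  let L : IntermediateField ℚ ℂ := L₀.restrictScalars ℚ
  have hFL : F ≤ L := fun x hx => L₀.algebraMap_mem ⟨x, hx⟩
  have hfinL₀ : FiniteDimensional ℚ L₀ := FiniteDimensional.trans ℚ F L₀
  have hfinL : FiniteDimensional ℚ L := hfinL₀
  have hg1 : aeval (IntermediateField.AdjoinSimple.gen F θ) f = 0 := by
    apply (algebraMap L₀ ℂ).injective
    rw [← aeval_algebraMap_apply, map_zero]
    exact hθ
  -- totally real
  have hL₀ : ∀ φ : L₀ →+* ℂ, ∀ x : L₀, (φ x).im = 0 := by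
    intro φ
    let σ : F →+* ℂ := φ.comp (algebraMap F L₀)
    have hσ : ∀ x, (σ x).im = 0 := hF σ
    have hgen : (φ (IntermediateField.AdjoinSimple.gen F θ)).im = 0 := by
      have h0 : aeval (IntermediateField.AdjoinSimple.gen F θ) f = 0 := hg1
      have h1 : (f.map σ).eval (φ (IntermediateField.AdjoinSimple.gen F θ)) = 0 := by
        rw [aeval_def] at h0
        have := congrArg φ h0
        rw [hom_eval₂, map_zero] at this
        rwa [eval_map]
      rw [eisPoly_map] at h1
      have h2 : ((σ π').re : ℂ) = σ π' := Complex.ext rfl (by simp [hσ])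
      apply roots_real (M : ℝ) (σ π').re hM2 n hn0 _ _ _
      · rw [← Real.norm_eq_abs, ← Complex.norm_real, h2]; exact hMφ σ
      · rw [h2]
        simpa [eisPoly, eval_prod] using h1
    intro x
    obtain ⟨g, -, hg⟩ := (IntermediateField.adjoin.powerBasis hθi).exists_eq_aeval x
    rw [hg, IntermediateField.adjoin.powerBasis_gen, aeval_def, hom_eval₂, eval₂_eq_sum, Polynomial.sum]
    rw [Complex.im_sum]
    refine Finset.sum_eq_zero fun i _ => ?_
    have h2 : ((σ (g.coeff i)).re : ℂ) = σ (g.coeff i) := Complex.ext rfl (by simp [hσ])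
    have h3 : (((φ (IntermediateField.AdjoinSimple.gen F θ)).re : ℝ) : ℂ)
      = φ (IntermediateField.AdjoinSimple.gen F θ) := Complex.ext rfl (by simp [hgen])
    rw [show (φ.comp (algebraMap F L₀)) (g.coeff i) = σ (g.coeff i) from rfl, ← h2, ← h3,
      ← Complex.ofReal_pow, ← Complex.ofReal_mul, Complex.ofReal_im]
  have hL : TotallyReal L := hL₀
  -- norm
  let y : L₀ := a L
  have hnorm : Algebra.norm F y = a F := hcompat F L hF hL hFL
  let pb := IntermediateField.adjoin.powerBasis hθi
  have hdim : pb.dim = n := by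
    rw [IntermediateField.adjoin.powerBasis_dim, hminpoly]; exact hfmd.2
  obtain ⟨c, hc1, hc2⟩ := key (E := ℂ) w v heq hlt pb π' hπ (by
    intro σ
    rw [hdim]
    apply eisPoly_root_val v M n hn0 _ _ hint (hlt _ hwπ1) hvM
    have h0 : aeval pb.gen f = 0 := hg1
    have := congrArg σ h0
    rw [← aeval_algHom_apply, map_zero, aeval_def, ← eval_map, eisPoly_map] at this
    exact this) y (by rw [hnorm]; exact hpa)
  rw [hnorm, hdim] at hc2
  -- c ^ n is congruent to 1
  have hc3 : w (c ^ n - 1) < 1 := by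
    obtain ⟨r, hr⟩ := p.exists_valuation_sub_lt_of_integer (K := F) hc1.le 1
    have hr : w (algebraMap (𝓞 F) F r - c) < 1 := hr
    have hr1 : w (algebraMap (𝓞 F) F r) = 1 := by
      have := w.map_add_eq_of_lt_left (x := c) (y := algebraMap (𝓞 F) F r - c) (by rw [hc1]; exact hr)
      rw [← hc1, ← this]; congr 1; ring
    have hrp : r ∉ p.asIdeal := (valuation_eq_one_iff_notMem p).mp hr1
    have hrn : r ^ n - 1 ∈ p.asIdeal := by
      rw [← Ideal.Quotient.eq_zero_iff_mem, map_sub, map_pow, map_one, sub_eq_zero]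
      have : p.asIdeal.IsMaximal := p.isMaximal
      letI := Ideal.Quotient.field p.asIdeal
      letI := Fintype.ofFinite (𝓞 F ⧸ p.asIdeal)
      rw [hn, hqcard, Nat.card_eq_fintype_card]
      exact FiniteField.pow_card_sub_one_eq_one _ fun h => hrp (Ideal.Quotient.eq_zero_iff_mem.mp h)
    have h1 : w (algebraMap (𝓞 F) F (r ^ n - 1)) < 1 := (valuation_lt_one_iff_mem p _).mpr hrn
    have h2 := prod_close w (Finset.range n) (fun _ => algebraMap (𝓞 F) F r) c hc1 (fun _ _ => hr)
    rw [Finset.prod_const, Finset.card_range] at h2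
    have : c ^ n - 1 = algebraMap (𝓞 F) F (r ^ n - 1) - ((algebraMap (𝓞 F) F r) ^ n - c ^ n) := by
      rw [map_sub, map_pow, map_one]; ring
    rw [this]
    exact w.map_sub_lt h1 h2
  intro hcon
  have h1 := heq _ hcon
  have h2 := hlt _ hc3
  have : algebraMap F ℂ (a F - 1) = (algebraMap F ℂ (a F) - algebraMap F ℂ c ^ n) + algebraMap F ℂ (c ^ n - 1) := by
    simp
  rw [this] at h1
  exact absurd h1 (v.map_add_lt hc2 h2).ne

/-- A norm-compatible family of nonzero elements `a_F ∈ F^×`, indexed by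
the totally real subfields `F` of `ℂ` of finite degree over `ℚ`, is trivial:
`a_F = 1` for every `F`. -/
theorem stmt_10 (a : ∀ F : IntermediateField ℚ ℂ, F)
    (ha : ∀ (F : IntermediateField ℚ ℂ) [FiniteDimensional ℚ F],
      TotallyReal F → a F ≠ 0)
    (hcompat : ∀ (F L : IntermediateField ℚ ℂ)
      [FiniteDimensional ℚ F] [FiniteDimensional ℚ L],
      TotallyReal F → TotallyReal L → ∀ h : F ≤ L, fieldNorm F L h (a L) = a F) :
    ∀ (F : IntermediateField ℚ ℂ) [FiniteDimensional ℚ F], TotallyReal F → a F = 1 := by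
  intro F _ hF
  by_contra h
  have : NumberField F := ⟨⟩
  obtain ⟨p, h1, h2⟩ := exists_prime_units F (a F) (a F - 1) (ha F hF) (sub_ne_zero.mpr h)
  exact stmt_aux a hcompat F hF p h1 h2
end

section
/- Let (a_F)_F be a family indexed by the totally real subfields F of ℂ of finite degree over ℚ, where a_F ∈ F^× is a nonzero element of F, and suppose that whenever F ⊆ L are two such fields, Nm_{L/F}(a_L)·a_F^{-1} is a unit of the ring of integers 𝓞_F. Then every a_F is itself a unit of 𝓞_F. (Equivalently, the inverse limit over totally real fields of the groups F^×/U(F), where U(F) = 𝓞_F^×, under the norm maps is trivial.) -/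
open NumberField IntermediateField

open FractionalIdeal in
lemma dvd_count_relNorm {F L : Type*} [Field F] [NumberField F] [Field L] [NumberField L]
    [Algebra F L] (v : IsDedekindDomain.HeightOneSpectrum (𝓞 F)) (N : ℕ)
    (hN : ∀ P : Ideal (𝓞 L), P.IsMaximal → P.LiesOver v.asIdeal → N ∣ P.inertiaDeg (𝓞 F))
    (I : Ideal (𝓞 L)) (hI : I ≠ 0) :
    (N : ℤ) ∣ count F v (Ideal.relNorm (𝓞 F) I : FractionalIdeal (nonZeroDivisors (𝓞 F)) F) := by
  induction I using UniqueFactorizationMonoid.induction_on_prime with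
  | h₁ => exact absurd rfl hI
  | h₂ x hx =>
    rw [Ideal.isUnit_iff] at hx
    subst hx
    simp [count_one]
  | h₃ a p ha0 hp ih =>
    have hp0 : p ≠ ⊥ := hp.ne_zero
    rw [map_mul, coeIdeal_mul, count_mul]
    · refine dvd_add ?_ (ih ha0)
      have hpp : p.IsPrime := Ideal.isPrime_of_prime hp
      have hpm : p.IsMaximal := hpp.isMaximal hp0
      have hum : (p.under (𝓞 F)).IsMaximal := inferInstance
      have hu0 : p.under (𝓞 F) ≠ ⊥ := Ideal.IsIntegral.comap_ne_bot (R := 𝓞 F) hp0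
      rw [Ideal.relNorm_eq_pow_of_isMaximal p (p.under (𝓞 F)), coeIdeal_pow, count_pow]
      by_cases hv : p.under (𝓞 F) = v.asIdeal
      · exact Dvd.dvd.mul_right (Int.natCast_dvd_natCast.2 (hN p hpm ⟨hv.symm⟩)) _
      · let w : IsDedekindDomain.HeightOneSpectrum (𝓞 F) := ⟨p.under (𝓞 F), hum.isPrime, hu0⟩
        have := count_maximal_coprime F v (w := w) (fun h => hv (by rw [← h]))
        change count F v (p.under (𝓞 F) : FractionalIdeal (nonZeroDivisors (𝓞 F)) F) = 0 at this
        rw [this]; simp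
    · rw [coeIdeal_ne_zero]; simpa using hp0
    · rw [coeIdeal_ne_zero]; simpa using ha0

open FractionalIdeal in
lemma dvd_count_norm {F L : Type*} [Field F] [NumberField F] [Field L] [NumberField L]
    [Algebra F L] (v : IsDedekindDomain.HeightOneSpectrum (𝓞 F)) (N : ℕ)
    (hN : ∀ P : Ideal (𝓞 L), P.IsMaximal → P.LiesOver v.asIdeal → N ∣ P.inertiaDeg (𝓞 F))
    (x : L) (hx : x ≠ 0) :
    (N : ℤ) ∣ count F v (spanSingleton (nonZeroDivisors (𝓞 F)) (Algebra.norm F x)) := by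
  have key : ∀ y : 𝓞 L, y ≠ 0 → (N : ℤ) ∣
      count F v (spanSingleton (nonZeroDivisors (𝓞 F)) (Algebra.norm F (y : L))) := by
    intro y hy
    have := dvd_count_relNorm v N hN (Ideal.span {y}) (by simpa using hy)
    rw [Ideal.relNorm_singleton, coeIdeal_span_singleton,
      Algebra.algebraMap_intNorm (K := F) (L := L)] at this
    exact this
  obtain ⟨y, z, hz, hyz⟩ := IsFractionRing.div_surjective (A := 𝓞 L) x
  have hz0 : z ≠ 0 := nonZeroDivisors.ne_zero hz
  have hzL : (algebraMap (𝓞 L) L z) ≠ 0 := by simpa using hz0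
  have hy0 : y ≠ 0 := by rintro rfl; simp at hyz; exact hx hyz.symm
  have h1 := key y hy0
  have h2 := key z hz0
  have hmul : (y : L) = x * (z : L) := by
    rw [← hyz]; exact (div_mul_cancel₀ _ hzL).symm
  rw [hmul, map_mul, ← spanSingleton_mul_spanSingleton, count_mul] at h1
  · exact (dvd_add_left h2).1 h1
  · rw [spanSingleton_ne_zero_iff, Ne, Algebra.norm_eq_zero_iff]; exact hx
  · rw [spanSingleton_ne_zero_iff, Ne, Algebra.norm_eq_zero_iff]; exact hzL

open FractionalIdeal in
lemma isUnit_of_count {F : Type*} [Field F] [NumberField F] (a : F) (ha : a ≠ 0)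
    (h : ∀ v : IsDedekindDomain.HeightOneSpectrum (𝓞 F),
      count F v (spanSingleton (nonZeroDivisors (𝓞 F)) a) = 0) :
    ∃ u : (𝓞 F)ˣ, a = ((u : 𝓞 F) : F) := by
  have h0 : spanSingleton (nonZeroDivisors (𝓞 F)) a ≠ 0 := spanSingleton_ne_zero_iff.2 ha
  have h1 := finprod_heightOneSpectrum_factorization' F h0
  simp only [h, zpow_zero, finprod_one] at h1
  have h2 : (spanSingleton (nonZeroDivisors (𝓞 F)) a⁻¹) = 1 := by
    rw [← spanSingleton_inv, ← h1, inv_one]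
  have m1 : a ∈ (1 : FractionalIdeal (nonZeroDivisors (𝓞 F)) F) := by
    rw [h1]; exact mem_spanSingleton_self _ _
  have m2 : a⁻¹ ∈ (1 : FractionalIdeal (nonZeroDivisors (𝓞 F)) F) := by
    rw [← h2]; exact mem_spanSingleton_self _ _
  rw [mem_one_iff] at m1 m2
  obtain ⟨x, hx⟩ := m1
  obtain ⟨y, hy⟩ := m2
  have hxy : x * y = 1 := by
    apply FaithfulSMul.algebraMap_injective (𝓞 F) F
    rw [map_mul, hx, hy, map_one, mul_inv_cancel₀ ha]
  exact ⟨⟨x, y, hxy, by rw [mul_comm, hxy]⟩, hx.symm⟩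

open FractionalIdeal in
lemma count_unit {F : Type*} [Field F] [NumberField F] (u : (𝓞 F)ˣ)
    (v : IsDedekindDomain.HeightOneSpectrum (𝓞 F)) :
      count F v (spanSingleton (nonZeroDivisors (𝓞 F)) ((u : 𝓞 F) : F)) = 0 := by
  have : spanSingleton (nonZeroDivisors (𝓞 F)) ((u : 𝓞 F) : F) =
     ((Ideal.span {(u : 𝓞 F)} : Ideal (𝓞 F)) : FractionalIdeal (nonZeroDivisors (𝓞 F)) F) := by
    rw [coeIdeal_span_singleton]
  rw [this, Ideal.span_singleton_eq_top.2 u.isUnit, coeIdeal_top, count_one]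

lemma dvd_of_pow_sub_one_dvd {q n m : ℕ} (hq : 2 ≤ q) (h : q ^ n - 1 ∣ q ^ m - 1) : n ∣ m := by
  have h1 := Nat.gcd_eq_left h
  rw [Nat.pow_sub_one_gcd_pow_sub_one] at h1
  have h2 : q ^ n.gcd m = q ^ n := by
    have := Nat.one_le_pow n q (by lia)
    have := Nat.one_le_pow (n.gcd m) q (by lia)
    lia
  exact Nat.gcd_eq_left_iff_dvd.1 (Nat.pow_right_injective hq h2)

set_option linter.deprecated false in
lemma dvd_inertiaDeg {F L M : Type*} [Field F] [NumberField F] [Field L] [NumberField L]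
    [Field M] [NumberField M] [Algebra F L] [Algebra L M]
    (v : IsDedekindDomain.HeightOneSpectrum (𝓞 F)) (N : ℕ) (hN : 1 ≤ N)
    (hLM : Module.finrank L M ≤ 2) (ζ : M)
    (hζ : IsPrimitiveRoot ζ (Ideal.absNorm v.asIdeal ^ (2 * N) - 1))
    (P : Ideal (𝓞 L)) (hP : P.IsMaximal) (hPv : P.LiesOver v.asIdeal) :
    N ∣ P.inertiaDeg (𝓞 F) := by
  obtain ⟨Q, hQ, hQP⟩ : ∃ Q : Ideal (𝓞 M), Q.IsMaximal ∧ Q.LiesOver P :=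
    Ideal.exists_maximal_ideal_liesOver_of_isIntegral P
  set q := Ideal.absNorm v.asIdeal with hqdef
  have hq0 : q ≠ 0 := by
    rw [hqdef, Ne, Ideal.absNorm_eq_zero_iff]; exact v.ne_bot
  have hq1 : q ≠ 1 := by
    rw [hqdef, Ne, Ideal.absNorm_eq_one_iff]; exact v.isPrime.ne_top
  have hq : 2 ≤ q := by lia
  have e1 : q ^ P.inertiaDeg (𝓞 F) = Ideal.absNorm P := Ideal.absNorm_pow_inertiaDeg v.asIdeal P
  have e2 : Ideal.absNorm P ^ Q.inertiaDeg (𝓞 L) = Ideal.absNorm Q :=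
    Ideal.absNorm_pow_inertiaDeg P Q
  have hP0 : P ≠ ⊥ := by
    intro h
    rw [h, Ideal.absNorm_bot] at e1
    exact hq0 (eq_zero_of_pow_eq_zero e1)
  rw [← e1, ← pow_mul] at e2
  have hle : Q.inertiaDeg (𝓞 L) ≤ 2 := by
    rw [← Ideal.inertiaDeg'_eq_inertiaDeg P Q]
    have : NoZeroSMulDivisors (𝓞 L) (𝓞 M) := ⟨fun h => smul_eq_zero.1 h⟩
    exact (Ideal.inertiaDeg_le_finrank (𝓞 M) L M Q hP0).trans hLM
  have hpow : 2 ≤ q ^ (2 * N) := le_trans hq (Nat.le_self_pow (by lia) q)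
  have : NeZero (q ^ (2 * N) - 1) := ⟨by lia⟩
  have hζ' : IsPrimitiveRoot hζ.toInteger (q ^ (2 * N) - 1) := hζ.toInteger_isPrimitiveRoot
  have hcop : (Ideal.absNorm Q).Coprime (q ^ (2 * N) - 1) := by
    rw [← e2]
    apply Nat.Coprime.pow_left
    have h3 : Nat.Coprime (q ^ (2 * N)) (q ^ (2 * N) - 1) := by
      rw [Nat.coprime_self_sub_right (by lia)]; simp
    exact Nat.Coprime.coprime_dvd_left (dvd_pow_self q (by lia)) h3
  have hred := IsPrimitiveRoot.idealQuotient_mk (I := Q) hζ'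
    (by rw [Ne, Ideal.absNorm_eq_one_iff]; exact hQ.ne_top) hcop
  let _ := Ideal.Quotient.field Q
  have hQ0 : Ideal.absNorm Q ≠ 0 := by rw [← e2]; exact pow_ne_zero _ hq0
  have hcard : Nat.card (𝓞 M ⧸ Q) = Ideal.absNorm Q := rfl
  have hfin : Finite (𝓞 M ⧸ Q) := Nat.finite_of_card_ne_zero (hcard ▸ hQ0)
  have hdvd : q ^ (2 * N) - 1 ∣ q ^ (P.inertiaDeg (𝓞 F) * Q.inertiaDeg (𝓞 L)) - 1 := by
    rw [e2, ← hcard, hred.eq_orderOf, ← Nat.card_units]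
    have := orderOf_dvd_natCard (hred.isUnit (NeZero.ne _)).unit
    rwa [← orderOf_units] at this
  have hd := dvd_of_pow_sub_one_dvd hq hdvd
  interval_cases hh : Q.inertiaDeg (𝓞 L)
  · have := Ideal.inertiaDeg_pos Q (𝓞 L); lia
  · rw [mul_one] at hd; exact (Dvd.intro_left 2 rfl).trans hd
  · rw [mul_comm] at hd; exact Nat.dvd_of_mul_dvd_mul_right (by norm_num) hd

lemma exists_ext_ringHom {K M Ω : Type*} [Field K] [Field M] [Field Ω] [IsAlgClosed Ω]
    [Algebra K M] [Algebra.IsAlgebraic K M] (φ : K →+* Ω) :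
    ∃ ψ : M →+* Ω, ∀ x, ψ (algebraMap K M x) = φ x := by
  letI := φ.toAlgebra
  let f : M →ₐ[K] Ω := IsAlgClosed.lift
  exact ⟨f.toRingHom, fun x => f.commutes x⟩

lemma finrank_adjoin_le (L : IntermediateField ℚ ℂ) (ζ : ℂ) (hζ0 : ζ ≠ 0) (ht : ζ + ζ⁻¹ ∈ L) :
    IsIntegral L ζ ∧ Module.finrank L L⟮ζ⟯ ≤ 2 := by
  let p : Polynomial L :=
    Polynomial.X ^ 2 + (Polynomial.C (-(⟨_, ht⟩ : L)) * Polynomial.X + Polynomial.C 1)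
  have hdeg : (Polynomial.C (-(⟨_, ht⟩ : L)) * Polynomial.X + Polynomial.C 1).degree < 2 :=
    lt_of_le_of_lt Polynomial.degree_linear_le (by norm_num)
  have hm : p.Monic := Polynomial.monic_X_pow_add hdeg
  have hd : p.natDegree = 2 := by
    apply Polynomial.natDegree_eq_of_degree_eq_some
    have := Polynomial.degree_add_eq_left_of_degree_lt
      (p := (Polynomial.X ^ 2 : Polynomial L))
      (q := Polynomial.C (-(⟨_, ht⟩ : L)) * Polynomial.X + Polynomial.C 1) (by rw [Polynomial.degree_X_pow]; exact hdeg)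
    rw [Polynomial.degree_X_pow] at this
    exact this
  have hev : Polynomial.aeval ζ p = 0 := by
    simp [p, IntermediateField.algebraMap_apply]
    field_simp
    ring
  have hi : IsIntegral L ζ := ⟨p, hm, hev⟩
  refine ⟨hi, ?_⟩
  rw [IntermediateField.adjoin.finrank hi, ← hd]
  exact Polynomial.natDegree_le_of_dvd (minpoly.dvd _ _ hev) hm.ne_zero

lemma totallyReal_sup (F : IntermediateField ℚ ℂ) (hF : TotallyReal F) (ζ : ℂ) (m : ℕ)
    (hm : m ≠ 0) (hζ : ζ ^ m = 1) : TotallyReal (F ⊔ ℚ⟮ζ + ζ⁻¹⟯) := by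
  have hζ0 : ζ ≠ 0 := by rintro rfl; simp [hm] at hζ
  set L := F ⊔ ℚ⟮ζ + ζ⁻¹⟯ with hL
  intro φ
  have htL : ζ + ζ⁻¹ ∈ L := (le_sup_right : _ ≤ L) (IntermediateField.mem_adjoin_simple_self _ _)
  have hFL : F ≤ L := le_sup_left
  have hint := (finrank_adjoin_le L ζ hζ0 htL).1
  have : Algebra.IsAlgebraic L L⟮ζ⟯ := IntermediateField.isAlgebraic_adjoin_simple hint
  obtain ⟨ψ, hψ⟩ := exists_ext_ringHom (M := L⟮ζ⟯) φ
  let z : L⟮ζ⟯ := IntermediateField.AdjoinSimple.gen L ζ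
  have hz : (z : ℂ) = ζ := IntermediateField.AdjoinSimple.coe_gen L ζ
  have hzm : z ^ m = 1 := by
    apply Subtype.ext
    push_cast
    rw [hz, hζ]
  have htz : algebraMap L L⟮ζ⟯ ⟨_, htL⟩ = z + z⁻¹ := by
    apply Subtype.ext
    push_cast
    rw [hz]; rfl
  have hreal : (φ ⟨_, htL⟩).im = 0 := by
    rw [← hψ, htz, map_add, map_inv₀]
    have h1 : (ψ z) ^ m = 1 := by rw [← map_pow, hzm, map_one]
    have h2 : ‖ψ z‖ = 1 := Complex.norm_eq_one_of_pow_eq_one h1 hm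
    rw [Complex.inv_eq_conj h2]
    simp
  let S : Subfield L := (Complex.ofRealHom.fieldRange).comap φ
  have hS : ∀ x : L, x ∈ S ↔ (φ x).im = 0 := by
    intro x
    constructor
    · rintro ⟨r, hr⟩; rw [← hr]; exact Complex.ofReal_im r
    · intro h; exact ⟨(φ x).re, Complex.ext (by simp) (by simp [h])⟩
  let T : IntermediateField ℚ ℂ := (S.map L.val.toRingHom).toIntermediateField (by
    intro x
    exact ⟨algebraMap ℚ L x, (hS _).2 (by simp), by simp⟩)
  have hT : L ≤ T := by
    refine sup_le ?_ ?_
    · intro x hx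
      exact ⟨⟨x, hFL hx⟩, (hS _).2 (hF (φ.comp (IntermediateField.inclusion hFL).toRingHom) ⟨x, hx⟩),
        rfl⟩
    · rw [IntermediateField.adjoin_simple_le_iff]
      exact ⟨⟨_, htL⟩, (hS _).2 hreal, rfl⟩
  intro x
  obtain ⟨y, hy, hyx⟩ := hT x.2
  have : y = x := Subtype.ext hyx
  rw [← this]
  exact (hS _).1 hy

/-- If `(a_F)_F`, indexed by the totally real subfields `F` of `ℂ` of
finite degree over `ℚ`, is a family of nonzero elements `a_F ∈ F^×` with
`Nm_{L/F}(a_L)·a_F⁻¹` a unit of `𝓞_F` whenever `F ⊆ L`, then every `a_F` is a unit of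
`𝓞_F`. -/
theorem stmt_12 (a : ∀ F : IntermediateField ℚ ℂ, F)
    (ha : ∀ (F : IntermediateField ℚ ℂ) [FiniteDimensional ℚ F],
      TotallyReal F → a F ≠ 0)
    (hcompat : ∀ (F L : IntermediateField ℚ ℂ)
      [FiniteDimensional ℚ F] [FiniteDimensional ℚ L],
      TotallyReal F → TotallyReal L → ∀ h : F ≤ L,
      ∃ u : (𝓞 F)ˣ, fieldNorm F L h (a L) * (a F)⁻¹ = ((u : 𝓞 F) : F)) :
    ∀ (F : IntermediateField ℚ ℂ) [FiniteDimensional ℚ F], TotallyReal F →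
      ∃ u : (𝓞 F)ˣ, a F = ((u : 𝓞 F) : F) := by
  intro F _ hF
  have ha0 := ha F hF
  refine isUnit_of_count (a F) ha0 fun v => ?_
  have key : ∀ N : ℕ, 1 ≤ N → (N : ℤ) ∣ FractionalIdeal.count F v
      (FractionalIdeal.spanSingleton (nonZeroDivisors (𝓞 F)) (a F)) := by
    intro N hN
    set q := Ideal.absNorm v.asIdeal with hqdef
    have hq0 : q ≠ 0 := by
      rw [hqdef, Ne, Ideal.absNorm_eq_zero_iff]; exact v.ne_bot
    have hq1 : q ≠ 1 := by
      rw [hqdef, Ne, Ideal.absNorm_eq_one_iff]; exact v.isPrime.ne_top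
    have hpow : 2 ≤ q ^ (2 * N) :=
      le_trans (by lia : 2 ≤ q) (Nat.le_self_pow (by lia) q)
    have hm : q ^ (2 * N) - 1 ≠ 0 := by lia
    obtain ⟨ζ, hζ⟩ : ∃ ζ : ℂ, IsPrimitiveRoot ζ (q ^ (2 * N) - 1) :=
      ⟨_, Complex.isPrimitiveRoot_exp _ hm⟩
    have hζ0 : ζ ≠ 0 := hζ.ne_zero hm
    have hL := totallyReal_sup F hF ζ _ hm hζ.pow_eq_one
    have hFL : F ≤ F ⊔ ℚ⟮ζ + ζ⁻¹⟯ := le_sup_left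
    have htL : ζ + ζ⁻¹ ∈ F ⊔ ℚ⟮ζ + ζ⁻¹⟯ :=
      (le_sup_right : ℚ⟮ζ + ζ⁻¹⟯ ≤ F ⊔ ℚ⟮ζ + ζ⁻¹⟯) (IntermediateField.mem_adjoin_simple_self _ _)
    have hζi : IsIntegral ℚ ζ :=
      IsIntegral.of_pow (Nat.pos_of_ne_zero hm) (by rw [hζ.pow_eq_one]; exact isIntegral_one)
    have hfd : FiniteDimensional ℚ ℚ⟮ζ + ζ⁻¹⟯ :=
      IntermediateField.adjoin.finiteDimensional (hζi.add hζi.inv)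
    have hLfd : FiniteDimensional ℚ ↥(F ⊔ ℚ⟮ζ + ζ⁻¹⟯) := IntermediateField.finiteDimensional_sup _ _
    generalize F ⊔ ℚ⟮ζ + ζ⁻¹⟯ = L at hL hFL htL hLfd
    obtain ⟨hint, hrank⟩ := finrank_adjoin_le L ζ hζ0 htL
    have : FiniteDimensional L L⟮ζ⟯ := IntermediateField.adjoin.finiteDimensional hint
    have : FiniteDimensional ℚ L⟮ζ⟯ := FiniteDimensional.trans ℚ L L⟮ζ⟯
    have : NumberField L⟮ζ⟯ := NumberField.of_module_finite ℚ L⟮ζ⟯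
    obtain ⟨u, hu⟩ := hcompat F L hF hL hFL
    letI : Algebra F L := (IntermediateField.inclusion hFL).toRingHom.toAlgebra
    have hz : IsPrimitiveRoot (IntermediateField.AdjoinSimple.gen L ζ) (q ^ (2 * N) - 1) := by
      apply IsPrimitiveRoot.of_map_of_injective (f := L⟮ζ⟯.val) _ L⟮ζ⟯.val.injective
      simpa using hζ
    have hd := dvd_count_norm v N
      (fun P hP hPv => dvd_inertiaDeg v N hN hrank _ hz P hP hPv) (a L) (ha L hL)
    have hu' : Algebra.norm F (a L) = ((u : 𝓞 F) : F) * a F := by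
      rw [← hu, inv_mul_cancel_right₀ ha0]; rfl
    rw [hu', ← FractionalIdeal.spanSingleton_mul_spanSingleton, FractionalIdeal.count_mul,
      count_unit, zero_add] at hd
    · exact hd
    · rw [FractionalIdeal.spanSingleton_ne_zero_iff]; simp
    · rw [FractionalIdeal.spanSingleton_ne_zero_iff]; exact ha0
  have := key (Int.natAbs (FractionalIdeal.count F v
      (FractionalIdeal.spanSingleton (nonZeroDivisors (𝓞 F)) (a F))) + 1) (by lia)
  refine Int.eq_zero_of_dvd_of_natAbs_lt_natAbs this ?_
  rw [Int.natAbs_natCast]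
  lia
end
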